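/- Let R = R_s, Λ = R ⊗_K R^{op}, let ⋯ → Q_1 → Q_0 → R → 0 be the minimal projective Λ-resolution of R with differentials d_t: Q_{t+1} → Q_t, and let δ^t = Hom_Λ(d_t, R): Hom_Λ(Q_t, R) → Hom_Λ(Q_{t+1}, R) be the induced coboundary maps. For t ∈ ℕ write t = 11ℓ + r with 0 ≤ r ≤ 10, set n = 6 and m = ⌊r/2⌋, and read all congruences mod s. Then dim_K Im δ^t equals: for r = 0: 6s−1 if ℓn+m≡0 and ℓ even, 2s if ℓn+m≡0 and ℓ odd, else 0; for r = 1: s if ℓn+m≡0 and ℓ even, 3s−1 if ℓn+m≡0 and ℓ odd, else 0; for r = 2: 3s if ℓn+m≡0 and ℓ even, s if ℓn+m≡0 and ℓ odd, else 0; for r = 3: if ℓn+m≡0 and ℓ even, 5s−1 when char K = 2 and 5s when char K ≠ 2, 7s−1 if ℓn+m≡0 and ℓ odd, else 0; for r = 4: 2s if ℓn+m≡0 and ℓ even; if ℓn+m≡0 and ℓ odd, 6s−1 when char K = 3 and 6s when char K ≠ 3; else 0; for r = 5: if ℓn+m≡0 and ℓ even, 6s−1 when char K = 3 and 6s when char K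 ≠ 3, 2s if ℓn+m≡0 and ℓ odd, else 0; for r = 6: 7s−1 if ℓn+m≡0 and ℓ even; if ℓn+m≡0 and ℓ odd, 5s−1 when char K = 2 and 5s when char K ≠ 2; else 0; for r = 7: s if ℓn+m≡0 and ℓ even, 3s if ℓn+m≡0 and ℓ odd, else 0; for r = 8: 3s−1 if ℓn+m≡0 and ℓ even, s if ℓn+m≡0 and ℓ odd, else 0; for r = 9: 2s if ℓn+m≡0 and ℓ even, 6s−1 if ℓn+m≡0 and ℓ odd, else 0; for r = 10: 2s if ℓn+m≡0 and ℓ even; if ℓn+m≡0 and ℓ odd, 6s−1 when char K = 3 and 6s when char K ≠ 3; else 0. -/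

import Mathlib

open scoped TensorProduct

set_option synthInstance.maxHeartbeats 1000000
set_option maxHeartbeats 2000000

universe u v

namespace E6

/-- Generators of the presentation of the path algebra of the quiver `𝒬ₛ`:
trivial paths `e i`, arrows `a i` (the `αᵢ`), `b i` (the `βᵢ`) and `g i` (the `γᵢ`). -/
inductive Gen (s : ℕ) : Type
  | e (i : ZMod (6 * s))
  | a (i : ZMod (3 * s))
  | b (i : ZMod (3 * s))
  | g (i : ZMod s)

variable (K : Type u) [Field K] (s : ℕ)

/-- The free algebra on the generators. -/
abbrev F : Type u := FreeAlgebra K (Gen s)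

/-- Trivial path generators. -/
noncomputable def E (i : ZMod (6 * s)) : F K s := FreeAlgebra.ι K (Gen.e i)
/-- `α` arrow generators. -/
noncomputable def A (i : ZMod (3 * s)) : F K s := FreeAlgebra.ι K (Gen.a i)
/-- `β` arrow generators. -/
noncomputable def B (i : ZMod (3 * s)) : F K s := FreeAlgebra.ι K (Gen.b i)
/-- `γ` arrow generators. -/
noncomputable def G (i : ZMod s) : F K s := FreeAlgebra.ι K (Gen.g i)

/-- Source vertex of the arrow `αᵢ` : writing `i = 3t + j` with `j < 3`,
`α_{3t} : 6t → 6t+1`, `α_{3t+1} : 6t+1 → 6t+2`, `α_{3t+2} : 6t+2 → 6t+5`. -/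
def aSrc (i : ZMod (3 * s)) : ZMod (6 * s) := ((2 * i.val - i.val % 3 : ℕ) : ZMod (6 * s))

/-- Target vertex of the arrow `αᵢ`. -/
def aTgt (i : ZMod (3 * s)) : ZMod (6 * s) :=
  if i.val % 3 = 1 then ((2 * i.val : ℕ) : ZMod (6 * s)) else ((2 * i.val + 1 : ℕ) : ZMod (6 * s))

/-- Source vertex of the arrow `βᵢ` : `β_{3t} : 6t → 6t+3`, `β_{3t+1} : 6t+3 → 6t+4`,
`β_{3t+2} : 6t+4 → 6t+5`. -/
def bSrc (i : ZMod (3 * s)) : ZMod (6 * s) :=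
  if i.val % 3 = 1 then ((2 * i.val + 1 : ℕ) : ZMod (6 * s)) else ((2 * i.val : ℕ) : ZMod (6 * s))

/-- Target vertex of the arrow `βᵢ`. -/
def bTgt (i : ZMod (3 * s)) : ZMod (6 * s) := ((2 * i.val + 3 - i.val % 3 : ℕ) : ZMod (6 * s))

/-- Source vertex of the arrow `γₜ : 6t+5 → 6t+6`. -/
def gSrc (i : ZMod s) : ZMod (6 * s) := ((6 * i.val + 5 : ℕ) : ZMod (6 * s))

/-- Target vertex of the arrow `γₜ`. -/
def gTgt (i : ZMod s) : ZMod (6 * s) := ((6 * i.val + 6 : ℕ) : ZMod (6 * s))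

/-- The set of arrow generators inside the free algebra. -/
noncomputable def arrows : Set (F K s) :=
  Set.range (A K s) ∪ Set.range (B K s) ∪ Set.range (G K s)

/-- The relations presenting `R_s = K[𝒬ₛ]/I₀` as a quotient of the free algebra on the
trivial paths and the arrows.  The first eight families of relations present the path
algebra `K[𝒬ₛ]` (the trivial paths are orthogonal idempotents summing to `1`, and each
arrow is fixed by multiplication with the trivial paths at its target, resp. source);
the remaining relations generate the ideal `I₀`: all paths of length `5` vanish
(equivalently, all products of five arrows), `α_{3t+2}α_{3t+1}α_{3t} = β_{3t+2}β_{3t+1}β_{3t}`,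
and `α_{3t+3}γ_tβ_{3t+2} = 0 = β_{3t+3}γ_tα_{3t+2}`. -/
inductive Rel : F K s → F K s → Prop
  | idem (i j : ZMod (6 * s)) :
      Rel (E K s i * E K s j) (if i = j then E K s i else 0)
  | sum_one :
      Rel (∑ i ∈ Finset.range (6 * s), E K s (i : ZMod (6 * s))) 1
  | a_tgt (i : ZMod (3 * s)) : Rel (E K s (aTgt s i) * A K s i) (A K s i)
  | a_src (i : ZMod (3 * s)) : Rel (A K s i * E K s (aSrc s i)) (A K s i)
  | b_tgt (i : ZMod (3 * s)) : Rel (E K s (bTgt s i) * B K s i) (B K s i)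
  | b_src (i : ZMod (3 * s)) : Rel (B K s i * E K s (bSrc s i)) (B K s i)
  | g_tgt (i : ZMod s) : Rel (E K s (gTgt s i) * G K s i) (G K s i)
  | g_src (i : ZMod s) : Rel (G K s i * E K s (gSrc s i)) (G K s i)
  | len5 (x₁ x₂ x₃ x₄ x₅ : F K s) (h₁ : x₁ ∈ arrows K s) (h₂ : x₂ ∈ arrows K s)
      (h₃ : x₃ ∈ arrows K s) (h₄ : x₄ ∈ arrows K s) (h₅ : x₅ ∈ arrows K s) :
      Rel (x₁ * x₂ * x₃ * x₄ * x₅) 0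
  | comm (t : Fin s) :
      Rel (A K s ((3 * (t : ℕ) + 2 : ℕ) : ZMod (3 * s)) *
             A K s ((3 * (t : ℕ) + 1 : ℕ) : ZMod (3 * s)) *
             A K s ((3 * (t : ℕ) : ℕ) : ZMod (3 * s)))
          (B K s ((3 * (t : ℕ) + 2 : ℕ) : ZMod (3 * s)) *
             B K s ((3 * (t : ℕ) + 1 : ℕ) : ZMod (3 * s)) *
             B K s ((3 * (t : ℕ) : ℕ) : ZMod (3 * s)))
  | zero_agb (t : Fin s) :
      Rel (A K s ((3 * (t : ℕ) + 3 : ℕ) : ZMod (3 * s)) * G K s (((t : ℕ) : ℕ) : ZMod s) *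
             B K s ((3 * (t : ℕ) + 2 : ℕ) : ZMod (3 * s))) 0
  | zero_bga (t : Fin s) :
      Rel (B K s ((3 * (t : ℕ) + 3 : ℕ) : ZMod (3 * s)) * G K s (((t : ℕ) : ℕ) : ZMod s) *
             A K s ((3 * (t : ℕ) + 2 : ℕ) : ZMod (3 * s))) 0

/-- The self-injective algebra `R_s` of tree class `E₆`, i.e. the quotient
`K[𝒬ₛ]/I₀` of the path algebra of `𝒬ₛ`, presented by generators and relations. -/
abbrev Alg : Type u := RingQuot (Rel K s)

/-- A canonical `Semiring` instance on `R_s`, routed through the `Ring` structure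
(this keeps instance paths on `R_s` coherent). -/
noncomputable instance (priority := 1100) : Semiring (Alg K s) :=
  Ring.toSemiring

/-- The images `e_i` in `R_s` of the trivial paths. -/
noncomputable def ee (i : ZMod (6 * s)) : Alg K s :=
  RingQuot.mkAlgHom K (Rel K s) (E K s i)

/-- The images `α_i` in `R_s` of the arrows `α`. -/
noncomputable def aa (i : ZMod (3 * s)) : Alg K s :=
  RingQuot.mkAlgHom K (Rel K s) (A K s i)

/-- The images `β_i` in `R_s` of the arrows `β`. -/
noncomputable def bb (i : ZMod (3 * s)) : Alg K s :=
  RingQuot.mkAlgHom K (Rel K s) (B K s i)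

/-- The images `γ_i` in `R_s` of the arrows `γ`. -/
noncomputable def gg (i : ZMod s) : Alg K s :=
  RingQuot.mkAlgHom K (Rel K s) (G K s i)

/-! ### The enveloping algebra `Λ = R ⊗ₖ Rᵐᵒᵖ` and the outer bimodule structure on `R` -/

/-- The enveloping algebra `Λ = R_s ⊗[K] R_sᵐᵒᵖ`. -/
abbrev Env : Type u := Alg K s ⊗[K] (Alg K s)ᵐᵒᵖ

/-- A canonical `Semiring` instance on `Λ`, routed through the `Ring` structure
(this keeps instance paths on `Λ` coherent). -/
noncomputable instance (priority := 1100) : Semiring (Env K s) :=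
  Ring.toSemiring

/-- `R_s` is a left `Λ`-module via the outer action `(a ⊗ b) • r = a * r * b.unop`. -/
noncomputable instance : Module (Env K s) (Alg K s) :=
  TensorProduct.Algebra.module


instance : SMulCommClass (Env K s) K (Alg K s) where
  smul_comm l k r := by
    induction l using TensorProduct.induction_on with
    | zero => simp
    | tmul a b =>
        show a • b • (k • r) = k • (a • b • r)
        rw [smul_comm b k r, smul_comm a k (b • r)]
    | add x y hx hy =>
        rw [add_smul, add_smul, smul_add, hx, hy]

instance : IsScalarTower K (Env K s) (Alg K s) where
  smul_assoc k l r := by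
    induction l using TensorProduct.induction_on with
    | zero => simp
    | tmul a b =>
        show ((k • a) ⊗ₜ[K] b) • r = k • (a ⊗ₜ[K] b) • r
        show (k • a) • b • r = k • (a • (b • r))
        rw [smul_assoc]
    | add x y hx hy =>
        rw [smul_add, add_smul, add_smul, hx, hy, smul_add]

/-! ### Projective and simple modules -/

/-- The quotient of a module by a submodule (as a type). -/
def modQuot {R : Type v} [Ring R] {M : Type*} [AddCommGroup M] [Module R M]
    (p : Submodule R M) : Type _ := M ⧸ p

noncomputable instance {R : Type v} [Ring R] {M : Type*} [AddCommGroup M] [Module R M]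
    (p : Submodule R M) : AddCommGroup (modQuot p) :=
  inferInstanceAs (AddCommGroup (M ⧸ p))

noncomputable instance {R : Type v} [Ring R] {M : Type*} [AddCommGroup M] [Module R M]
    (p : Submodule R M) : Module R (modQuot p) :=
  inferInstanceAs (Module R (M ⧸ p))

/-- Right multiplication by a fixed element, as an endomorphism of the left regular module. -/
def rmul (Λ : Type v) [Ring Λ] (x : Λ) : Λ →ₗ[Λ] Λ where
  toFun y := y * x
  map_add' a b := add_mul a b x
  map_smul' r a := mul_assoc r a x

/-- The Jacobson radical of the ring `Λ` times the `Λ`-module `M`, i.e. the submodule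
`rad(Λ)·M` generated by all products `r • x` with `r` in the Jacobson radical of `Λ`
(the Jacobson radical being the intersection of all maximal left ideals). -/
def radSMul (Λ : Type v) [Ring Λ] (M : Type w) [AddCommGroup M] [Module Λ M] :
    Submodule Λ M :=
  Submodule.span Λ {z | ∃ r ∈ (⊥ : Ideal Λ).jacobson, ∃ x : M, z = r • x}

/-- The indecomposable projective left `R_s`-module `P_i = R_s·e_i`. -/
noncomputable def P (i : ZMod (6 * s)) : Submodule (Alg K s) (Alg K s) :=
  LinearMap.range (rmul (Alg K s) (ee K s i))

/-- The simple left `R_s`-module `S_i = P_i / rad(P_i)` at the vertex `i`. -/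
noncomputable def S (i : ZMod (6 * s)) : Type u :=
  modQuot (radSMul (Alg K s) ↥(P K s i))

noncomputable instance (i : ZMod (6 * s)) : AddCommGroup (S K s i) :=
  inferInstanceAs (AddCommGroup (modQuot (radSMul (Alg K s) ↥(P K s i))))

noncomputable instance (i : ZMod (6 * s)) : Module (Alg K s) (S K s i) :=
  inferInstanceAs (Module (Alg K s) (modQuot (radSMul (Alg K s) ↥(P K s i))))

/-- The canonical projection `P_i → S_i`. -/
noncomputable def toS (i : ZMod (6 * s)) : ↥(P K s i) →ₗ[Alg K s] S K s i :=
  (radSMul (Alg K s) ↥(P K s i)).mkQ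

/-- Corestriction of right multiplication by `e_i` to `P_i`. -/
noncomputable def toP (i : ZMod (6 * s)) : Alg K s →ₗ[Alg K s] ↥(P K s i) :=
  LinearMap.codRestrict (P K s i) (rmul (Alg K s) (ee K s i))
    (fun c => LinearMap.mem_range_self _ c)

/-- The homomorphism `P_j → P_i` given by right multiplication with (the class of)
a path `w` from vertex `i` to vertex `j`; concretely it is `x ↦ x * w * e_i`, which
for an actual path `w` from `i` to `j` (so that `w * e_i = w` holds in `R_s`) is just
right multiplication `x ↦ x * w`. -/
noncomputable def pmul (i j : ZMod (6 * s)) (w : Alg K s) :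
    ↥(P K s j) →ₗ[Alg K s] ↥(P K s i) :=
  (toP K s i).comp ((rmul (Alg K s) w).comp (P K s j).subtype)

/-- `α`-arrows of `R_s`, indexed by natural numbers. -/
noncomputable def aN (k : ℕ) : Alg K s := aa K s ((k : ℕ) : ZMod (3 * s))

/-- `β`-arrows of `R_s`, indexed by natural numbers. -/
noncomputable def bN (k : ℕ) : Alg K s := bb K s ((k : ℕ) : ZMod (3 * s))

/-- `γ`-arrows of `R_s`, indexed by natural numbers. -/
noncomputable def gN (k : ℕ) : Alg K s := gg K s ((k : ℕ) : ZMod s)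

/-- The homomorphism `P_j → P_i` (vertices given by natural numbers, taken mod `6s`)
induced by right multiplication with `w`. -/
noncomputable def pmulN (i j : ℕ) (w : Alg K s) :
    ↥(P K s ((j : ℕ) : ZMod (6 * s))) →ₗ[Alg K s] ↥(P K s ((i : ℕ) : ZMod (6 * s))) :=
  pmul K s ((i : ℕ) : ZMod (6 * s)) ((j : ℕ) : ZMod (6 * s)) w

/-- The canonical projection `P_i → S_i` (vertex given by a natural number). -/
noncomputable def toSN (i : ℕ) :
    ↥(P K s ((i : ℕ) : ZMod (6 * s))) →ₗ[Alg K s] S K s ((i : ℕ) : ZMod (6 * s)) :=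
  toS K s ((i : ℕ) : ZMod (6 * s))

/-- The simple module `S_i`, for a vertex given by a natural number. -/
noncomputable def SN (i : ℕ) : Type u := S K s ((i : ℕ) : ZMod (6 * s))

noncomputable instance (i : ℕ) : AddCommGroup (SN K s i) :=
  inferInstanceAs (AddCommGroup (S K s ((i : ℕ) : ZMod (6 * s))))

noncomputable instance (i : ℕ) : Module (Alg K s) (SN K s i) :=
  inferInstanceAs (Module (Alg K s) (S K s ((i : ℕ) : ZMod (6 * s))))

/-! ### Projective resolutions, minimality and syzygies -/

/-- A projective resolution `⋯ → Q 1 → Q 0 → M → 0` of a module `M` over a ring `Λ`. -/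
structure ProjRes (Λ : Type v) [Ring Λ] (M : Type w) [AddCommGroup M] [Module Λ M] where
  /-- The terms of the resolution. -/
  Q : ℕ → Type v
  [acg : ∀ n, AddCommGroup (Q n)]
  [mod : ∀ n, Module Λ (Q n)]
  proj : ∀ n, Module.Projective Λ (Q n)
  /-- The differentials. -/
  d : ∀ n, Q (n + 1) →ₗ[Λ] Q n
  /-- The augmentation. -/
  ε : Q 0 →ₗ[Λ] M
  surj : Function.Surjective ε
  exact₀ : LinearMap.range (d 0) = LinearMap.ker ε
  exact : ∀ n, LinearMap.range (d (n + 1)) = LinearMap.ker (d n)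

attribute [instance] ProjRes.acg ProjRes.mod

/-- A projective resolution is minimal if the image of every differential lies in
`rad(Λ)` times the target. -/
def ProjRes.Minimal {Λ : Type v} [Ring Λ] {M : Type w} [AddCommGroup M]
    [Module Λ M] (res : ProjRes Λ M) : Prop :=
  ∀ n, LinearMap.range (res.d n) ≤ radSMul Λ (res.Q n)

/-- `Ω^p(M) ≅ N` : the `p`-th syzygy of `M` with respect to the projective resolution
`res` is isomorphic to `N` (stated for `p ≥ 1`; here `Ω¹ = ker ε` and
`Ω^p = ker (d (p-2))` for `p ≥ 2`). -/
def ProjRes.SyzygyIso {Λ : Type v} [Ring Λ] {M : Type w} [AddCommGroup M]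
    [Module Λ M] (res : ProjRes Λ M) (p : ℕ) (N : Type*) [AddCommGroup N]
    [Module Λ N] : Prop :=
  (p = 1 ∧ Nonempty (↥(LinearMap.ker res.ε) ≃ₗ[Λ] N)) ∨
  (2 ≤ p ∧ Nonempty (↥(LinearMap.ker (res.d (p - 2))) ≃ₗ[Λ] N))

/-! ### The automorphisms `σ` and `τ`, and twisted bimodules -/

/-- The defining property of the algebra automorphism `σ` of `R_s` :
`σ(e_i) = e_{i+36}` for `i ≡ 0,5 (mod 6)`, `σ(e_i) = e_{i+38}` for `i ≡ 1,2 (mod 6)`,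
`σ(e_i) = e_{i+34}` for `i ≡ 3,4 (mod 6)`; `σ(γ_i) = -γ_{i+6}`;
`σ(α_i) = -β_{i+18}` for `i ≡ 0,1 (mod 3)` and `σ(α_i) = β_{i+18}` for `i ≡ 2 (mod 3)`;
`σ(β_i) = -α_{i+18}` for `i ≡ 1,2 (mod 3)` and `σ(β_i) = α_{i+18}` for `i ≡ 0 (mod 3)`. -/
noncomputable def IsSigma (σ : Alg K s ≃ₐ[K] Alg K s) : Prop :=
  (∀ i : ZMod (6 * s), σ (ee K s i) =
      if i.val % 6 = 0 ∨ i.val % 6 = 5 then ee K s (i + 36)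
      else if i.val % 6 = 1 ∨ i.val % 6 = 2 then ee K s (i + 38)
      else ee K s (i + 34)) ∧
  (∀ i : ZMod s, σ (gg K s i) = -gg K s (i + 6)) ∧
  (∀ i : ZMod (3 * s), σ (aa K s i) =
      if i.val % 3 = 2 then bb K s (i + 18) else -bb K s (i + 18)) ∧
  (∀ i : ZMod (3 * s), σ (bb K s i) =
      if i.val % 3 = 0 then aa K s (i + 18) else -aa K s (i + 18))

/-- The underlying type of the twisted bimodule `₁R_σ` : the linear space `R_s` with
the ordinary left action of `R_s` and the right action twisted by `σ`. -/
def Twisted (_σ : Alg K s ≃ₐ[K] Alg K s) : Type u := Alg K s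

variable {K s} in
/-- The identity map `R_s → ₁R_σ`. -/
def Twisted.mk (σ : Alg K s ≃ₐ[K] Alg K s) (x : Alg K s) : Twisted K s σ := x

variable {K s} in
/-- The identity map `₁R_σ → R_s`. -/
def Twisted.un (σ : Alg K s ≃ₐ[K] Alg K s) (x : Twisted K s σ) : Alg K s := x

section TwistedInstances

variable (σ : Alg K s ≃ₐ[K] Alg K s)

noncomputable instance : AddCommGroup (Twisted K s σ) :=
  inferInstanceAs (AddCommGroup (Alg K s))

noncomputable instance : Module K (Twisted K s σ) :=
  inferInstanceAs (Module K (Alg K s))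

noncomputable instance : Module (Alg K s) (Twisted K s σ) :=
  inferInstanceAs (Module (Alg K s) (Alg K s))

/-- The right action on `₁R_σ` : `(op b) • m = m * σ(b)`. -/
noncomputable instance : Module (Alg K s)ᵐᵒᵖ (Twisted K s σ) :=
  Module.compHom (Alg K s) (RingHom.op (σ : Alg K s →+* Alg K s))

variable {K s σ} in
theorem Twisted.op_smul_def (b : (Alg K s)ᵐᵒᵖ) (m : Twisted K s σ) :
    b • m = Twisted.mk σ (Twisted.un σ m * σ b.unop) :=
  rfl

noncomputable instance : IsScalarTower K (Alg K s) (Twisted K s σ) :=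
  inferInstanceAs (IsScalarTower K (Alg K s) (Alg K s))

noncomputable instance : IsScalarTower K (Alg K s)ᵐᵒᵖ (Twisted K s σ) where
  smul_assoc k b m := by
    rw [Twisted.op_smul_def, Twisted.op_smul_def, MulOpposite.unop_smul, map_smul]
    show Twisted.un σ m * k • σ b.unop = k • (Twisted.un σ m * σ b.unop)
    rw [mul_smul_comm]

noncomputable instance : SMulCommClass (Alg K s) (Alg K s)ᵐᵒᵖ (Twisted K s σ) where
  smul_comm a b m := by
    rw [Twisted.op_smul_def]
    show Twisted.mk σ (a * (Twisted.un σ m * σ b.unop)) =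
      b • Twisted.mk σ (a * Twisted.un σ m)
    rw [Twisted.op_smul_def]
    show Twisted.mk σ (a * (Twisted.un σ m * σ b.unop)) =
      Twisted.mk σ ((a * Twisted.un σ m) * σ b.unop)
    rw [mul_assoc]

/-- The twisted bimodule `₁R_σ` as a module over the enveloping algebra `Λ`. -/
noncomputable instance : Module (Env K s) (Twisted K s σ) :=
  TensorProduct.Algebra.module

end TwistedInstances

/-- The defining property of the automorphism `τ` of `R_s` : `τ` fixes all `e_i`
and all `γ_i`, and `τ(α_i) = -α_i`, `τ(β_i) = -β_i` for `i ≡ 0,2 (mod 3)` while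
`τ(α_i) = α_i`, `τ(β_i) = β_i` for `i ≡ 1 (mod 3)`. -/
noncomputable def IsTau (τ : Alg K s ≃ₐ[K] Alg K s) : Prop :=
  (∀ i : ZMod (6 * s), τ (ee K s i) = ee K s i) ∧
  (∀ i : ZMod s, τ (gg K s i) = gg K s i) ∧
  (∀ i : ZMod (3 * s), τ (aa K s i) =
      if i.val % 3 = 1 then aa K s i else -aa K s i) ∧
  (∀ i : ZMod (3 * s), τ (bb K s i) =
      if i.val % 3 = 1 then bb K s i else -bb K s i)


/-- The homomorphism group `Hom_Λ(Q_t, R)`. -/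
noncomputable def HomQ (K : Type u) [Field K] (s : ℕ)
    (res : ProjRes (Env K s) (Alg K s)) (t : ℕ) : Type u :=
  res.Q t →ₗ[Env K s] Alg K s

/-- The identity map `Hom_Λ(Q_t, R) → HomQ`. -/
noncomputable def HomQ.mk' (K : Type u) [Field K] (s : ℕ)
    (res : ProjRes (Env K s) (Alg K s)) (t : ℕ)
    (f : res.Q t →ₗ[Env K s] Alg K s) : HomQ K s res t := f

/-- The identity map `HomQ → Hom_Λ(Q_t, R)`. -/
noncomputable def HomQ.un (K : Type u) [Field K] (s : ℕ)
    (res : ProjRes (Env K s) (Alg K s)) (t : ℕ)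
    (f : HomQ K s res t) : res.Q t →ₗ[Env K s] Alg K s := f

noncomputable instance (K : Type u) [Field K] (s : ℕ)
    (res : ProjRes (Env K s) (Alg K s)) (t : ℕ) : AddCommGroup (HomQ K s res t) :=
  inferInstanceAs (AddCommGroup (res.Q t →ₗ[Env K s] Alg K s))

noncomputable instance (K : Type u) [Field K] (s : ℕ)
    (res : ProjRes (Env K s) (Alg K s)) (t : ℕ) : Module K (HomQ K s res t) :=
  inferInstanceAs (Module K (res.Q t →ₗ[Env K s] Alg K s))

/-- The coboundary map `δ^t : Hom_Λ(Q_t, R) → Hom_Λ(Q_{t+1}, R)`, `f ↦ f ∘ d_t`,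
of the complex obtained by applying `Hom_Λ(-, R)` to the resolution: a `K`-linear map. -/
noncomputable def hdelta (K : Type u) [Field K] (s : ℕ)
    (res : ProjRes (Env K s) (Alg K s)) (t : ℕ) :
    HomQ K s res t →ₗ[K] HomQ K s res (t + 1) where
  toFun f := HomQ.mk' K s res (t + 1) ((HomQ.un K s res t f).comp (res.d t))
  map_add' f g := by
    show ((HomQ.un K s res t f + HomQ.un K s res t g).comp (res.d t)) = _
    rw [LinearMap.add_comp]
    rfl
  map_smul' k f := by
    show ((k • HomQ.un K s res t f).comp (res.d t)) = _
    rw [LinearMap.smul_comp]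
    rfl

/-- The dimensions of the coboundary groups `Im δ^t`, as stated (`p` denotes the
characteristic of `K`). -/
def imDim (p s t : ℕ) : ℕ :=
  let L := t / 11
  let r := t % 11
  let m := r / 2
  let c0 : Bool := (6 * L + m) % s == 0 % s
  let ev : Bool := L % 2 == 0
  if r == 0 then (if c0 && ev then 6*s - 1 else if c0 && !ev then 2*s else 0)
  else if r == 1 then (if c0 && ev then s else if c0 && !ev then 3*s - 1 else 0)
  else if r == 2 then (if c0 && ev then 3*s else if c0 && !ev then s else 0)
  else if r == 3 then
    (if c0 && ev then (if p == 2 then 5*s - 1 else 5*s)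
     else if c0 && !ev then 7*s - 1 else 0)
  else if r == 4 then
    (if c0 && ev then 2*s
     else if c0 && !ev then (if p == 3 then 6*s - 1 else 6*s) else 0)
  else if r == 5 then
    (if c0 && ev then (if p == 3 then 6*s - 1 else 6*s)
     else if c0 && !ev then 2*s else 0)
  else if r == 6 then
    (if c0 && ev then 7*s - 1
     else if c0 && !ev then (if p == 2 then 5*s - 1 else 5*s) else 0)
  else if r == 7 then (if c0 && ev then s else if c0 && !ev then 3*s else 0)
  else if r == 8 then (if c0 && ev then 3*s - 1 else if c0 && !ev then s else 0)
  else if r == 9 then (if c0 && ev then 2*s else if c0 && !ev then 6*s - 1 else 0)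
  else
    (if c0 && ev then 2*s
     else if c0 && !ev then (if p == 3 then 6*s - 1 else 6*s) else 0)

/-! ### A basis of `R_s` -/

set_option linter.unusedSectionVars false

section PathBasis

variable {K s}

/-- `sup v w d` holds when `R_s` has a nonzero path from the vertex `6k + v` to `6(k + d) + w`. -/
def sup (v w d : ℕ) : Bool :=
  Nat.blt v 6 && (Nat.blt w 6 && (Nat.blt d 2 &&
    Nat.beq (2417542584594805846209 / 2 ^ (v + 6 * w + 36 * d) % 2) 1))

/-- The vertices of `𝒬ₛ` in the form `6k + v`. -/
def vt (s v : ℕ) (k : ZMod s) : ZMod (6 * s) := ((6 * k.val + v : ℕ) : ZMod (6 * s))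

/-- Source of an arrow type: the types `0,1,2` are `α`, `3,4,5` are `β` and `6` is `γ`. -/
def arSrc : ℕ → ℕ
  | 0 => 0 | 1 => 1 | 2 => 2 | 3 => 0 | 4 => 3 | 5 => 4 | _ => 5

/-- Target of an arrow type. -/
def arTgt : ℕ → ℕ
  | 0 => 1 | 1 => 2 | 2 => 5 | 3 => 3 | 4 => 4 | 5 => 5 | _ => 0

/-- The number of blocks of six vertices by which an arrow type advances. -/
def arDeg : ℕ → ℕ
  | 0 => 0 | 1 => 0 | 2 => 0 | 3 => 0 | 4 => 0 | 5 => 0 | _ => 1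

/-- The type of the last arrow of the chosen path from `v` to `w`. -/
def arLast (v w : ℕ) : ℕ :=
  match w with
  | 0 => 6 | 1 => 0 | 2 => 1 | 3 => 3 | 4 => 4
  | _ => if v = 3 ∨ v = 4 then 5 else 2

/-- Position of a vertex inside its block. -/
def hgt : ℕ → ℕ
  | 0 => 0 | 1 => 1 | 2 => 2 | 3 => 1 | 4 => 2 | _ => 3

/-- Length of the paths from `v` to `w` advancing `d` blocks. -/
def plen (v w d : ℕ) : ℕ := hgt w + 4 * d - hgt v

lemma sup_bound {v w d : ℕ} (h : sup v w d = true) : v < 6 ∧ w < 6 ∧ d < 2 := by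
  simp only [sup, Bool.and_eq_true, Nat.blt_eq] at h
  exact ⟨h.1, h.2.1, h.2.2.1⟩

section

variable (K)

/-- The arrow of type `τ` in block `k`. -/
noncomputable def ar (τ : ℕ) (k : ZMod s) : Alg K s :=
  match τ with
  | 0 => aa K s ((3 * k.val + 0 : ℕ) : ZMod (3 * s))
  | 1 => aa K s ((3 * k.val + 1 : ℕ) : ZMod (3 * s))
  | 2 => aa K s ((3 * k.val + 2 : ℕ) : ZMod (3 * s))
  | 3 => bb K s ((3 * k.val + 0 : ℕ) : ZMod (3 * s))
  | 4 => bb K s ((3 * k.val + 1 : ℕ) : ZMod (3 * s))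
  | 5 => bb K s ((3 * k.val + 2 : ℕ) : ZMod (3 * s))
  | _ => gg K s k

/-- The trivial path at `6k + v`; zero for `v ≥ 6`. -/
noncomputable def ev (v : ℕ) (k : ZMod s) : Alg K s := if v < 6 then ee K s (vt s v k) else 0

/-- The chosen path of length `n` from `6k + v` to `6(k + d) + w`. -/
noncomputable def pthA : ℕ → ℕ → ℕ → ℕ → ZMod s → Alg K s
  | 0, v, _, _, k => ev K v k
  | n + 1, v, w, d, k =>
      ar K (arLast v w) (k + ((d - arDeg (arLast v w) : ℕ) : ZMod s)) *
        pthA n v (arSrc (arLast v w)) (d - arDeg (arLast v w)) k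

/-- The basis path from `6k + v` to `6(k + d) + w`, or zero if there is none. -/
noncomputable def pth (v w d : ℕ) (k : ZMod s) : Alg K s :=
  if sup v w d = true then pthA K (plen v w d) v w d k else 0

end

lemma vt_natCast (v n : ℕ) :
    vt s v (n : ZMod s) = ((6 * n + v : ℕ) : ZMod (6 * s)) := by
  rw [vt, ZMod.val_natCast, ZMod.natCast_eq_natCast_iff]
  exact ((Nat.mod_modEq n s).mul_left' 6).add_right v

variable [NeZero s]

lemma vt_zero_add_one (k : ZMod s) :
    vt s 0 (k + 1) = ((6 * k.val + 6 : ℕ) : ZMod (6 * s)) := by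
  have h : k + 1 = ((k.val + 1 : ℕ) : ZMod s) := by simp
  rw [h, vt_natCast]
  congr 1

lemma vt_inj {v w : ℕ} {k l : ZMod s} (hv : v < 6) (hw : w < 6) :
    vt s v k = vt s w l ↔ v = w ∧ k = l := by
  have hk := ZMod.val_lt k
  have hl := ZMod.val_lt l
  constructor
  · intro h
    rw [vt, vt, ZMod.natCast_eq_natCast_iff, Nat.ModEq, Nat.mod_eq_of_lt (by omega),
      Nat.mod_eq_of_lt (by omega)] at h
    exact ⟨by omega, ZMod.val_injective _ (by omega)⟩
  · rintro ⟨rfl, rfl⟩; rfl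

lemma val_three (k : ZMod s) {j : ℕ} (hj : j < 3) :
    ((3 * k.val + j : ℕ) : ZMod (3 * s)).val = 3 * k.val + j := by
  have hk := ZMod.val_lt k
  rw [ZMod.val_natCast, Nat.mod_eq_of_lt (by omega)]

lemma three_succ (k : ZMod s) :
    ((3 * k.val + 3 : ℕ) : ZMod (3 * s)) = ((3 * (k + 1).val + 0 : ℕ) : ZMod (3 * s)) := by
  rw [ZMod.natCast_eq_natCast_iff]
  have : k + 1 = ((k.val + 1 : ℕ) : ZMod s) := by simp
  rw [this, ZMod.val_natCast]
  exact (((Nat.mod_modEq (k.val + 1) s).mul_left' 3).symm)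

/-! #### Relations between arrows -/

lemma mk_eq {x y : F K s} (h : Rel K s x y) :
    RingQuot.mkAlgHom K (Rel K s) x = RingQuot.mkAlgHom K (Rel K s) y :=
  RingQuot.mkAlgHom_rel K h

lemma ee_mul_ee (i j : ZMod (6 * s)) : ee K s i * ee K s j = if i = j then ee K s i else 0 := by
  have := mk_eq (Rel.idem (K := K) i j)
  rw [map_mul] at this
  rw [ee, ee, this]
  split_ifs <;> simp

lemma sum_ee : ∑ i ∈ Finset.range (6 * s), ee K s (i : ZMod (6 * s)) = 1 := by
  have := mk_eq (Rel.sum_one (K := K) (s := s))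
  rwa [map_sum, map_one] at this

lemma ar_tgt {τ : ℕ} (hτ : τ < 7) (k : ZMod s) :
    ev K (arTgt τ) (k + (arDeg τ : ZMod s)) * ar K τ k = ar K τ k := by
  have ha (i : ZMod (3 * s)) : ee K s (aTgt s i) * aa K s i = aa K s i := by
    rw [ee, aa, ← map_mul, mk_eq (Rel.a_tgt i)]
  have hb (i : ZMod (3 * s)) : ee K s (bTgt s i) * bb K s i = bb K s i := by
    rw [ee, bb, ← map_mul, mk_eq (Rel.b_tgt i)]
  have hg (i : ZMod s) : ee K s (gTgt s i) * gg K s i = gg K s i := by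
    rw [ee, gg, ← map_mul, mk_eq (Rel.g_tgt i)]
  have key (i : ZMod (6 * s)) (v : ℕ) (hv : v < 6) (l : ZMod s) (h : i = vt s v l) :
    ee K s i = ev K v l := by rw [ev, if_pos hv, h]
  interval_cases τ <;> simp only [ar, arTgt, arDeg, Nat.cast_zero, add_zero, Nat.cast_one]
  all_goals first
    | (conv_rhs => rw [← ha])
    | (conv_rhs => rw [← hb])
    | (conv_rhs => rw [← hg])
  all_goals congr 1
  all_goals symm; apply key _ _ (by norm_num)
  all_goals first
    | rw [gTgt, vt_zero_add_one]
    | (try simp only [aTgt, bTgt]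
       rw [val_three k (by norm_num)]
       simp only [vt]
       first
        | rw [if_pos (by omega)]
        | rw [if_neg (by omega)]
        | skip
       congr 1
       omega)
    | (have h3 := val_three k (j := 0) (by norm_num)
       simp only [add_zero] at h3
       simp only [aTgt, bTgt, vt]
       rw [h3]
       first
        | rw [if_neg (by omega)]
        | skip
       congr 1
       omega)

lemma ar_src {τ : ℕ} (hτ : τ < 7) (k : ZMod s) :
    ar K τ k * ev K (arSrc τ) k = ar K τ k := by
  have ha (i : ZMod (3 * s)) : aa K s i * ee K s (aSrc s i) = aa K s i := by
    rw [ee, aa, ← map_mul, mk_eq (Rel.a_src i)]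
  have hb (i : ZMod (3 * s)) : bb K s i * ee K s (bSrc s i) = bb K s i := by
    rw [ee, bb, ← map_mul, mk_eq (Rel.b_src i)]
  have hg (i : ZMod s) : gg K s i * ee K s (gSrc s i) = gg K s i := by
    rw [ee, gg, ← map_mul, mk_eq (Rel.g_src i)]
  have key (i : ZMod (6 * s)) (v : ℕ) (hv : v < 6) (l : ZMod s) (h : i = vt s v l) :
    ee K s i = ev K v l := by rw [ev, if_pos hv, h]
  interval_cases τ <;> simp only [ar, arSrc]
  all_goals first
    | (conv_rhs => rw [← ha])
    | (conv_rhs => rw [← hb])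
    | (conv_rhs => rw [← hg])
  all_goals congr 1
  all_goals symm; apply key _ _ (by norm_num)
  all_goals first
    | rfl
    | (simp only [aSrc, bSrc, vt]
       rw [val_three k (by norm_num)]
       first
        | rw [if_pos (by omega)]
        | rw [if_neg (by omega)]
        | skip
       congr 1
       try omega)

lemma ar_comm (k : ZMod s) :
    ar K 2 k * (ar K 1 k * ar K 0 k) = ar K 5 k * (ar K 4 k * ar K 3 k) := by
  have := mk_eq (Rel.comm (K := K) ⟨k.val, ZMod.val_lt k⟩)
  simpa only [map_mul, mul_assoc, add_zero, ar, aa, bb] using this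

lemma ar_agb (k : ZMod s) : ar K 0 (k + 1) * (ar K 6 k * ar K 5 k) = 0 := by
  have := mk_eq (Rel.zero_agb (K := K) ⟨k.val, ZMod.val_lt k⟩)
  simp only [map_mul, mul_assoc, ZMod.natCast_val, ZMod.cast_id', id_eq, map_zero] at this
  simp only [ar, ← three_succ, aa, bb, gg]
  simpa using this

lemma ar_bga (k : ZMod s) : ar K 3 (k + 1) * (ar K 6 k * ar K 2 k) = 0 := by
  have := mk_eq (Rel.zero_bga (K := K) ⟨k.val, ZMod.val_lt k⟩)
  simp only [map_mul, mul_assoc, ZMod.natCast_val, ZMod.cast_id', id_eq, map_zero] at this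
  simp only [ar, ← three_succ, aa, bb, gg]
  simpa using this

lemma ar_len5 (τ₁ τ₂ τ₃ τ₄ τ₅ : ℕ) (k₁ k₂ k₃ k₄ k₅ : ZMod s) :
    ar K τ₁ k₁ * (ar K τ₂ k₂ * (ar K τ₃ k₃ * (ar K τ₄ k₄ * ar K τ₅ k₅))) = 0 := by
  have H (τ : ℕ) (k : ZMod s) : ∃ x ∈ arrows K s, ar K τ k = RingQuot.mkAlgHom K (Rel K s) x := by
    unfold ar
    split
    all_goals first
      | exact ⟨_, Or.inl (Or.inl ⟨_, rfl⟩), rfl⟩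
      | exact ⟨_, Or.inl (Or.inr ⟨_, rfl⟩), rfl⟩
      | exact ⟨_, Or.inr ⟨_, rfl⟩, rfl⟩
  obtain ⟨x₁, h₁, e₁⟩ := H τ₁ k₁
  obtain ⟨x₂, h₂, e₂⟩ := H τ₂ k₂
  obtain ⟨x₃, h₃, e₃⟩ := H τ₃ k₃
  obtain ⟨x₄, h₄, e₄⟩ := H τ₄ k₄
  obtain ⟨x₅, h₅, e₅⟩ := H τ₅ k₅
  have := mk_eq (Rel.len5 (K := K) _ _ _ _ _ h₁ h₂ h₃ h₄ h₅)
  simpa only [e₁, e₂, e₃, e₄, e₅, ← map_mul, mul_assoc, map_zero] using this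
lemma ev_mul_ev (v w : ℕ) (k l : ZMod s) :
    ev K v k * ev K w l = if v = w ∧ k = l then ev K v k else 0 := by
  unfold ev
  by_cases hv : v < 6
  · by_cases hw : w < 6
    · simp only [hv, hw, if_true, ee_mul_ee, vt_inj hv hw]
    · have : v ≠ w := by omega
      simp [hw, this]
  · simp [hv]

lemma pthA_mul_ev (n v w d : ℕ) (k : ZMod s) : pthA K n v w d k * ev K v k = pthA K n v w d k := by
  induction n generalizing w d with
  | zero => rw [pthA, ev_mul_ev, if_pos ⟨rfl, rfl⟩]
  | succ n ih => rw [pthA, mul_assoc, ih]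

lemma pth_mul_ev (v w d : ℕ) (k : ZMod s) : pth K v w d k * ev K v k = pth K v w d k := by
  unfold pth
  split_ifs
  · exact pthA_mul_ev ..
  · exact zero_mul _

lemma pth_of_not_sup {v w d : ℕ} (h : ¬ sup v w d = true) (k : ZMod s) : pth K v w d k = 0 :=
  if_neg h

lemma pth_self (v : ℕ) (k : ZMod s) : pth K v v 0 k = ev K v k := by
  by_cases hv : v < 6
  · rw [pth, if_pos (by revert v; decide), show plen v v 0 = 0 by simp [plen], pthA]
  · rw [pth_of_not_sup fun h => hv (sup_bound h).1, ev, if_neg hv]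

set_option synthInstance.maxSize 4096 in
lemma arLast_spec : ∀ v < 6, ∀ w < 6, ∀ d < 2, sup v w d = true → v ≠ w ∨ d ≠ 0 →
    arLast v w < 7 ∧ arTgt (arLast v w) = w ∧ arDeg (arLast v w) ≤ d ∧
      sup v (arSrc (arLast v w)) (d - arDeg (arLast v w)) = true ∧
      plen v w d = plen v (arSrc (arLast v w)) (d - arDeg (arLast v w)) + 1 := by
  decide

lemma pth_eq_ar_mul {v w d : ℕ} (h : sup v w d = true) (h0 : v ≠ w ∨ d ≠ 0) (k : ZMod s) :
    pth K v w d k = ar K (arLast v w) (k + ((d - arDeg (arLast v w) : ℕ) : ZMod s)) *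
      pth K v (arSrc (arLast v w)) (d - arDeg (arLast v w)) k := by
  obtain ⟨hv, hw, hd⟩ := sup_bound h
  obtain ⟨-, -, -, h4, h5⟩ := arLast_spec v hv w hw d hd h h0
  rw [pth, if_pos h, h5, pthA, pth, if_pos h4]

lemma ev_mul_pth (v w d : ℕ) (k : ZMod s) :
    ev K w (k + (d : ZMod s)) * pth K v w d k = pth K v w d k := by
  by_cases h : sup v w d = true
  · by_cases h0 : v ≠ w ∨ d ≠ 0
    · obtain ⟨hv, hw, hd⟩ := sup_bound h
      obtain ⟨h1, h2, h3, -, -⟩ := arLast_spec v hv w hw d hd h h0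
      rw [pth_eq_ar_mul h h0, ← mul_assoc]
      congr 1
      have := ar_tgt (K := K) h1 (k + ((d - arDeg (arLast v w) : ℕ) : ZMod s))
      rwa [h2, add_assoc, ← Nat.cast_add, Nat.sub_add_cancel h3] at this
    · obtain ⟨rfl, rfl⟩ : v = w ∧ d = 0 := by tauto
      rw [pth_self, Nat.cast_zero, add_zero, ev_mul_ev, if_pos ⟨rfl, rfl⟩]
  · rw [pth_of_not_sup h, mul_zero]

set_option synthInstance.maxSize 4096 in
lemma ar_cases : ∀ v < 6, ∀ d < 2, ∀ τ < 7, sup v (arSrc τ) d = true →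
    (sup v (arTgt τ) (d + arDeg τ) = true ∧ arLast v (arTgt τ) = τ ∧
      (v ≠ arTgt τ ∨ d + arDeg τ ≠ 0)) ∨
    (sup v (arTgt τ) (d + arDeg τ) = false ∧ plen v (arSrc τ) d = 4) ∨
    (sup v (arTgt τ) (d + arDeg τ) = false ∧ τ = 0 ∧ d = 1 ∧ arLast v 5 = 5 ∧
      sup v 5 0 = true ∧ v ≠ 5) ∨
    (sup v (arTgt τ) (d + arDeg τ) = false ∧ τ = 3 ∧ d = 1 ∧ arLast v 5 = 2 ∧
      sup v 5 0 = true ∧ v ≠ 5) ∨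
    (τ = 5 ∧ arLast v 5 = 2 ∧ sup v 5 d = true ∧ sup v 4 d = true ∧ sup v 3 d = true ∧
      sup v 2 d = true ∧ sup v 1 d = true ∧ (d = 0 → v = 0)) := by
  decide

/-- Multiplying a basis path by an arrow. -/
lemma ar_mul_pth {v d τ : ℕ} (hτ : τ < 7) (h : sup v (arSrc τ) d = true) (k : ZMod s) :
    ar K τ (k + (d : ZMod s)) * pth K v (arSrc τ) d k = pth K v (arTgt τ) (d + arDeg τ) k := by
  obtain ⟨hv, -, hd⟩ := sup_bound h
  obtain ⟨h1, h2, h3⟩ | ⟨h1, h2⟩ | ⟨h1, rfl, rfl, h2, h3, h4⟩ | ⟨h1, rfl, rfl, h2, h3, h4⟩ |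
    ⟨rfl, h2, h5, h4, h3, h2', h1, h0⟩ := ar_cases v hv d hd τ hτ h
  · rw [pth_eq_ar_mul h1 h3, h2, Nat.add_sub_cancel]
  · rw [pth_of_not_sup (w := arTgt τ) (by simp [h1]), pth, if_pos h, h2]
    simp only [pthA, ← mul_assoc]
    rw [← zero_mul (ev K v k)]
    congr 1
    simp only [mul_assoc]
    exact ar_len5 ..
  · rw [pth_of_not_sup (w := arTgt _) (by rw [h1]; simp)]
    simp only [arSrc] at h ⊢
    rw [pth_eq_ar_mul h (by simp)]
    simp only [arLast, arDeg, Nat.sub_self, arSrc]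
    rw [pth_eq_ar_mul h3 (by simp [h4]), h2]
    simp only [arDeg, Nat.sub_zero, arSrc, Nat.cast_zero, add_zero, Nat.cast_one]
    rw [← mul_assoc (ar K 6 k), ← mul_assoc, ar_agb, zero_mul]
  · rw [pth_of_not_sup (w := arTgt _) (by rw [h1]; simp)]
    simp only [arSrc] at h ⊢
    rw [pth_eq_ar_mul h (by simp)]
    simp only [arLast, arDeg, Nat.sub_self, arSrc]
    rw [pth_eq_ar_mul h3 (by simp [h4]), h2]
    simp only [arDeg, Nat.sub_zero, arSrc, Nat.cast_zero, add_zero, Nat.cast_one]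
    rw [← mul_assoc (ar K 6 k), ← mul_assoc, ar_bga, zero_mul]
  · have ne {w : ℕ} (hw : 0 < w) : v ≠ w ∨ d ≠ 0 := by
      by_cases hd0 : d = 0
      · left; rw [h0 hd0]; omega
      · exact Or.inr hd0
    have e5 := pth_eq_ar_mul (K := K) h5 (ne (by norm_num)) k
    have e4 := pth_eq_ar_mul (K := K) h4 (ne (by norm_num)) k
    have e3 := pth_eq_ar_mul (K := K) h3 (ne (by norm_num)) k
    have e2 := pth_eq_ar_mul (K := K) h2' (ne (by norm_num)) k
    have e1 := pth_eq_ar_mul (K := K) h1 (ne (by norm_num)) k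
    simp only [arLast, arDeg, arSrc, Nat.sub_zero, arTgt, add_zero] at *
    simp only [h2, Nat.sub_zero] at e5
    rw [e5, e4, e3, e2, e1]
    have := congrArg (· * pth K v 0 d k) (ar_comm (K := K) (k + (d : ZMod s)))
    simpa only [mul_assoc] using this.symm

set_option synthInstance.maxSize 4096 in
lemma sup_trans : ∀ v < 6, ∀ w < 6, ∀ d < 2, ∀ x < 6, ∀ e < 2, sup v w d = true →
    sup w x e = true → w ≠ x ∨ e ≠ 0 →
      sup v (arSrc (arLast w x)) (d + (e - arDeg (arLast w x))) = false →
      sup v x (d + e) = false := by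
  decide

/-- Multiplication of composable basis paths. -/
lemma pth_mul_pth {v w d x e : ℕ} (h : sup v w d = true) (h' : sup w x e = true) (k : ZMod s) :
    pth K w x e (k + (d : ZMod s)) * pth K v w d k = pth K v x (d + e) k := by
  obtain ⟨n, hn⟩ : ∃ n, plen w x e = n := ⟨_, rfl⟩
  induction n generalizing x e with
  | zero =>
    have h0 : ¬ (w ≠ x ∨ e ≠ 0) := by
      intro h0
      obtain ⟨hv, hw, hd⟩ := sup_bound h'
      obtain ⟨-, -, -, -, h5⟩ := arLast_spec w hv x hw e hd h' h0
      omega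
    obtain ⟨rfl, rfl⟩ : w = x ∧ e = 0 := by tauto
    rw [pth_self, ev_mul_pth, add_zero]
  | succ n ih =>
    have h0 : w ≠ x ∨ e ≠ 0 := by
      by_contra h0
      obtain ⟨rfl, rfl⟩ : w = x ∧ e = 0 := by tauto
      simp [plen] at hn
    obtain ⟨hw, hx, he⟩ := sup_bound h'
    obtain ⟨hv, -, hd⟩ := sup_bound h
    obtain ⟨h1, h2, h3, h4, h5⟩ := arLast_spec w hw x hx e he h' h0
    rw [pth_eq_ar_mul h' h0, mul_assoc, ih h4 (by omega)]
    by_cases h6 : sup v (arSrc (arLast w x)) (d + (e - arDeg (arLast w x))) = true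
    · have := ar_mul_pth (K := K) h1 h6 k
      rw [h2, add_assoc, Nat.sub_add_cancel h3] at this
      rw [← this, Nat.cast_add, add_assoc]
    · rw [pth_of_not_sup h6, mul_zero, pth_of_not_sup]
      rw [sup_trans v hv w hw d hd x hx e he h h' h0 (by simpa using h6)]
      simp

lemma pth_mul_pth_of_ne {v w d w' x e : ℕ} {k l : ZMod s} (h : ¬ (w' = w ∧ l = k + (d : ZMod s))) :
    pth K w' x e l * pth K v w d k = 0 := by
  rw [← pth_mul_ev w', ← ev_mul_pth v w, mul_assoc, ← mul_assoc (ev K w' l), ev_mul_ev, if_neg h,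
    zero_mul, mul_zero]

end PathBasis

section Resolution

set_option linter.unusedSectionVars false

variable {K s} [NeZero s]

/-- The index set of the basis of `R_s`. -/
abbrev Idx (s : ℕ) : Type :=
  {x : ℕ × ℕ × ℕ × ZMod s // sup x.1 x.2.1 x.2.2.1 = true}

instance : Finite (Idx s) := by
  have : Finite ({v : ℕ // v < 6} × {v : ℕ // v < 6} × {v : ℕ // v < 2} × ZMod s) := inferInstance
  refine Finite.of_injective
    (fun x : Idx s => ((⟨x.1.1, (sup_bound x.2).1⟩, ⟨x.1.2.1, (sup_bound x.2).2.1⟩,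
      ⟨x.1.2.2.1, (sup_bound x.2).2.2⟩, x.1.2.2.2) :
      {v : ℕ // v < 6} × {v : ℕ // v < 6} × {v : ℕ // v < 2} × ZMod s)) ?_
  rintro ⟨⟨a, b, c, d⟩, h⟩ ⟨⟨a', b', c', d'⟩, h'⟩ hh
  simp only [Prod.mk.injEq, Subtype.mk.injEq] at hh ⊢
  exact hh

section

variable (K)

/-- The element of the basis family with a given index. -/
noncomputable def pb (x : Idx s) : Alg K s := pth K x.1.1 x.1.2.1 x.1.2.2.1 x.1.2.2.2

/-- The standard basis vector of `Idx s →₀ K` with given index, or zero. -/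
noncomputable def sg (v w d : ℕ) (k : ZMod s) : Idx s →₀ K :=
  if h : sup v w d = true then Finsupp.single ⟨(v, w, d, k), h⟩ 1 else 0

/-- Action of trivial paths on `Idx s →₀ K`. -/
noncomputable def actE (i : ZMod (6 * s)) : Module.End K (Idx s →₀ K) :=
  Finsupp.linearCombination K fun x =>
    if vt s x.1.2.1 (x.1.2.2.2 + (x.1.2.2.1 : ZMod s)) = i then
      sg K x.1.1 x.1.2.1 x.1.2.2.1 x.1.2.2.2 else 0

/-- Action of arrows on `Idx s →₀ K`. -/
noncomputable def actA (τ : ℕ) (k : ZMod s) : Module.End K (Idx s →₀ K) :=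
  Finsupp.linearCombination K fun x =>
    if x.1.2.1 = arSrc τ ∧ x.1.2.2.2 + (x.1.2.2.1 : ZMod s) = k then
      sg K x.1.1 (arTgt τ) (x.1.2.2.1 + arDeg τ) x.1.2.2.2 else 0

/-- Action of the generators on `Idx s →₀ K`. -/
noncomputable def actGen : Gen s → Module.End K (Idx s →₀ K)
  | Gen.e i => actE K i
  | Gen.a i => actA K (i.val % 3) ((i.val / 3 : ℕ) : ZMod s)
  | Gen.b i => actA K (3 + i.val % 3) ((i.val / 3 : ℕ) : ZMod s)
  | Gen.g i => actA K 6 i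

end

lemma actE_sg (i : ZMod (6 * s)) (v w d : ℕ) (k : ZMod s) :
    actE K i (sg K v w d k) = if vt s w (k + (d : ZMod s)) = i then sg K v w d k else 0 := by
  by_cases h : sup v w d = true
  · conv_lhs => rw [sg, dif_pos h, actE, Finsupp.linearCombination_single, one_smul]
  · simp [sg, h]

lemma actA_sg (τ : ℕ) (l : ZMod s) (v w d : ℕ) (k : ZMod s) :
    actA K τ l (sg K v w d k) =
      if sup v w d = true ∧ w = arSrc τ ∧ k + (d : ZMod s) = l then
        sg K v (arTgt τ) (d + arDeg τ) k else 0 := by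
  by_cases h : sup v w d = true
  · conv_lhs => rw [sg, dif_pos h, actA, Finsupp.linearCombination_single, one_smul]
    simp [h]
  · simp [sg, h]

lemma end_ext {f g : Module.End K (Idx s →₀ K)}
    (h : ∀ v w d k, sup v w d = true → f (sg K v w d k) = g (sg K v w d k)) : f = g := by
  refine Finsupp.lhom_ext' fun x => LinearMap.ext_ring ?_
  obtain ⟨⟨v, w, d, k⟩, hx⟩ := x
  have := h v w d k hx
  rwa [sg, dif_pos hx] at this

lemma val_div_three (i : ZMod (3 * s)) : ((i.val / 3 : ℕ) : ZMod s).val = i.val / 3 := by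
  have := ZMod.val_lt i
  rw [ZMod.val_natCast, Nat.mod_eq_of_lt (by omega)]

lemma aTgt_eq (i : ZMod (3 * s)) :
    aTgt s i = vt s (arTgt (i.val % 3))
      (((i.val / 3 : ℕ) : ZMod s) + (arDeg (i.val % 3) : ZMod s)) := by
  have h3 : i.val % 3 < 3 := Nat.mod_lt _ (by norm_num)
  rw [aTgt, vt]
  generalize hj : i.val % 3 = j at *
  interval_cases j <;> simp only [arTgt, arDeg, Nat.cast_zero, add_zero, val_div_three] <;>
    split_ifs <;> first | omega | exact congrArg Nat.cast (by omega) | tauto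

lemma aSrc_eq (i : ZMod (3 * s)) :
    aSrc s i = vt s (arSrc (i.val % 3)) ((i.val / 3 : ℕ) : ZMod s) := by
  have h3 : i.val % 3 < 3 := Nat.mod_lt _ (by norm_num)
  rw [aSrc, vt]
  generalize hj : i.val % 3 = j at *
  interval_cases j <;> simp only [arSrc, val_div_three] <;> exact congrArg Nat.cast (by omega)

lemma bTgt_eq (i : ZMod (3 * s)) :
    bTgt s i = vt s (arTgt (3 + i.val % 3))
      (((i.val / 3 : ℕ) : ZMod s) + (arDeg (3 + i.val % 3) : ZMod s)) := by
  have h3 : i.val % 3 < 3 := Nat.mod_lt _ (by norm_num)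
  rw [bTgt, vt]
  generalize hj : i.val % 3 = j at *
  interval_cases j <;> simp only [arTgt, arDeg, Nat.cast_zero, add_zero, val_div_three] <;>
    exact congrArg Nat.cast (by omega)

lemma bSrc_eq (i : ZMod (3 * s)) :
    bSrc s i = vt s (arSrc (3 + i.val % 3)) ((i.val / 3 : ℕ) : ZMod s) := by
  have h3 : i.val % 3 < 3 := Nat.mod_lt _ (by norm_num)
  rw [bSrc, vt]
  generalize hj : i.val % 3 = j at *
  interval_cases j <;> simp only [arSrc, val_div_three] <;>
    split_ifs <;> first | omega | exact congrArg Nat.cast (by omega) | tauto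

lemma actE_mul_actA {τ : ℕ} (k : ZMod s) {i : ZMod (6 * s)}
    (hi : i = vt s (arTgt τ) (k + (arDeg τ : ZMod s))) :
    actE K i * actA K τ k = actA K τ k := by
  refine end_ext fun v w d l h => ?_
  rw [Module.End.mul_apply, actA_sg]
  split_ifs with h'
  · rw [actE_sg, if_pos]
    rw [hi, ← h'.2.2, Nat.cast_add, add_assoc]
  · rw [map_zero]

lemma actA_mul_actE {τ : ℕ} (k : ZMod s) {i : ZMod (6 * s)}
    (hi : i = vt s (arSrc τ) k) :
    actA K τ k * actE K i = actA K τ k := by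
  refine end_ext fun v w d l h => ?_
  rw [Module.End.mul_apply, actE_sg, actA_sg]
  split_ifs with h1 h2 h2
  · rw [actA_sg, if_pos h2]
  · rw [actA_sg, if_neg h2]
  · exact absurd (by rw [hi, h2.2.1, h2.2.2]) h1
  · rw [map_zero]

/-- The span of the vectors of length at least `m`. -/
noncomputable def lenGE (K : Type u) [Field K] (s m : ℕ) : Submodule K (Idx s →₀ K) :=
  Submodule.span K {x | ∃ v w d k, sup v w d = true ∧ m ≤ plen v w d ∧ x = sg K v w d k}

set_option synthInstance.maxSize 4096 in
lemma plen_step : ∀ τ < 7, ∀ v < 6, ∀ d < 2, sup v (arSrc τ) d = true →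
    sup v (arTgt τ) (d + arDeg τ) = true →
      plen v (arSrc τ) d + 1 ≤ plen v (arTgt τ) (d + arDeg τ) := by
  decide

set_option synthInstance.maxSize 4096 in
lemma plen_le : ∀ v < 6, ∀ w < 6, ∀ d < 2, sup v w d = true → plen v w d ≤ 4 := by
  decide

lemma actA_lenGE {τ : ℕ} (hτ : τ < 7) (k : ZMod s) (m : ℕ) {x : Idx s →₀ K}
    (hx : x ∈ lenGE K s m) : actA K τ k x ∈ lenGE K s (m + 1) := by
  induction hx using Submodule.span_induction with
  | mem x hx =>
    obtain ⟨v, w, d, l, h, hm, rfl⟩ := hx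
    rw [actA_sg]
    split_ifs with h'
    · obtain ⟨-, rfl, -⟩ := h'
      obtain ⟨hv, -, hd⟩ := sup_bound h
      by_cases h2 : sup v (arTgt τ) (d + arDeg τ) = true
      · exact Submodule.subset_span ⟨_, _, _, _, h2,
          le_trans (Nat.succ_le_succ hm) (plen_step τ hτ v hv d hd h h2), rfl⟩
      · rw [sg, dif_neg h2]; exact zero_mem _
    · exact zero_mem _
  | zero => rw [map_zero]; exact zero_mem _
  | add x y _ _ hx hy => rw [map_add]; exact add_mem hx hy
  | smul c x _ hx => rw [map_smul]; exact Submodule.smul_mem _ _ hx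

lemma lenGE_five : lenGE K s 5 = ⊥ := by
  rw [lenGE, Submodule.span_eq_bot]
  rintro _ ⟨v, w, d, k, h, hm, rfl⟩
  obtain ⟨hv, hw, hd⟩ := sup_bound h
  have := plen_le v hv w hw d hd h
  omega

set_option synthInstance.maxSize 4096 in
lemma sup_comm : ∀ v < 6, ∀ d < 2, sup v 0 d = true →
    sup v 1 d = true ∧ sup v 2 d = sup v 5 d ∧ sup v 3 d = true ∧ sup v 4 d = sup v 5 d ∨
    sup v 5 d = false := by
  decide

set_option synthInstance.maxSize 4096 in
lemma sup_zero : ∀ v < 6, ∀ d < 2, (sup v 4 d = true → sup v 5 d = true → sup v 0 (d + 1) = true →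
    sup v 1 (d + 1) = false) ∧ (sup v 2 d = true → sup v 5 d = true → sup v 0 (d + 1) = true →
    sup v 3 (d + 1) = false) := by
  decide

/-- The representation of the free algebra underlying the regular representation of `R_s`. -/
noncomputable def freeRep (K : Type u) [Field K] (s : ℕ) [NeZero s] :
    F K s →ₐ[K] Module.End K (Idx s →₀ K) :=
  FreeAlgebra.lift K (actGen K)

lemma freeRep_arrow {x : F K s} (hx : x ∈ arrows K s) :
    ∃ τ < 7, ∃ k, freeRep K s x = actA K τ k := by
  obtain (⟨i, rfl⟩ | ⟨i, rfl⟩) | ⟨i, rfl⟩ := hx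
  · exact ⟨i.val % 3, by omega, _, FreeAlgebra.lift_ι_apply ..⟩
  · exact ⟨3 + i.val % 3, by omega, _, FreeAlgebra.lift_ι_apply ..⟩
  · exact ⟨6, by omega, _, FreeAlgebra.lift_ι_apply ..⟩

lemma freeRep_E (i : ZMod (6 * s)) : freeRep K s (E K s i) = actE K i :=
  FreeAlgebra.lift_ι_apply ..

lemma freeRep_a (i : ZMod (3 * s)) :
    freeRep K s (A K s i) = actA K (i.val % 3) ((i.val / 3 : ℕ) : ZMod s) :=
  FreeAlgebra.lift_ι_apply ..

lemma freeRep_b (i : ZMod (3 * s)) :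
    freeRep K s (B K s i) = actA K (3 + i.val % 3) ((i.val / 3 : ℕ) : ZMod s) :=
  FreeAlgebra.lift_ι_apply ..

lemma freeRep_A (n : ℕ) :
    freeRep K s (A K s (n : ZMod (3 * s))) = actA K (n % 3) ((n / 3 : ℕ) : ZMod s) := by
  have h1 : (n % (3 * s)) % 3 = n % 3 := Nat.mod_mul_right_mod n 3 s
  have h2 : n % (3 * s) / 3 = n / 3 % s := Nat.mod_mul_right_div_self n 3 s
  rw [freeRep_a, ZMod.val_natCast, h1, h2, ZMod.natCast_mod]

lemma freeRep_B (n : ℕ) :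
    freeRep K s (B K s (n : ZMod (3 * s))) = actA K (3 + n % 3) ((n / 3 : ℕ) : ZMod s) := by
  have h1 : (n % (3 * s)) % 3 = n % 3 := Nat.mod_mul_right_mod n 3 s
  have h2 : n % (3 * s) / 3 = n / 3 % s := Nat.mod_mul_right_div_self n 3 s
  rw [freeRep_b, ZMod.val_natCast, h1, h2, ZMod.natCast_mod]

lemma freeRep_G (i : ZMod s) : freeRep K s (G K s i) = actA K 6 i :=
  FreeAlgebra.lift_ι_apply ..

lemma freeRep_rel {x y : F K s} (h : Rel K s x y) : freeRep K s x = freeRep K s y := by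
  induction h with
  | idem i j =>
    rw [map_mul, freeRep_E, freeRep_E, show freeRep K s (if i = j then E K s i else 0) =
      if i = j then actE K i else 0 by split_ifs <;> simp [freeRep_E]]
    refine end_ext fun v w d k _ => ?_
    rw [Module.End.mul_apply, actE_sg]
    by_cases h1 : vt s w (k + (d : ZMod s)) = j
    · rw [if_pos h1, actE_sg, h1]
      by_cases h2 : j = i
      · rw [if_pos h2, if_pos h2.symm, actE_sg, if_pos (h1.trans h2)]
      · rw [if_neg h2, if_neg (Ne.symm h2), LinearMap.zero_apply]
    · rw [if_neg h1, map_zero]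
      split_ifs with h2
      · rw [actE_sg, if_neg (h2 ▸ h1)]
      · rfl
  | sum_one =>
    rw [map_sum, map_one]
    simp only [freeRep_E]
    refine end_ext fun v w d k _ => ?_
    rw [LinearMap.sum_apply, Module.End.one_apply]
    simp only [actE_sg]
    rw [Finset.sum_eq_single_of_mem (vt s w (k + (d : ZMod s))).val
      (Finset.mem_range.2 (ZMod.val_lt _)), if_pos (by rw [ZMod.natCast_val, ZMod.cast_id', id])]
    intro n hn hne
    refine if_neg fun h => hne ?_
    rw [h, ZMod.val_natCast, Nat.mod_eq_of_lt (Finset.mem_range.1 hn)]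
  | a_tgt i =>
    rw [map_mul, freeRep_E, freeRep_a, actE_mul_actA _ (aTgt_eq i)]
  | a_src i =>
    rw [map_mul, freeRep_E, freeRep_a, actA_mul_actE _ (aSrc_eq i)]
  | b_tgt i =>
    rw [map_mul, freeRep_E, freeRep_b, actE_mul_actA _ (bTgt_eq i)]
  | b_src i =>
    rw [map_mul, freeRep_E, freeRep_b, actA_mul_actE _ (bSrc_eq i)]
  | g_tgt i =>
    rw [map_mul, freeRep_E, freeRep_G]
    exact actE_mul_actA i (by rw [gTgt, ← vt_zero_add_one]; simp [arTgt, arDeg])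
  | g_src i =>
    rw [map_mul, freeRep_E, freeRep_G]
    exact actA_mul_actE i rfl
  | len5 x₁ x₂ x₃ x₄ x₅ h₁ h₂ h₃ h₄ h₅ =>
    obtain ⟨τ₁, t₁, k₁, e₁⟩ := freeRep_arrow h₁
    obtain ⟨τ₂, t₂, k₂, e₂⟩ := freeRep_arrow h₂
    obtain ⟨τ₃, t₃, k₃, e₃⟩ := freeRep_arrow h₃
    obtain ⟨τ₄, t₄, k₄, e₄⟩ := freeRep_arrow h₄
    obtain ⟨τ₅, t₅, k₅, e₅⟩ := freeRep_arrow h₅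
    rw [map_mul, map_mul, map_mul, map_mul, e₁, e₂, e₃, e₄, e₅, map_zero]
    refine end_ext fun v w d k h => ?_
    have h0 : sg K v w d k ∈ lenGE K s 0 := Submodule.subset_span ⟨v, w, d, k, h, by omega, rfl⟩
    have := actA_lenGE t₁ k₁ _ (actA_lenGE t₂ k₂ _ (actA_lenGE t₃ k₃ _ (actA_lenGE t₄ k₄ _
      (actA_lenGE t₅ k₅ _ h0))))
    rw [zero_add, show 1 + 1 + 1 + 1 + 1 = 5 from rfl, lenGE_five, Submodule.mem_bot] at this
    simpa only [Module.End.mul_apply, LinearMap.zero_apply] using this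
  | comm t =>
    simp only [map_mul, freeRep_A, freeRep_B]
    have e0 : 3 * (t : ℕ) / 3 = t := by omega
    have e1 : (3 * (t : ℕ) + 1) / 3 = t := by omega
    have e2 : (3 * (t : ℕ) + 2) / 3 = t := by omega
    have m0 : 3 * (t : ℕ) % 3 = 0 := by omega
    have m1 : (3 * (t : ℕ) + 1) % 3 = 1 := by omega
    have m2 : (3 * (t : ℕ) + 2) % 3 = 2 := by omega
    rw [e0, e1, e2, m0, m1, m2, show 3 + 0 = 3 from rfl, show 3 + 1 = 4 from rfl,
      show 3 + 2 = 5 from rfl]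
    refine end_ext fun v w d k h => ?_
    simp only [Module.End.mul_apply]
    rw [actA_sg, actA_sg]
    by_cases h' : sup v w d = true ∧ w = arSrc 0 ∧ k + (d : ZMod s) = ((t : ℕ) : ZMod s)
    · rw [if_pos h', if_pos (show _ ∧ w = arSrc 3 ∧ _ from h')]
      obtain ⟨-, rfl, hk⟩ := h'
      obtain ⟨hv, -, hd⟩ := sup_bound h
      simp only [arTgt, arDeg, add_zero, actA_sg]
      obtain ⟨h1, h2, h3, h4⟩ | h5 := sup_comm v hv d hd h
      · by_cases h5 : sup v 5 d = true
        · simp only [h1, h2, h3, h4, h5, hk, arSrc, arTgt, arDeg, and_self, if_true, actA_sg]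
        · have : sg K v 5 d k = 0 := by rw [sg, dif_neg h5]
          have h2' : sg K v 2 d k = 0 := by rw [sg, dif_neg (by rwa [h2])]
          have h4' : sg K v 4 d k = 0 := by rw [sg, dif_neg (by rwa [h4])]
          simp [h2', h4']
      · have : sg K v 5 d k = 0 := by rw [sg, dif_neg (by simp [h5])]
        split_ifs <;> simp [actA_sg, arTgt, arDeg, this]
    · rw [if_neg h', if_neg (show ¬ (_ ∧ w = arSrc 3 ∧ _) from h'), map_zero, map_zero, map_zero, map_zero]
  | zero_agb t =>
    simp only [map_mul, freeRep_A, freeRep_B, freeRep_G, map_zero]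
    have e3 : (3 * (t : ℕ) + 3) / 3 = t + 1 := by omega
    have e2 : (3 * (t : ℕ) + 2) / 3 = t := by omega
    have m3 : (3 * (t : ℕ) + 3) % 3 = 0 := by omega
    have m2 : (3 * (t : ℕ) + 2) % 3 = 2 := by omega
    rw [e3, e2, m3, m2]
    refine end_ext fun v w d k h => ?_
    simp only [Module.End.mul_apply, LinearMap.zero_apply]
    rw [actA_sg]
    split_ifs with h'
    · obtain ⟨-, rfl, hk⟩ := h'
      obtain ⟨hv, -, hd⟩ := sup_bound h
      rw [actA_sg]
      split_ifs with h'
      · rw [actA_sg]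
        split_ifs with h''
        · rw [sg, dif_neg]
          have := (sup_zero v hv d hd).1 h h'.1 h''.1
          simpa [arTgt, arDeg] using this
        · rfl
      · rw [map_zero]
    · rw [map_zero, map_zero]
  | zero_bga t =>
    simp only [map_mul, freeRep_A, freeRep_B, freeRep_G, map_zero]
    have e3 : (3 * (t : ℕ) + 3) / 3 = t + 1 := by omega
    have e2 : (3 * (t : ℕ) + 2) / 3 = t := by omega
    have m3 : (3 * (t : ℕ) + 3) % 3 = 0 := by omega
    have m2 : (3 * (t : ℕ) + 2) % 3 = 2 := by omega
    rw [e3, e2, m3, m2]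
    refine end_ext fun v w d k h => ?_
    simp only [Module.End.mul_apply, LinearMap.zero_apply]
    rw [actA_sg]
    split_ifs with h'
    · obtain ⟨-, rfl, hk⟩ := h'
      obtain ⟨hv, -, hd⟩ := sup_bound h
      rw [actA_sg]
      split_ifs with h'
      · rw [actA_sg]
        split_ifs with h''
        · rw [sg, dif_neg]
          have := (sup_zero v hv d hd).2 h h'.1 h''.1
          simpa [arTgt, arDeg] using this
        · rfl
      · rw [map_zero]
    · rw [map_zero, map_zero]

/-- The regular representation of `R_s` in the path basis. -/
noncomputable def algRep (K : Type u) [Field K] (s : ℕ) [NeZero s] :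
    Alg K s →ₐ[K] Module.End K (Idx s →₀ K) :=
  RingQuot.liftAlgHom K ⟨freeRep K s, fun _ _ h => freeRep_rel h⟩

lemma algRep_mk (x : F K s) :
    algRep K s (RingQuot.mkAlgHom K (Rel K s) x) = freeRep K s x :=
  RingQuot.liftAlgHom_mkAlgHom_apply ..

lemma algRep_ar {τ : ℕ} (hτ : τ < 7) (k : ZMod s) : algRep K s (ar K τ k) = actA K τ k := by
  have e0 : 3 * k.val / 3 = k.val := by omega
  have e1 : (3 * k.val + 1) / 3 = k.val := by omega
  have e2 : (3 * k.val + 2) / 3 = k.val := by omega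
  have m0 : 3 * k.val % 3 = 0 := by omega
  have m1 : (3 * k.val + 1) % 3 = 1 := by omega
  have m2 : (3 * k.val + 2) % 3 = 2 := by omega
  have hk : ((k.val : ℕ) : ZMod s) = k := by rw [ZMod.natCast_val, ZMod.cast_id', id]
  interval_cases τ <;> simp only [ar, aa, bb, gg, algRep_mk, add_zero, freeRep_A, freeRep_B,
    freeRep_G, e0, e1, e2, m0, m1, m2, hk]

/-- The sum of the vectors of trivial paths. -/
noncomputable def unitVec (K : Type u) [Field K] (s : ℕ) [NeZero s] : Idx s →₀ K :=
  ∑ v ∈ Finset.range 6, ∑ k : ZMod s, sg K v v 0 k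

lemma algRep_ev {v : ℕ} (hv : v < 6) (k : ZMod s) :
    algRep K s (ev K v k) (unitVec K s) = sg K v v 0 k := by
  rw [ev, if_pos hv, ee, algRep_mk, freeRep_E, unitVec, map_sum,
    Finset.sum_eq_single_of_mem v (Finset.mem_range.2 hv), map_sum,
    Finset.sum_eq_single_of_mem k (Finset.mem_univ k)]
  · rw [actE_sg, if_pos (by rw [Nat.cast_zero, add_zero])]
  · intro l _ hl
    rw [actE_sg, if_neg]
    rw [Nat.cast_zero, add_zero, vt_inj hv hv]
    exact fun h => hl h.2
  · intro w hw hne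
    rw [map_sum]
    refine Finset.sum_eq_zero fun l _ => ?_
    rw [actE_sg, if_neg]
    rw [Nat.cast_zero, add_zero, vt_inj (Finset.mem_range.1 hw) hv]
    exact fun h => hne h.1

lemma algRep_pth (v w d : ℕ) (k : ZMod s) :
    algRep K s (pth K v w d k) (unitVec K s) = sg K v w d k := by
  by_cases h : sup v w d = true
  · obtain ⟨n, hn⟩ : ∃ n, plen v w d = n := ⟨_, rfl⟩
    induction n generalizing w d with
    | zero =>
      obtain ⟨hv, hw, hd⟩ := sup_bound h
      have h0 : ¬ (v ≠ w ∨ d ≠ 0) := by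
        intro h0
        obtain ⟨-, -, -, -, h5⟩ := arLast_spec v hv w hw d hd h h0
        omega
      obtain ⟨rfl, rfl⟩ : v = w ∧ d = 0 := by tauto
      rw [pth_self, algRep_ev hv]
    | succ n ih =>
      have h0 : v ≠ w ∨ d ≠ 0 := by
        by_contra h0
        obtain ⟨rfl, rfl⟩ : v = w ∧ d = 0 := by tauto
        simp [plen] at hn
      obtain ⟨hv, hw, hd⟩ := sup_bound h
      obtain ⟨h1, h2, h3, h4, h5⟩ := arLast_spec v hv w hw d hd h h0
      rw [pth_eq_ar_mul h h0, map_mul, Module.End.mul_apply, ih _ _ h4 (by omega), algRep_ar h1,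
        actA_sg, if_pos ⟨h4, rfl, rfl⟩, h2, Nat.sub_add_cancel h3]
  · rw [pth_of_not_sup h, sg, dif_neg h, map_zero, LinearMap.zero_apply]

lemma linearIndependent_pb : LinearIndependent K (pb K : Idx s → Alg K s) := by
  let φ : Alg K s →ₗ[K] (Idx s →₀ K) :=
    (LinearMap.applyₗ (unitVec K s)).comp (algRep K s).toLinearMap
  refine LinearIndependent.of_comp φ ?_
  have : (φ ∘ pb K : Idx s → _) = Finsupp.basisSingleOne (R := K) (ι := Idx s) := by
    funext x
    rw [Finsupp.coe_basisSingleOne]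
    refine (algRep_pth _ _ _ _).trans ?_
    rw [sg, dif_pos x.2]
  rw [this]
  exact Module.Basis.linearIndependent _

lemma pth_mem_span (v w d : ℕ) (k : ZMod s) :
    pth K v w d k ∈ Submodule.span K (Set.range (pb K : Idx s → Alg K s)) := by
  by_cases h : sup v w d = true
  · exact Submodule.subset_span ⟨⟨(v, w, d, k), h⟩, rfl⟩
  · rw [pth_of_not_sup h]; exact zero_mem _

lemma aa_eq_ar (i : ZMod (3 * s)) : aa K s i = ar K (i.val % 3) ((i.val / 3 : ℕ) : ZMod s) := by
  have h3 : i.val % 3 < 3 := Nat.mod_lt _ (by norm_num)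
  have hi : ((i.val : ℕ) : ZMod (3 * s)) = i := by rw [ZMod.natCast_val, ZMod.cast_id', id]
  conv_lhs => rw [← hi]
  generalize hj : i.val % 3 = j at *
  interval_cases j <;> rw [ar, val_div_three] <;> congr 2 <;> omega

lemma bb_eq_ar (i : ZMod (3 * s)) :
    bb K s i = ar K (3 + i.val % 3) ((i.val / 3 : ℕ) : ZMod s) := by
  have h3 : i.val % 3 < 3 := Nat.mod_lt _ (by norm_num)
  have hi : ((i.val : ℕ) : ZMod (3 * s)) = i := by rw [ZMod.natCast_val, ZMod.cast_id', id]
  conv_lhs => rw [← hi]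
  generalize hj : i.val % 3 = j at *
  interval_cases j <;> rw [ar, val_div_three] <;> congr 2 <;> omega

lemma ee_eq_ev (i : ZMod (6 * s)) :
    ee K s i = ev K (i.val % 6) ((i.val / 6 : ℕ) : ZMod s) := by
  have := ZMod.val_lt i
  have hi : ((i.val : ℕ) : ZMod (6 * s)) = i := by rw [ZMod.natCast_val, ZMod.cast_id', id]
  rw [ev, if_pos (Nat.mod_lt _ (by norm_num)), vt_natCast, Nat.div_add_mod, hi]

lemma span_pb : Submodule.span K (Set.range (pb K : Idx s → Alg K s)) = ⊤ := by
  set N := Submodule.span K (Set.range (pb K : Idx s → Alg K s)) with hN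
  have hpth (v w d : ℕ) (k : ZMod s) : pth K v w d k ∈ N := pth_mem_span v w d k
  have har {τ : ℕ} (hτ : τ < 7) (l : ZMod s) {n : Alg K s} (hn : n ∈ N) : ar K τ l * n ∈ N := by
    induction hn using Submodule.span_induction with
    | mem x hx =>
      obtain ⟨⟨⟨v, w, d, k⟩, h⟩, rfl⟩ := hx
      change ar K τ l * pth K v w d k ∈ N
      by_cases h' : w = arSrc τ ∧ l = k + (d : ZMod s)
      · obtain ⟨rfl, rfl⟩ := h'
        rw [ar_mul_pth hτ h]
        exact hpth _ _ _ _
      · rw [← ar_src hτ, ← ev_mul_pth v w, mul_assoc, ← mul_assoc (ev K _ l), ev_mul_ev, if_neg,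
          zero_mul, mul_zero]
        · exact zero_mem _
        · exact fun h => h' ⟨h.1.symm, h.2⟩
    | zero => rw [mul_zero]; exact zero_mem _
    | add x y _ _ hx hy => rw [mul_add]; exact add_mem hx hy
    | smul c x _ hx => rw [mul_smul_comm]; exact Submodule.smul_mem _ _ hx
  have hev (v : ℕ) (l : ZMod s) {n : Alg K s} (hn : n ∈ N) : ev K v l * n ∈ N := by
    induction hn using Submodule.span_induction with
    | mem x hx =>
      obtain ⟨⟨⟨v', w, d, k⟩, h⟩, rfl⟩ := hx
      change ev K v l * pth K v' w d k ∈ N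
      rw [← ev_mul_pth v' w, ← mul_assoc, ev_mul_ev]
      split_ifs with h'
      · rw [h'.1, h'.2, ev_mul_pth]
        exact hpth _ _ _ _
      · rw [zero_mul]; exact zero_mem _
    | zero => rw [mul_zero]; exact zero_mem _
    | add x y _ _ hx hy => rw [mul_add]; exact add_mem hx hy
    | smul c x _ hx => rw [mul_smul_comm]; exact Submodule.smul_mem _ _ hx
  have hmul (x : F K s) : ∀ n ∈ N, RingQuot.mkAlgHom K (Rel K s) x * n ∈ N := by
    induction x using FreeAlgebra.induction with
    | grade0 r =>
      intro n hn
      rw [AlgHom.commutes, ← Algebra.smul_def]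
      exact Submodule.smul_mem _ _ hn
    | grade1 g =>
      intro n hn
      cases g with
      | e i => change ee K s i * n ∈ N; rw [ee_eq_ev]; exact hev _ _ hn
      | a i => change aa K s i * n ∈ N; rw [aa_eq_ar]; exact har (by omega) _ hn
      | b i => change bb K s i * n ∈ N; rw [bb_eq_ar]; exact har (by omega) _ hn
      | g i => exact har (τ := 6) (by omega) i hn
    | mul a b ha hb => intro n hn; rw [map_mul, mul_assoc]; exact ha _ (hb _ hn)
    | add a b ha hb => intro n hn; rw [map_add, add_mul]; exact add_mem (ha _ hn) (hb _ hn)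
  have h1 : (1 : Alg K s) ∈ N := by
    rw [← sum_ee]
    refine sum_mem fun i _ => ?_
    rw [ee_eq_ev, ← pth_self]
    exact hpth _ _ _ _
  rw [eq_top_iff]
  rintro a -
  obtain ⟨x, rfl⟩ := RingQuot.mkAlgHom_surjective K (Rel K s) a
  simpa using hmul x 1 h1

/-- The basis of `R_s` consisting of paths. -/
noncomputable def pathBasis (K : Type u) [Field K] (s : ℕ) [NeZero s] :
    Module.Basis (Idx s) K (Alg K s) :=
  Module.Basis.mk linearIndependent_pb span_pb.ge

lemma pathBasis_apply (x : Idx s) : pathBasis K s x = pb K x := Module.Basis.mk_apply ..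

instance : Module.Finite K (Alg K s) := Module.Finite.of_basis (pathBasis K s)

/-- Generators of the terms of the resolution: `100 * off + 10 * a + b`. -/
def genTable : List (List ℕ) :=
  [[0, 11, 22, 33, 44, 55], [10, 21, 30, 43, 52, 54, 105], [50, 114, 121, 132, 143, 205],
   [120, 140, 151, 153, 202, 204, 215, 235], [150, 200, 212, 213, 224, 231, 234, 242, 255],
   [210, 230, 252, 254, 301, 303, 325, 345], [300, 311, 322, 323, 333, 341, 344, 355, 405],
   [320, 340, 351, 353, 402, 404, 415, 435], [350, 414, 421, 432, 443, 505],
   [450, 501, 503, 514, 525, 532, 545], [500, 513, 524, 531, 542, 555],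
   [600, 613, 624, 631, 642, 655], [610, 623, 630, 641, 652, 654, 705],
   [650, 712, 723, 734, 741, 805], [720, 740, 751, 753, 802, 804, 815, 835],
   [750, 800, 811, 814, 822, 832, 833, 844, 855], [810, 830, 852, 854, 901, 903, 925, 945],
   [900, 913, 921, 924, 931, 942, 943, 955, 1005], [920, 940, 951, 953, 1002, 1004, 1015, 1035],
   [950, 1012, 1023, 1034, 1041, 1105], [1050, 1101, 1103, 1112, 1125, 1134, 1145],
   [1100, 1111, 1122, 1133, 1144, 1155]]

def diffTable : List (List (List ℕ)) :=
  [[[0, 1100], [100, 1200], [0, 1300], [300, 1400], [200, 1500], [400, 1500], [10, 1501]],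
   [[0, 100, 1200, 1300, 400, 1500], [10, 501, 1600], [10, 101, 110, 401, 1600], [210, 401, 1600], [210, 301, 310, 501, 1600], [11, 111, 411, 1601, 1610]],
   [[1, 100, 1200], [1, 1300, 400], [10, 1200, 300], [10, 1100, 400], [11, 301, 1500], [101, 1500], [11, 110, 1500], [310, 1500]],
   [[0, 1100, 1200, 300], [1, 1201, 400, 1500], [400, 1600], [301, 500, 1600], [10, 500, 1600], [201, 1400, 700], [500, 1700], [110, 1400, 700], [10, 1210, 1600, 700]],
   [[1, 1100, 200, 1300], [100, 500, 600], [10, 200, 700, 1800], [400, 1600, 1800], [11, 1110, 1501, 701], [110, 301, 1401], [11, 1310, 410, 1801], [510, 1710, 801]],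
   [[1, 101, 1201, 301, 400, 500], [10, 1400], [201, 1600], [10, 301, 500, 1600], [110, 1500], [110, 1201, 400, 1700], [301, 700], [10, 110, 1210, 310, 1600, 1700], [410, 701]],
   [[0, 100, 200, 1300], [0, 400, 1500, 1600], [100, 200, 500, 1700], [300, 400, 1600, 1700], [10, 201, 1701, 1800], [601, 1800], [110, 800], [10, 410, 1701, 1800]],
   [[0, 1100, 1200, 300], [500, 600], [10, 201, 1400, 1600], [400, 1700], [110, 301, 500, 1700], [11, 311, 1410, 510, 1601, 1701]],
   [[1, 1010, 100, 200, 300, 1400], [201, 301, 1500], [11, 1101, 401, 1500], [11, 1101, 110, 1500], [11, 110, 210, 1500], [301, 1310, 1500], [310, 1410, 500]],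
   [[1, 1100, 200], [200, 1300], [300, 1400], [100, 1500], [500, 600], [10, 1400, 1600]],
   [[1, 1010, 1101, 1201, 301, 401, 501], [10, 101, 1110, 201, 1501], [10, 1110, 201, 1210, 1501], [10, 1301, 310, 1401, 1501], [10, 310, 1401, 410, 1501], [10, 1110, 1210, 310, 410, 1501, 510]],
   [[0, 100], [100, 1200], [0, 300], [300, 1400], [400, 1500], [200, 1500], [10, 1501]],
   [[0, 1100, 1200, 300, 400, 1500], [10, 401, 1600], [10, 101, 1110, 501, 1600], [210, 501, 1600], [210, 301, 1310, 401, 1600], [11, 1111, 1511, 1601, 610]],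
   [[1, 1100, 200], [1, 300, 1400], [10, 1100, 400], [10, 1200, 300], [101, 1500], [11, 301, 1500], [11, 1110, 1500], [310, 500]],
   [[0, 1100, 1200, 300], [1, 301, 400, 1500], [201, 400, 1600], [500, 1600], [10, 400, 1600], [400, 700], [301, 1500, 1700], [110, 1500, 1700], [10, 310, 1600, 1700]],
   [[1, 1100, 200, 1300], [100, 1500, 1600], [400, 1500, 1800], [10, 300, 700, 1800], [110, 201, 1401], [11, 1110, 1601, 701], [11, 210, 1410, 1801], [610, 1710, 1801]],
   [[1, 101, 1201, 301, 1400, 1500], [10, 1500], [10, 201, 400, 1600], [301, 1600], [110, 1400], [201, 1700], [110, 1301, 500, 700], [10, 110, 1210, 310, 1600, 700], [410, 1601]],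
   [[0, 1100, 200, 1300], [0, 1400, 500, 600], [200, 400, 1500, 1700], [100, 300, 600, 1700], [10, 1501, 1701, 800], [301, 1800], [10, 1110, 1701, 800], [410, 800]],
   [[0, 1100, 1200, 300], [400, 1600], [10, 301, 1500, 1600], [500, 700], [110, 201, 1400, 700], [11, 1211, 410, 510, 1601, 701]],
   [[1, 10, 100, 1200, 1300, 400], [11, 101, 401, 1500], [201, 301, 1500], [11, 101, 110, 1500], [11, 110, 1210, 1500], [301, 310, 1500], [310, 1410, 1500]],
   [[1, 1100, 200], [100, 1300], [300, 1400], [200, 1500], [500, 1600], [10, 1400, 600]],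
   [[1, 10, 101, 201, 1301, 1401, 1501], [10, 101, 110, 201, 1501], [10, 110, 201, 210, 1501], [10, 1301, 1310, 1401, 1501], [10, 1310, 1401, 1410, 1501], [10, 110, 210, 1310, 1410, 1501, 1510]]]

def homTable : List (List (ℕ × List ℕ)) :=
  [[(1, [1, 101, 401, 1600]), (10, [0]), (20, [0, 100]), (30, [200]), (40, [200, 300]),
   (50, [0, 100, 400]), (101, [101, 401, 1600]), (111, [10, 101, 401, 1600]), (120, [100]),
   (150, [100, 400]), (201, [401, 1600]), (211, [10, 401, 1600]), (221, [10, 110, 401, 1600]),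
   (250, [400]), (301, [301, 501, 1600]), (331, [210, 301, 501, 1600]), (340, [300]),
   (350, [300, 500]), (401, [501, 1600]), (431, [210, 501, 1600]), (441, [210, 310, 501, 1600]),
   (450, [500]), (501, [1600]), (511, [10, 1600]), (521, [10, 110, 1600]), (531, [210, 1600]),
   (541, [210, 310, 1600]), (551, [10, 110, 410, 1600])], [(11, [1, 100]), (121, [200]),
   (201, [1001]), (231, [1001, 300]), (250, [1000]), (341, [400]), (431, [300]), (441, [300]),
   (451, [10, 300]), (511, [100]), (521, [100]), (551, [100]), (601, [1500])], [(21, [0]),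
   (41, [100]), (51, [0, 1200]), (101, [500]), (111, [500, 1600]), (201, [1201, 400]),
   (211, [1201]), (221, [10, 1201]), (250, [1200]), (301, [400]), (331, [400, 1700]),
   (401, [301, 500]), (431, [301]), (441, [1110, 301]), (450, [300]), (501, [410, 1701]),
   (510, [1600]), (520, [10, 1600]), (530, [1700]), (540, [1700]), (550, [1700])], [(1, [100]),
   (11, [1, 1300]), (21, [1, 1300, 400]), (101, [1001, 100]), (131, [1001, 1500]),
   (141, [1001, 1500, 700]), (150, [1000]), (231, [500]), (241, [500, 1700]),
   (251, [1010, 500, 1700]), (311, [300]), (321, [300, 1400]), (351, [300, 1400]),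
   (401, [1011, 110, 1701]), (410, [200]), (420, [200]), (440, [1700]), (450, [1010, 1700]),
   (501, [601]), (520, [400]), (530, [600]), (540, [600]), (550, [600]), (601, [110, 1801]),
   (611, [11, 1310, 1801]), (650, [1800]), (731, [510, 801])], [(51, [0, 100, 1200, 300]),
   (101, [101, 400]), (110, [1000]), (120, [1000]), (130, [100]), (140, [100]), (150, [100]),
   (201, [201]), (211, [201]), (250, [200]), (301, [301, 500]), (311, [10, 301, 500]),
   (350, [300]), (401, [301]), (411, [301]), (421, [301, 1600]), (450, [300]), (501, [1400]),
   (531, [1110, 201, 1400]), (631, [1301]), (731, [201]), (741, [201, 700]), (821, [1600]),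
   (841, [700]), (851, [700])], [(1, [0]), (11, [0, 100]), (131, [0, 400]), (221, [200]),
   (251, [200, 1700]), (341, [600]), (351, [600]), (401, [10, 1101]), (410, [1100]),
   (420, [1100]), (440, [500]), (450, [1100]), (501, [1401]), (520, [300]), (530, [1400]),
   (540, [1400]), (550, [1400]), (601, [10, 1701, 1800]), (611, [10, 110, 1701]),
   (621, [1210, 1701]), (650, [1700]), (701, [800]), (731, [800]), (741, [1510, 800])],
   [(1, [1, 301, 1400, 500]), (20, [0]), (40, [100]), (50, [0, 300]), (111, [201, 1400, 1600]),
   (201, [400]), (211, [400, 600]), (221, [1010, 400, 600]), (301, [301, 500]), (311, [301]),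
   (321, [301]), (350, [300]), (431, [301, 500, 1700]), (501, [201, 1400]), (531, [201, 1400]),
   (541, [110, 201, 1400]), (550, [200]), (601, [500]), (631, [500]), (641, [500]),
   (731, [1700]), (741, [110, 1700]), (751, [10, 310, 1600, 1700]), (801, [601]), (810, [600]),
   (820, [600]), (850, [600])], [(11, [1]), (21, [1, 200]), (101, [1001]), (131, [1001, 1300]),
   (141, [1001, 1300, 400]), (150, [1000]), (221, [200]), (231, [300]), (241, [300]),
   (251, [200, 300]), (341, [400]), (351, [10, 1100, 400]), (401, [301, 1500]), (430, [300]),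
   (440, [300]), (450, [300]), (501, [101]), (510, [100]), (520, [100]), (550, [100]),
   (611, [11, 110, 1500]), (701, [1500]), (731, [1310, 1500])], [(51, [0]), (111, [1300]),
   (201, [100]), (211, [100]), (221, [100, 1400]), (331, [500]), (401, [200]), (431, [200]),
   (441, [200, 600]), (501, [110, 1401]), (520, [1400]), (540, [600]), (550, [600])], [(1, [0]),
   (11, [0, 1100]), (21, [0, 1100, 1200]), (31, [0, 300]), (41, [0, 300, 400]),
   (51, [0, 1100, 1200, 300, 400, 500]), (101, [1010, 301, 401, 501]), (130, [300]),
   (140, [300, 400]), (150, [300, 400]), (201, [101, 201]), (210, [100]), (220, [100, 200]),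
   (250, [100, 200, 1500]), (301, [201]), (311, [10, 1110, 201, 1501]), (320, [200]),
   (350, [200, 1500]), (411, [10, 1110, 1501]), (421, [10, 1110, 1210, 1501]), (450, [1500]),
   (501, [1010, 401, 501]), (531, [1010, 1310, 401, 501]), (540, [400]), (550, [400]),
   (601, [10, 1501]), (631, [10, 310, 1501]), (641, [10, 310, 410, 1501])], [(1, [0]),
   (111, [100]), (221, [200]), (331, [1300]), (441, [1400]), (551, [1500])],
   [(1, [1, 1101, 1501, 600]), (10, [0]), (20, [0, 1100]), (30, [200]), (40, [200, 1300]),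
   (50, [0, 1100, 1500]), (101, [101, 501, 1600]), (111, [10, 101, 501, 1600]), (120, [100]),
   (150, [100, 500]), (201, [501, 1600]), (211, [10, 501, 1600]), (221, [10, 1110, 501, 1600]),
   (250, [500]), (301, [301, 401, 1600]), (331, [210, 301, 401, 1600]), (340, [300]),
   (350, [300, 400]), (401, [401, 1600]), (431, [210, 401, 1600]), (441, [210, 1310, 401, 1600]),
   (450, [400]), (501, [1600]), (511, [10, 1600]), (521, [10, 1110, 1600]), (531, [210, 1600]),
   (541, [210, 1310, 1600]), (551, [10, 1110, 1510, 1600])], [(11, [1, 1100]), (121, [200]),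
   (201, [1001]), (231, [1001, 1300]), (250, [1000]), (341, [400]), (411, [100]), (421, [100]),
   (451, [100]), (531, [300]), (541, [300]), (551, [10, 300]), (601, [1500])], [(21, [0]),
   (41, [100]), (51, [0, 300]), (101, [400]), (111, [400, 1600]), (201, [1301, 500]),
   (211, [1301]), (221, [10, 1301]), (250, [1300]), (301, [500]), (331, [500, 700]),
   (401, [201, 400]), (431, [201]), (441, [1110, 201]), (450, [200]), (501, [1410, 1601]),
   (510, [1600]), (520, [10, 1600]), (530, [700]), (540, [700]), (550, [700])], [(1, [100]),
   (11, [1, 200]), (21, [1, 200, 1400]), (101, [1001, 100]), (131, [1001, 600]),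
   (141, [1001, 600, 1700]), (150, [1000]), (211, [200]), (221, [200, 1400]), (251, [200, 1400]),
   (331, [600]), (341, [600, 1700]), (351, [1010, 600, 1700]), (401, [1110, 401]), (420, [400]),
   (430, [500]), (440, [500]), (450, [500]), (501, [301]), (510, [300]), (520, [300]),
   (540, [1700]), (550, [1010, 1700]), (611, [11, 210, 1801]), (650, [1800]), (701, [110, 1801]),
   (731, [610, 1801])], [(51, [0, 100, 1200, 300]), (101, [1001, 400]), (110, [1000]),
   (120, [1000]), (130, [100]), (140, [100]), (150, [100]), (201, [400]), (211, [10, 201, 400]),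
   (250, [200]), (311, [301]), (350, [300]), (411, [201]), (421, [201, 1600]), (450, [200]),
   (501, [1201]), (531, [1201]), (601, [301, 1500]), (631, [1110, 301, 1500]), (701, [301]),
   (731, [301]), (741, [301, 1700]), (821, [1600]), (841, [1700]), (851, [1700])],
   [(11, [0, 1100]), (101, [0]), (131, [0, 1400]), (241, [500]), (251, [500]), (321, [300]),
   (351, [300, 1700]), (401, [10, 1401]), (420, [200]), (430, [1400]), (440, [1400]),
   (450, [1400]), (501, [1101]), (510, [1100]), (520, [1100]), (540, [600]), (550, [1100]),
   (601, [1800]), (611, [1800]), (621, [210, 1800]), (650, [1700]), (701, [1010, 701, 1800]),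
   (731, [1010, 410, 701]), (741, [510, 701])], [(1, [1, 1201, 400, 500]), (20, [0]),
   (40, [100]), (50, [0, 1200]), (111, [301, 1500, 1600]), (201, [201, 1400]),
   (211, [201, 1400]), (221, [10, 201, 1400]), (250, [200]), (301, [500]), (311, [500]),
   (321, [500]), (431, [201, 1400, 700]), (501, [1400]), (531, [1400, 700]),
   (541, [110, 1400, 700]), (601, [301, 1500]), (631, [301]), (641, [301]), (650, [300]),
   (711, [1600]), (721, [10, 1600]), (751, [10, 1210, 1600, 700]), (801, [701]), (830, [700]),
   (840, [700]), (850, [700])], [(11, [1, 100]), (21, [1, 100, 1200]), (101, [1001]),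
   (131, [1001]), (141, [1001, 1400]), (150, [1000]), (211, [100]), (221, [100]), (241, [400]),
   (251, [10, 100, 400]), (321, [200]), (351, [200, 300]), (401, [101, 1500]), (410, [100]),
   (420, [100]), (450, [100]), (501, [301]), (530, [300]), (540, [300]), (550, [300]),
   (601, [1500]), (611, [11, 110, 1500]), (731, [1310, 500])], [(51, [0]), (111, [300]),
   (201, [200]), (211, [200]), (221, [200, 1400]), (331, [500]), (401, [100]), (431, [100]),
   (441, [100, 1600]), (501, [1110, 1601]), (520, [1400]), (540, [1600]), (550, [1600])],
   [(1, [0]), (11, [0, 100]), (21, [0, 100, 200]), (31, [0, 1300]), (41, [0, 1300, 1400]),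
   (51, [0, 100, 200, 1300, 1400, 1500]), (101, [10, 101, 201, 1501]), (110, [100]),
   (120, [100, 200]), (150, [100, 200, 1500]), (201, [301, 401]), (230, [300]),
   (240, [300, 400]), (250, [300, 400]), (301, [10, 201, 1501]), (311, [10, 110, 201, 1501]),
   (320, [200]), (350, [200, 1500]), (401, [10, 1501]), (411, [10, 110, 1501]),
   (421, [10, 110, 210, 1501]), (450, [1500]), (501, [401]), (531, [1010, 310, 401, 501]),
   (540, [400]), (550, [400]), (631, [1010, 310, 501]), (641, [1010, 310, 410, 501])], [(1, [0]),
   (111, [100]), (221, [200]), (331, [1300]), (441, [1400]), (551, [1500])]]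

/-! ### The tables of the resolution -/

/-- The origin of the generator `g` of the `t`-th term. -/
def gAT (t g : ℕ) : ℕ := match (genTable.getD t []).getD g 66 with | c => c / 10 % 10
/-- The end of the generator `g` of the `t`-th term. -/
def gBT (t g : ℕ) : ℕ := match (genTable.getD t []).getD g 66 with | c => c % 10
/-- The offset of the generator `g` of the `t`-th term. -/
def gOT (t g : ℕ) : ℕ := (genTable.getD t []).getD g 66 / 100

/-- Formal linear combinations of terms `(g, dq, dp)`. -/
abbrev Chain := List (ℤ × ℕ × ℕ × ℕ)

/-- Decoding of table entries. -/
def dec (c : ℕ) : ℤ × ℕ × ℕ × ℕ :=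
  (bif Nat.ble 1000 c then -1 else 1, c / 100 % 10, c / 10 % 10, c % 10)

/-- The differential applied to a generator. -/
def dT (t g : ℕ) : Chain := ((diffTable.getD t []).getD g []).map dec

/-- The contracting homotopy applied to a path ending at a generator. -/
def hT (t g w d : ℕ) : Chain :=
  (((homTable.getD t []).lookup (100 * g + 10 * w + d)).getD []).map dec

/-- Whether the term `x` with left factor ending at `w` and right factor starting at `v` is
nonzero. -/
def okT (t v w : ℕ) (x : ℕ × ℕ × ℕ) : Bool :=
  sup v (gBT t x.1) x.2.1 && sup (gAT t x.1) w x.2.2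

/-- Multiplication of a term by a pair of paths. -/
def shiftC (dq dp : ℕ) (y : ℤ × ℕ × ℕ × ℕ) : ℤ × ℕ × ℕ × ℕ :=
  (y.1, y.2.1, dq + y.2.2.1, dp + y.2.2.2)

/-- The differential on chains, from the term `t'` to the preceding term `t`. -/
def dC (t t' v w : ℕ) (ch : Chain) : Chain :=
  (ch.filter fun x => okT t' v w x.2).flatMap fun x =>
    (dT t x.2.1).map fun y => (x.1 * y.1, (shiftC x.2.2.1 x.2.2.2 y).2)

/-- The contracting homotopy on chains over the term `t`. -/
def hC (t v w : ℕ) (ch : Chain) : Chain :=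
  (ch.filter fun x => okT t v w x.2).flatMap fun x =>
    (hT t x.2.1 w x.2.2.2).map fun y => (x.1 * y.1, (shiftC x.2.2.1 0 y).2)

/-- The augmentation followed by its section on chains. -/
def eC (v w : ℕ) (ch : Chain) : Chain :=
  (ch.filter fun x => okT 0 v w x.2).map fun x => (x.1, w, x.2.2.1 + x.2.2.2, 0)

/-- Equality of triples. -/
def eqT (x y : ℕ × ℕ × ℕ) : Bool :=
  Nat.beq x.1 y.1 && (Nat.beq x.2.1 y.2.1 && Nat.beq x.2.2 y.2.2)

/-- Insertion of a summand into a chain. -/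
def insC (x : ℤ × ℕ × ℕ × ℕ) : Chain → Chain
  | [] => [x]
  | y :: l => bif eqT x.2 y.2 then (x.1 + y.1, y.2) :: l else y :: insC x l

/-- Whether a chain represents zero. -/
def zeroC (t v w : ℕ) (ch : Chain) : Bool :=
  (ch.foldr (fun x l => bif okT t v w x.2 then insC x l else l) []).all fun x => decide (x.1 = 0)

/-- All quantified values below a bound. -/
def allB (n : ℕ) (p : ℕ → Bool) : Bool := (List.range n).all p

lemma allB_spec {n : ℕ} {p : ℕ → Bool} (h : allB n p = true) {i : ℕ} (hi : i < n) : p i = true :=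
  List.all_eq_true.1 h i (List.mem_range.2 hi)

/-- Consistency of the table of differentials. -/
def checkD (t : ℕ) : Bool :=
  allB 9 fun g => (dT t g).all fun y =>
    Nat.blt y.2.1 9 && (sup (gBT ((t + 1) % 22) g) (gBT t y.2.1) y.2.2.1 &&
      (sup (gAT t y.2.1) (gAT ((t + 1) % 22) g) y.2.2.2 &&
        (Nat.beq (gOT ((t + 1) % 22) g + 12 * ((t + 1) / 22))
          (gOT t y.2.1 + y.2.2.1 + y.2.2.2) &&
        Nat.ble 1 (plen (gBT ((t + 1) % 22) g) (gBT t y.2.1) y.2.2.1 +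
          plen (gAT t y.2.1) (gAT ((t + 1) % 22) g) y.2.2.2))))

/-- Consistency of the table of the homotopy. -/
def checkH (t : ℕ) : Bool :=
  allB 9 fun g => allB 6 fun w => allB 2 fun d => (hT t g w d).all fun y =>
    Nat.blt y.2.1 9 && (sup (gBT t g) (gBT ((t + 1) % 22) y.2.1) y.2.2.1 &&
      sup (gAT ((t + 1) % 22) y.2.1) w y.2.2.2)

/-- The composite of two differentials vanishes. -/
def checkDD (t : ℕ) : Bool :=
  allB 9 fun g =>
    zeroC t (gBT ((t + 2) % 22) g) (gAT ((t + 2) % 22) g)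
      (dC t ((t + 1) % 22) (gBT ((t + 2) % 22) g) (gAT ((t + 2) % 22) g)
        (dT ((t + 1) % 22) g))

/-- The homotopy identity in positive degrees. -/
def checkDH (t : ℕ) : Bool :=
  let t1 := (t + 1) % 22
  let t2 := (t + 2) % 22
  allB 9 fun g => allB 6 fun w => allB 2 fun d =>
    zeroC t1 (gBT t1 g) w ((-1, g, 0, d) ::
      (dC t1 t2 (gBT t1 g) w (hC t1 (gBT t1 g) w [(1, g, 0, d)]) ++
        hC t (gBT t1 g) w (dC t t1 (gBT t1 g) w [(1, g, 0, d)])))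

/-- The homotopy identity in degree zero. -/
def checkE : Bool :=
  (allB 9 fun g => allB 6 fun w => allB 2 fun d =>
    zeroC 0 (gBT 0 g) w ((-1, g, 0, d) ::
      (dC 0 1 (gBT 0 g) w (hC 0 (gBT 0 g) w [(1, g, 0, d)]) ++
        eC (gBT 0 g) w [(1, g, 0, d)]))) &&
  (allB 9 fun g => zeroC 0 (gBT 1 g) (gAT 1 g) (eC (gBT 1 g) (gAT 1 g) (dT 0 g))) &&
  (allB 6 fun w => Nat.beq (gBT 0 w) w && Nat.beq (gAT 0 w) w && Nat.beq (gOT 0 w) 0) &&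
  (allB 9 fun g => Nat.blt g 6 || Nat.beq (gBT 0 g) 6)

lemma check_all :
    ((allB 22 fun t => checkD t && checkH t && checkDD t && checkDH t) && checkE) = true := by
  decide +kernel

/-! ### The terms of the resolution -/

open MulOpposite

/-- Labels of the generators of a term of the resolution. -/
abbrev GI (s : ℕ) := Fin 9 × ZMod s

/-- The free module containing the terms of the resolution. -/
def Fr (K : Type u) [Field K] (s : ℕ) : Type u := GI s → Env K s

noncomputable instance : AddCommGroup (Fr K s) := inferInstanceAs (AddCommGroup (GI s → Env K s))

noncomputable instance : Module (Env K s) (Fr K s) :=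
  inferInstanceAs (Module (Env K s) (GI s → Env K s))

noncomputable instance : Module K (Fr K s) := inferInstanceAs (Module K (GI s → Env K s))

instance : IsScalarTower K (Env K s) (Fr K s) :=
  inferInstanceAs (IsScalarTower K (Env K s) (GI s → Env K s))

instance : SMulCommClass (Env K s) K (Fr K s) :=
  inferInstanceAs (SMulCommClass (Env K s) K (GI s → Env K s))

/-- Functions concentrated at one label. -/
noncomputable def sgl (i : GI s) : Env K s →ₗ[Env K s] Fr K s :=
  LinearMap.single (Env K s) (fun _ : GI s => Env K s) i

lemma smul_sgl (x y : Env K s) (i : GI s) : x • (sgl i y : Fr K s) = sgl i (x * y) := by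
  rw [← smul_eq_mul, map_smul]

/-- Origin of a generator. -/
def gA (n g : ℕ) : ℕ := gAT (n % 22) g
/-- End of a generator. -/
def gB (n g : ℕ) : ℕ := gBT (n % 22) g
/-- Offset of a generator. -/
def gO (n g : ℕ) : ℕ := gOT (n % 22) g + 12 * (n / 22)

variable (K) in
/-- The term `(g, dq, dp)` for paths starting at `6k + v` and ending at a vertex of type `w`. -/
noncomputable def term (n v w : ℕ) (k : ZMod s) (x : ℕ × ℕ × ℕ) : Fr K s :=
  if h : x.1 < 9 then
    sgl ((⟨x.1, h⟩, k + (x.2.1 : ZMod s)) : GI s)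
      (pth K (gA n x.1) w x.2.2 (k + (x.2.1 : ZMod s) + (gO n x.1 : ZMod s)) ⊗ₜ[K]
        op (pth K v (gB n x.1) x.2.1 k))
  else 0

variable (K) in
/-- The element represented by a chain. -/
noncomputable def evl (n v w : ℕ) (k : ZMod s) (ch : Chain) : Fr K s :=
  (ch.map fun x => x.1 • term K n v w k x.2).sum

lemma term_of_not_ok {n v w : ℕ} {x : ℕ × ℕ × ℕ} (h : okT (n % 22) v w x = false)
    (k : ZMod s) : term K n v w k x = 0 := by
  rw [term]
  split_ifs with h9
  · rw [okT, Bool.and_eq_false_iff] at h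
    rcases h with h | h
    · rw [pth_of_not_sup (v := v) (by rw [gB, h]; simp), op_zero, TensorProduct.tmul_zero,
        map_zero]
    · rw [pth_of_not_sup (w := w) (by rw [gA, h]; simp), TensorProduct.zero_tmul, map_zero]
  · rfl

@[simp] lemma evl_nil (n v w : ℕ) (k : ZMod s) : evl K n v w k [] = 0 := rfl

@[simp] lemma evl_cons (n v w : ℕ) (k : ZMod s) (x : ℤ × ℕ × ℕ × ℕ) (l : Chain) :
    evl K n v w k (x :: l) = x.1 • term K n v w k x.2 + evl K n v w k l := by
  simp [evl]

@[simp] lemma evl_append (n v w : ℕ) (k : ZMod s) (l l' : Chain) :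
    evl K n v w k (l ++ l') = evl K n v w k l + evl K n v w k l' := by
  simp [evl]

lemma eqT_iff {x y : ℕ × ℕ × ℕ} (h : eqT x y = true) : x = y := by
  obtain ⟨a, b, c⟩ := x
  obtain ⟨a', b', c'⟩ := y
  simp only [eqT, Bool.and_eq_true, Nat.beq_eq] at h
  simp [h]

lemma evl_insC (n v w : ℕ) (k : ZMod s) (x : ℤ × ℕ × ℕ × ℕ) (l : Chain) :
    evl K n v w k (insC x l) = x.1 • term K n v w k x.2 + evl K n v w k l := by
  induction l with
  | nil => simp [insC]
  | cons y l ih =>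
    rw [insC]
    cases h : eqT x.2 y.2
    · simp only [cond_false, evl_cons, ih]; abel
    · simp only [cond_true, evl_cons, eqT_iff h, add_smul]; abel

lemma evl_of_zeroC {n v w : ℕ} {ch : Chain} (h : zeroC (n % 22) v w ch = true) (k : ZMod s) :
    evl K n v w k ch = 0 := by
  have h1 : evl K n v w k ch = evl K n v w k
      (ch.foldr (fun x l => bif okT (n % 22) v w x.2 then insC x l else l) []) := by
    clear h
    induction ch with
    | nil => rfl
    | cons x l ih =>
      rw [List.foldr_cons]
      cases hx : okT (n % 22) v w x.2
      · rw [evl_cons, term_of_not_ok hx, cond_false, ih, smul_zero, zero_add]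
      · rw [evl_cons, cond_true, evl_insC, ih]
  rw [h1]
  rw [zeroC, List.all_eq_true] at h
  refine List.sum_eq_zero fun y hy => ?_
  obtain ⟨x, hx, rfl⟩ := List.mem_map.1 hy
  rw [of_decide_eq_true (h x hx), zero_smul]

lemma check_spec {n : ℕ} : checkD (n % 22) = true ∧ checkH (n % 22) = true ∧
    checkDD (n % 22) = true ∧ checkDH (n % 22) = true := by
  have h := check_all
  rw [Bool.and_eq_true] at h
  have := allB_spec h.1 (Nat.mod_lt n (by norm_num : 0 < 22))
  simpa [and_assoc] using this

lemma checkD_spec {n g : ℕ} (hg : g < 9) {y : ℤ × ℕ × ℕ × ℕ} (hy : y ∈ dT (n % 22) g) :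
    y.2.1 < 9 ∧ sup (gB (n + 1) g) (gB n y.2.1) y.2.2.1 = true ∧
      sup (gA n y.2.1) (gA (n + 1) g) y.2.2.2 = true ∧
      gO (n + 1) g = gO n y.2.1 + y.2.2.1 + y.2.2.2 ∧
      1 ≤ plen (gB (n + 1) g) (gB n y.2.1) y.2.2.1 +
        plen (gA n y.2.1) (gA (n + 1) g) y.2.2.2 := by
  have h := List.all_eq_true.1 (allB_spec (check_spec (n := n)).1 hg) y hy
  have e : (n % 22 + 1) % 22 = (n + 1) % 22 := by omega
  have e' : (n + 1) / 22 = n / 22 + (n % 22 + 1) / 22 := by omega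
  simp only [Bool.and_eq_true, Nat.blt_eq, Nat.beq_eq, Nat.ble_eq, e] at h
  simp only [gA, gB, gO, e']
  refine ⟨h.1, h.2.1, h.2.2.1, ?_, h.2.2.2.2⟩
  have := h.2.2.2.1
  omega

lemma checkH_spec {n g w d : ℕ} (hg : g < 9) (hw : w < 6) (hd : d < 2) {y : ℤ × ℕ × ℕ × ℕ}
    (hy : y ∈ hT (n % 22) g w d) :
    y.2.1 < 9 ∧ sup (gB n g) (gB (n + 1) y.2.1) y.2.2.1 = true ∧
      sup (gA (n + 1) y.2.1) w y.2.2.2 = true := by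
  have h := List.all_eq_true.1 (allB_spec (allB_spec (allB_spec
    (check_spec (n := n)).2.1 hg) hw) hd) y hy
  have e : (n % 22 + 1) % 22 = (n + 1) % 22 := by omega
  simp only [Bool.and_eq_true, Nat.blt_eq, e] at h
  exact h

/-- The value of the differential on a generator. -/
noncomputable def DD (n : ℕ) (i : GI s) : Fr K s :=
  evl K n (gB (n + 1) i.1) (gA (n + 1) i.1) i.2 (dT (n % 22) i.1)

variable (K s) in
/-- The differential on the free modules. -/
noncomputable def dF (n : ℕ) : Fr K s →ₗ[Env K s] Fr K s :=
  Fintype.linearCombination (Env K s) (DD n)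

lemma dF_sgl (n : ℕ) (i : GI s) (x : Env K s) : dF K s n (sgl i x) = x • DD n i :=
  Fintype.linearCombination_apply_single _ _ _ _

lemma smul_term {n v w v' w' dq dp : ℕ} {x : ℕ × ℕ × ℕ} (k : ZMod s) (l : ZMod s)
    (h1 : sup v' v dq = true) (h2 : sup w w' dp = true) (hx : okT (n % 22) v w x = true)
    (hl : l = k + (dq : ZMod s) + (x.2.1 + gO n x.1 + x.2.2 : ℕ)) :
    (pth K w w' dp l ⊗ₜ[K] op (pth K v' v dq k)) • term K n v w (k + (dq : ZMod s)) x =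
      term K n v' w' k (x.1, dq + x.2.1, dp + x.2.2) := by
  rw [term, term]
  rw [okT, Bool.and_eq_true] at hx
  change sup v (gB n x.1) _ = true ∧ sup (gA n x.1) _ _ = true at hx
  split_ifs with h9
  · rw [smul_sgl, Algebra.TensorProduct.tmul_mul_tmul, ← op_mul]
    rw [show k + ((dq + x.2.1 : ℕ) : ZMod s) = k + (dq : ZMod s) + (x.2.1 : ZMod s) by
      push_cast; ring]
    rw [pth_mul_pth h1 hx.1, add_comm dp, ← pth_mul_pth hx.2 h2, hl]
    congr 4
    push_cast
    ring
  · rw [smul_zero]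

lemma dF_term {n v w : ℕ} {k : ZMod s} {x : ℕ × ℕ × ℕ} (hx : okT ((n + 1) % 22) v w x = true)
    (hg : x.1 < 9) :
    dF K s n (term K (n + 1) v w k x) = evl K n v w k
      ((dT (n % 22) x.1).map fun y => (y.1, (shiftC x.2.1 x.2.2 y).2)) := by
  rw [term, dif_pos hg, dF_sgl, DD, evl, evl, List.smul_sum, List.map_map, List.map_map]
  congr 1
  refine List.map_congr_left fun y hy => ?_
  obtain ⟨h1, h2, h3, h4, -⟩ := checkD_spec hg hy
  rw [okT, Bool.and_eq_true] at hx
  simp only [Function.comp, shiftC]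
  rw [smul_comm, smul_term]
  · exact hx.1
  · exact hx.2
  · rw [okT, Bool.and_eq_true]; exact ⟨h2, h3⟩
  · rw [h4]; push_cast; ring

/-! ### The contracting homotopy -/

lemma dF_evl (n v w : ℕ) (k : ZMod s) {ch : Chain} (hch : ∀ x ∈ ch, x.2.1 < 9) :
    dF K s n (evl K (n + 1) v w k ch) = evl K n v w k (dC (n % 22) ((n + 1) % 22) v w ch) := by
  induction ch with
  | nil => simp [dC]
  | cons x l ih =>
    rw [evl_cons, map_add, map_zsmul, ih fun y hy => hch y (List.mem_cons_of_mem _ hy), dC, dC]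
    cases hx : okT ((n + 1) % 22) v w x.2
    · rw [term_of_not_ok hx, map_zero, smul_zero, zero_add, List.filter_cons_of_neg (by simp [hx])]
    · rw [List.filter_cons_of_pos (p := fun x : ℤ × ℕ × ℕ × ℕ => okT ((n + 1) % 22) v w x.2) hx,
        List.flatMap_cons, evl_append,
        dF_term hx (hch x List.mem_cons_self)]
      congr 1
      rw [evl, evl, List.smul_sum, List.map_map, List.map_map, List.map_map]
      congr 1
      refine List.map_congr_left fun y _ => ?_
      exact smul_smul ..

/-- The contracting homotopy on left factors at the label `i`. -/
noncomputable def HP (n : ℕ) (i : GI s) : Alg K s →ₗ[K] Fr K s :=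
  (pathBasis K s).constr K fun x =>
    if x.1.1 = gA n i.1 ∧ x.1.2.2.2 = i.2 + (gO n i.1 : ZMod s) then
      evl K (n + 1) (gB n i.1) x.1.2.1 i.2 (hT (n % 22) i.1 x.1.2.1 x.1.2.2.1)
    else 0

lemma HP_pth {n w d : ℕ} {i : GI s} (h : sup (gA n i.1) w d = true) :
    HP n i (pth K (gA n i.1) w d (i.2 + (gO n i.1 : ZMod s))) =
      evl K (n + 1) (gB n i.1) w i.2 (hT (n % 22) i.1 w d) := by
  have := (pathBasis K s).constr_basis K (fun x : Idx s =>
    if x.1.1 = gA n i.1 ∧ x.1.2.2.2 = i.2 + (gO n i.1 : ZMod s) then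
      evl K (n + 1) (gB n i.1) x.1.2.1 i.2 (hT (n % 22) i.1 x.1.2.1 x.1.2.2.1)
    else 0) ⟨(gA n i.1, w, d, i.2 + (gO n i.1 : ZMod s)), h⟩
  rw [pathBasis_apply] at this
  exact this.trans (if_pos ⟨rfl, rfl⟩)

/-- The right action of the algebra. -/
noncomputable def rgt (q : Alg K s) : Fr K s →ₗ[K] Fr K s where
  toFun f := ((1 : Alg K s) ⊗ₜ[K] op q) • f
  map_add' _ _ := smul_add ..
  map_smul' _ _ := smul_comm ..

lemma rgt_apply (q : Alg K s) (f : Fr K s) : rgt q f = ((1 : Alg K s) ⊗ₜ[K] op q) • f := rfl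

lemma rgt_mul (q q' : Alg K s) (f : Fr K s) : rgt q' (rgt q f) = rgt (q * q') f := by
  rw [rgt_apply, rgt_apply, rgt_apply, smul_smul, Algebra.TensorProduct.tmul_mul_tmul, one_mul,
    op_mul]

/-- The right action as a linear map. -/
noncomputable def rgtL (K : Type u) [Field K] (s : ℕ) [NeZero s] :
    Alg K s →ₗ[K] Fr K s →ₗ[K] Fr K s where
  toFun := rgt
  map_add' q q' := by
    ext1 f
    rw [LinearMap.add_apply, rgt_apply, rgt_apply, rgt_apply, op_add, TensorProduct.tmul_add,
      add_smul]
  map_smul' c q := by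
    ext1 f
    rw [LinearMap.smul_apply, rgt_apply, rgt_apply, op_smul, TensorProduct.tmul_smul,
      smul_assoc, RingHom.id_apply]

/-- The extension of a map of left modules to the enveloping algebra. -/
noncomputable def extR (f : Alg K s →ₗ[K] Fr K s) : Env K s →ₗ[K] Fr K s :=
  TensorProduct.lift (((rgtL K s).flip.comp f).compl₂
    (opLinearEquiv K : Alg K s ≃ₗ[K] (Alg K s)ᵐᵒᵖ).symm.toLinearMap)

lemma extR_tmul (f : Alg K s →ₗ[K] Fr K s) (p q : Alg K s) :
    extR f (p ⊗ₜ[K] op q) = rgt q (f p) := rfl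

lemma sgl_apply (i j : GI s) (x : Env K s) : (sgl i x : Fr K s) j = if j = i then x else 0 := by
  exact Pi.single_apply i x j

/-- The contracting homotopy. -/
noncomputable def hF (n : ℕ) : Fr K s →ₗ[K] Fr K s where
  toFun f := ∑ i, extR (HP n i) (f i)
  map_add' f g := by
    rw [← Finset.sum_add_distrib]
    exact Finset.sum_congr rfl fun i _ => map_add (extR (HP n i)) (f i) (g i)
  map_smul' c f := by
    rw [Finset.smul_sum]
    exact Finset.sum_congr rfl fun i _ => map_smul (extR (HP n i)) c (f i)

lemma hF_sgl (n : ℕ) (i : GI s) (x : Env K s) : hF n (sgl i x) = extR (HP n i) x := by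
  refine (Finset.sum_eq_single i (fun j _ hj => ?_) (by simp)).trans ?_
  · rw [sgl_apply, if_neg hj, map_zero]
  · rw [sgl_apply, if_pos rfl]

lemma hF_rgt (n : ℕ) (q : Alg K s) (f : Fr K s) : hF n (rgt q f) = rgt q (hF n f) := by
  change ∑ i, extR (HP n i) (((1 : Alg K s) ⊗ₜ[K] op q) * f i) = rgt q (∑ i, extR (HP n i) (f i))
  rw [map_sum]
  refine Finset.sum_congr rfl fun i _ => ?_
  induction f i using TensorProduct.induction_on with
  | zero => simp
  | tmul a b =>
    rw [Algebra.TensorProduct.tmul_mul_tmul, one_mul, ← op_unop b, ← op_mul, extR_tmul, extR_tmul,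
      rgt_mul]
  | add x y hx hy => rw [mul_add, map_add, map_add, map_add, hx, hy]

lemma hF_term {n v w : ℕ} {k : ZMod s} {x : ℕ × ℕ × ℕ} (hx : okT (n % 22) v w x = true)
    (hg : x.1 < 9) :
    hF n (term K n v w k x) = evl K (n + 1) v w k
      ((hT (n % 22) x.1 w x.2.2).map fun y => (y.1, (shiftC x.2.1 0 y).2)) := by
  have hx' := hx
  rw [okT, Bool.and_eq_true] at hx
  change sup v (gB n x.1) _ = true ∧ sup (gA n x.1) _ _ = true at hx
  rw [term, dif_pos hg, hF_sgl, extR_tmul, HP_pth hx.2, rgt_apply, evl, evl, List.smul_sum,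
    List.map_map, List.map_map]
  congr 1
  refine List.map_congr_left fun y hy => ?_
  obtain ⟨-, hw, hd⟩ := sup_bound hx.2
  obtain ⟨h1, h2, h3⟩ := checkH_spec hg hw hd hy
  simp only [Function.comp, shiftC]
  rw [smul_comm]
  congr 1
  rw [term, term]
  split_ifs
  rw [smul_sgl, Algebra.TensorProduct.tmul_mul_tmul, ← op_mul, pth_mul_pth hx.1 h2, one_mul,
    zero_add]
  rw [show k + ((x.2.1 + y.2.2.1 : ℕ) : ZMod s) = k + (x.2.1 : ZMod s) + (y.2.2.1 : ZMod s) by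
      push_cast; ring]

lemma hF_evl (n v w : ℕ) (k : ZMod s) {ch : Chain} (hch : ∀ x ∈ ch, x.2.1 < 9) :
    hF n (evl K n v w k ch) = evl K (n + 1) v w k (hC (n % 22) v w ch) := by
  induction ch with
  | nil => simp [hC]
  | cons x l ih =>
    rw [evl_cons, map_add, map_zsmul, ih fun y hy => hch y (List.mem_cons_of_mem _ hy), hC, hC]
    cases hx : okT (n % 22) v w x.2
    · rw [term_of_not_ok hx, map_zero, smul_zero, zero_add, List.filter_cons_of_neg (by simp [hx])]
    · rw [List.filter_cons_of_pos (p := fun x : ℤ × ℕ × ℕ × ℕ => okT (n % 22) v w x.2) hx,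
        List.flatMap_cons, evl_append,
        hF_term hx (hch x List.mem_cons_self)]
      congr 1
      rw [evl, evl, List.smul_sum, List.map_map, List.map_map, List.map_map]
      congr 1
      refine List.map_congr_left fun y _ => ?_
      exact smul_smul ..

lemma dC_lt (n v w : ℕ) {ch : Chain} (hch : ∀ x ∈ ch, x.2.1 < 9) :
    ∀ x ∈ dC (n % 22) ((n + 1) % 22) v w ch, x.2.1 < 9 := by
  intro x hx
  simp only [dC, List.mem_flatMap, List.mem_filter, List.mem_map] at hx
  obtain ⟨y, ⟨hy, -⟩, z, hz, rfl⟩ := hx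
  exact (checkD_spec (hch y hy) hz).1

lemma hC_lt (n v w : ℕ) {ch : Chain} (hch : ∀ x ∈ ch, x.2.1 < 9) :
    ∀ x ∈ hC (n % 22) v w ch, x.2.1 < 9 := by
  intro x hx
  simp only [hC, List.mem_flatMap, List.mem_filter, List.mem_map] at hx
  obtain ⟨y, ⟨hy, hok⟩, z, hz, rfl⟩ := hx
  rw [okT, Bool.and_eq_true] at hok
  obtain ⟨-, hw, hd⟩ := sup_bound hok.2
  exact (checkH_spec (hch y hy) hw hd hz).1

/-! ### The resolution -/

variable (K s) in
/-- The augmentation on the free module. -/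
noncomputable def epsF : Fr K s →ₗ[Env K s] Alg K s :=
  Fintype.linearCombination (Env K s) fun i : GI s => ev K i.1 i.2

lemma epsF_sgl (i : GI s) (x : Env K s) : epsF K s (sgl i x) = x • ev K i.1 i.2 :=
  Fintype.linearCombination_apply_single _ _ _ _

variable (K s) in
/-- The section of the augmentation. -/
noncomputable def secF : Alg K s →ₗ[K] Fr K s :=
  ∑ i : GI s, ((sgl i).restrictScalars K).comp
    ((TensorProduct.mk K (Alg K s) (Alg K s)ᵐᵒᵖ (ev K i.1 i.2)).comp
      ((opLinearEquiv K : Alg K s ≃ₗ[K] (Alg K s)ᵐᵒᵖ).toLinearMap.comp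
        (LinearMap.mulLeft K (ev K i.1 i.2))))

lemma secF_apply (r : Alg K s) :
    secF K s r = ∑ i : GI s, sgl i (ev K i.1 i.2 ⊗ₜ[K] op (ev K i.1 i.2 * r)) := by
  rw [secF, LinearMap.sum_apply]
  rfl

lemma secF_mul (r q : Alg K s) : secF K s (r * q) = rgt q (secF K s r) := by
  rw [secF_apply, secF_apply, map_sum]
  refine Finset.sum_congr rfl fun i _ => ?_
  rw [rgt_apply, smul_sgl, Algebra.TensorProduct.tmul_mul_tmul, one_mul, ← op_mul, mul_assoc]

lemma checkE_spec :
    (∀ g < 9, ∀ w < 6, ∀ d < 2, zeroC 0 (gBT 0 g) w ((-1, g, 0, d) ::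
      (dC 0 1 (gBT 0 g) w (hC 0 (gBT 0 g) w [(1, g, 0, d)]) ++
        eC (gBT 0 g) w [(1, g, 0, d)])) = true) ∧
    (∀ g < 9, zeroC 0 (gBT 1 g) (gAT 1 g) (eC (gBT 1 g) (gAT 1 g) (dT 0 g)) = true) ∧
    (∀ w < 6, gB 0 w = w ∧ gA 0 w = w ∧ gO 0 w = 0) ∧ (∀ g < 9, g < 6 ∨ gB 0 g = 6) := by
  have h := check_all
  rw [Bool.and_eq_true, checkE, Bool.and_eq_true, Bool.and_eq_true, Bool.and_eq_true] at h
  obtain ⟨-, ⟨⟨h1, h2⟩, h3⟩, h4⟩ := h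
  refine ⟨fun g hg w hw d hd => allB_spec (allB_spec (allB_spec h1 hg) hw) hd,
    fun g hg => allB_spec h2 hg, fun w hw => ?_, fun g hg => ?_⟩
  · simpa [and_assoc, gB, gA, gO] using allB_spec h3 hw
  · simpa [gB] using allB_spec h4 hg

lemma epsF_term {v w : ℕ} {k : ZMod s} {x : ℕ × ℕ × ℕ} (hx : okT 0 v w x = true)
    (hg : x.1 < 9) : epsF K s (term K 0 v w k x) = pth K v w (x.2.1 + x.2.2) k := by
  obtain ⟨-, -, h3, h4⟩ := checkE_spec
  rw [okT, Bool.and_eq_true] at hx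
  change sup v (gB 0 x.1) _ = true ∧ sup (gA 0 x.1) _ _ = true at hx
  have h6 : x.1 < 6 := by
    rcases h4 _ hg with h | h
    · exact h
    · have := (sup_bound hx.1).2.1
      omega
  obtain ⟨e1, e2, e3⟩ := h3 _ h6
  rw [e1, e2] at hx
  rw [term, dif_pos hg, epsF_sgl, e1, e2, e3, Nat.cast_zero, add_zero]
  change pth K x.1 w x.2.2 (k + (x.2.1 : ZMod s)) *
    (ev K x.1 (k + (x.2.1 : ZMod s)) * pth K v x.1 x.2.1 k) = _
  rw [ev_mul_pth, pth_mul_pth hx.1 hx.2]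

lemma secF_pth {v w d : ℕ} (hw : w < 6) (k : ZMod s) :
    secF K s (pth K v w d k) = term K 0 v w k (w, d, 0) := by
  obtain ⟨-, -, h3, -⟩ := checkE_spec
  obtain ⟨e1, e2, e3⟩ := h3 w hw
  have h9 : w < 9 := by omega
  rw [secF_apply, term, dif_pos h9, e1, e2, e3, pth_self, Nat.cast_zero, add_zero,
    Finset.sum_eq_single ((⟨w, h9⟩, k + (d : ZMod s)) : GI s)]
  · rw [ev_mul_pth]
  · intro i _ hi
    rw [← ev_mul_pth, ← mul_assoc, ev_mul_ev, if_neg, zero_mul, op_zero, TensorProduct.tmul_zero,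
      map_zero]
    rintro ⟨h1, h2⟩
    exact hi (Prod.ext (Fin.ext h1) h2)
  · simp

lemma secF_epsF_evl (v w : ℕ) (k : ZMod s) {ch : Chain} (hch : ∀ x ∈ ch, x.2.1 < 9) :
    secF K s (epsF K s (evl K 0 v w k ch)) = evl K 0 v w k (eC v w ch) := by
  induction ch with
  | nil => simp [eC]
  | cons x l ih =>
    rw [evl_cons, map_add, map_add, map_zsmul, map_zsmul,
      ih fun y hy => hch y (List.mem_cons_of_mem _ hy), eC, eC]
    cases hx : okT 0 v w x.2
    · rw [term_of_not_ok (n := 0) hx, map_zero, map_zero, smul_zero, zero_add,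
        List.filter_cons_of_neg (by simp [hx])]
    · rw [List.filter_cons_of_pos (p := fun x : ℤ × ℕ × ℕ × ℕ => okT 0 v w x.2) hx,
        List.map_cons, evl_cons, epsF_term hx (hch x List.mem_cons_self), secF_pth]
      rw [okT, Bool.and_eq_true] at hx
      exact (sup_bound hx.2).2.1

lemma epsF_secF (r : Alg K s) : epsF K s (secF K s r) = r := by
  have : ((epsF K s).restrictScalars K).comp (secF K s) = LinearMap.id := by
    refine (pathBasis K s).ext fun x => ?_
    obtain ⟨⟨v, w, d, k⟩, h⟩ := x
    rw [pathBasis_apply]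
    change epsF K s (secF K s (pth K v w d k)) = pth K v w d k
    have hw := (sup_bound h).2.1
    have h3 := checkE_spec.2.2.1 w hw
    rw [secF_pth hw, epsF_term (x := (w, d, 0)) _ (show w < 9 by lia), add_zero]
    rw [okT, Bool.and_eq_true]
    change sup v (gB 0 w) d = true ∧ sup (gA 0 w) w 0 = true
    rw [h3.1, h3.2.1]
    refine ⟨h, ?_⟩
    interval_cases w <;> rfl
  exact LinearMap.congr_fun this r

lemma fr_ext {M : Type*} [AddCommGroup M] [Module (Env K s) M] {f g : Fr K s →ₗ[Env K s] M}
    (h : ∀ i, f (sgl i 1) = g (sgl i 1)) : f = g := by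
  refine LinearMap.pi_ext' (R := Env K s) (φ := fun _ : GI s => Env K s) fun i => ?_
  ext1
  exact h i

lemma dF_comp (n : ℕ) (f : Fr K s) : dF K s n (dF K s (n + 1) f) = 0 := by
  refine LinearMap.congr_fun (f := (dF K s n).comp (dF K s (n + 1))) (g := 0)
    (fr_ext fun i => ?_) f
  rw [LinearMap.comp_apply, dF_sgl, one_smul, DD, dF_evl, LinearMap.zero_apply]
  · have := allB_spec (check_spec (n := n)).2.2.1 i.1.2
    rw [show (n % 22 + 1) % 22 = (n + 1) % 22 by omega,
      show (n % 22 + 2) % 22 = (n + 1 + 1) % 22 by omega] at this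
    exact evl_of_zeroC this _
  · exact fun x hx => (checkD_spec i.1.2 hx).1

lemma epsF_dF (f : Fr K s) : epsF K s (dF K s 0 f) = 0 := by
  refine LinearMap.congr_fun (f := (epsF K s).comp (dF K s 0)) (g := 0)
    (fr_ext fun i => ?_) f
  rw [LinearMap.comp_apply, dF_sgl, one_smul, DD, LinearMap.zero_apply, ← epsF_secF (epsF K s _),
    secF_epsF_evl]
  · exact (congrArg _ (evl_of_zeroC (n := 0) (checkE_spec.2.1 _ i.1.2) _)).trans (map_zero _)
  · exact fun x hx => (checkD_spec (n := 0) i.1.2 hx).1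

variable (K) in
/-- The idempotent attached to a generator. -/
noncomputable def idm (n : ℕ) (i : GI s) : Env K s :=
  ev K (gA n i.1) (i.2 + (gO n i.1 : ZMod s)) ⊗ₜ[K] op (ev K (gB n i.1) i.2)

lemma idm_mul_idm (n : ℕ) (i : GI s) : idm K n i * idm K n i = idm K n i := by
  rw [idm, Algebra.TensorProduct.tmul_mul_tmul, ← op_mul, ev_mul_ev, ev_mul_ev, if_pos ⟨rfl, rfl⟩,
    if_pos ⟨rfl, rfl⟩]

variable (K s) in
/-- The terms of the resolution. -/
noncomputable def QF (n : ℕ) : Submodule (Env K s) (Fr K s) where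
  carrier := {f | ∀ i, f i * idm K n i = f i}
  add_mem' {f g} hf hg i := by
    change (f i + g i) * idm K n i = f i + g i
    rw [add_mul, hf, hg]
  zero_mem' i := zero_mul _
  smul_mem' c f hf i := by
    change c * f i * idm K n i = c * f i
    rw [mul_assoc, hf]

lemma sgl_mem_QF {n : ℕ} {i : GI s} {x : Env K s} (hx : x * idm K n i = x) :
    sgl i x ∈ QF K s n := by
  intro j
  rw [sgl_apply]
  split_ifs with h
  · rw [h, hx]
  · exact zero_mul _

lemma term_mem_QF (n v w : ℕ) (k : ZMod s) (x : ℕ × ℕ × ℕ) : term K n v w k x ∈ QF K s n := by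
  rw [term]
  split_ifs with h
  · refine sgl_mem_QF ?_
    rw [idm, Algebra.TensorProduct.tmul_mul_tmul, ← op_mul, ev_mul_pth]
    congr 1
    rw [pth_mul_ev]
  · exact Submodule.zero_mem _

lemma evl_mem_QF (n v w : ℕ) (k : ZMod s) (ch : Chain) : evl K n v w k ch ∈ QF K s n := by
  induction ch with
  | nil => exact Submodule.zero_mem _
  | cons x l ih =>
    rw [evl_cons]
    exact add_mem (zsmul_mem (term_mem_QF n v w k x.2) _) ih

lemma secF_mem_QF (r : Alg K s) : secF K s r ∈ QF K s 0 := by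
  rw [secF_apply]
  refine Submodule.sum_mem _ fun i _ => ?_
  by_cases h : (i.1 : ℕ) < 6
  · obtain ⟨e1, e2, e3⟩ := checkE_spec.2.2.1 _ h
    refine sgl_mem_QF ?_
    rw [idm, e1, e2, e3, Algebra.TensorProduct.tmul_mul_tmul, ← op_mul, Nat.cast_zero, add_zero,
      ev_mul_ev, if_pos ⟨rfl, rfl⟩, ← mul_assoc, ev_mul_ev, if_pos ⟨rfl, rfl⟩]
  · rw [ev, if_neg h, TensorProduct.zero_tmul, map_zero]
    exact Submodule.zero_mem _

lemma extR_mem {Q : Submodule (Env K s) (Fr K s)} {f : Alg K s →ₗ[K] Fr K s}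
    (hf : ∀ p, f p ∈ Q) (x : Env K s) : extR f x ∈ Q := by
  induction x using TensorProduct.induction_on with
  | zero => rw [map_zero]; exact Submodule.zero_mem _
  | add x y hx hy => rw [map_add]; exact Submodule.add_mem _ hx hy
  | tmul p q =>
    rw [← op_unop q, extR_tmul]
    exact Submodule.smul_mem _ _ (hf p)

lemma HP_mem_QF (n : ℕ) (i : GI s) (p : Alg K s) : HP n i p ∈ QF K s (n + 1) := by
  rw [HP, Module.Basis.constr_apply]
  refine Submodule.sum_mem _ fun x _ => ?_
  change _ • ite _ _ _ ∈ _
  split_ifs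
  · exact Submodule.smul_of_tower_mem _ _ (evl_mem_QF n.succ _ _ _ _)
  · rw [smul_zero]; exact Submodule.zero_mem _

lemma hF_mem_QF (n : ℕ) (f : Fr K s) : hF n f ∈ QF K s (n + 1) :=
  Submodule.sum_mem _ fun i _ => extR_mem (HP_mem_QF n i) (f i)

lemma dF_mem_QF (n : ℕ) (f : Fr K s) : dF K s n f ∈ QF K s n :=
  Submodule.sum_mem _ fun _ _ => Submodule.smul_mem _ _ (evl_mem_QF n _ _ _ _)

lemma mul_idm_eq (n : ℕ) (i : GI s) (p q : Alg K s) :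
    (sgl i (p ⊗ₜ[K] op q * idm K n i) : Fr K s) =
      rgt q (sgl i ((p * ev K (gA n i.1) (i.2 + (gO n i.1 : ZMod s))) ⊗ₜ[K]
        op (ev K (gB n i.1) i.2))) := by
  rw [rgt_apply, smul_sgl, idm, Algebra.TensorProduct.tmul_mul_tmul,
    Algebra.TensorProduct.tmul_mul_tmul, one_mul]

lemma sum_sgl (f : Fr K s) : ∑ i, sgl i (f i) = f :=
  Finset.univ_sum_single f

/-- Maps commuting with the right action agree on a term of the resolution as soon as they agree
on the paths ending at generators. -/
lemma qF_ext {n : ℕ} {Φ Ψ : Fr K s →ₗ[K] Fr K s} (hΦ : ∀ q f, Φ (rgt q f) = rgt q (Φ f))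
    (hΨ : ∀ q f, Ψ (rgt q f) = rgt q (Ψ f))
    (h : ∀ g < 9, ∀ w < 6, ∀ d < 2, ∀ k, Φ (term K n (gB n g) w k (g, 0, d)) =
      Ψ (term K n (gB n g) w k (g, 0, d))) {f : Fr K s} (hf : f ∈ QF K s n) : Φ f = Ψ f := by
  have key (i : GI s) (x : Env K s) : Φ (sgl i (x * idm K n i)) = Ψ (sgl i (x * idm K n i)) := by
    induction x using TensorProduct.induction_on with
    | zero => simp
    | add x y hx hy => rw [add_mul, map_add, map_add, map_add, hx, hy]
    | tmul p q =>
      rw [← op_unop q, mul_idm_eq, hΦ, hΨ]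
      congr 1
      let L : Alg K s →ₗ[K] Fr K s :=
        ((sgl i).restrictScalars K).comp (((TensorProduct.mk K (Alg K s) (Alg K s)ᵐᵒᵖ).flip
          (op (ev K (gB n i.1) i.2))).comp
            (LinearMap.mulRight K (ev K (gA n i.1) (i.2 + (gO n i.1 : ZMod s)))))
      have : Φ.comp L = Ψ.comp L := by
        refine (pathBasis K s).ext fun x => ?_
        obtain ⟨⟨v, w, d, k⟩, hs⟩ := x
        obtain ⟨-, hw, hd⟩ := sup_bound hs
        rw [pathBasis_apply]
        have hL : L (pth K v w d k) = sgl i ((pth K v w d k *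
          ev K (gA n i.1) (i.2 + (gO n i.1 : ZMod s))) ⊗ₜ[K] op (ev K (gB n i.1) i.2)) := rfl
        change Φ (L (pth K v w d k)) = Ψ (L (pth K v w d k))
        rw [hL, ← pth_mul_ev, mul_assoc, ev_mul_ev]
        split_ifs with hv
        · obtain ⟨rfl, rfl⟩ := hv
          rw [pth_mul_ev]
          have := h i.1 i.1.2 w hw d hd i.2
          rw [term, dif_pos i.1.2, Nat.cast_zero, add_zero, pth_self] at this
          exact this
        · rw [mul_zero, TensorProduct.zero_tmul, map_zero, map_zero, map_zero]
      exact LinearMap.congr_fun this p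
  rw [← sum_sgl f, map_sum, map_sum]
  refine Finset.sum_congr rfl fun i _ => ?_
  rw [← hf i]
  exact key i _

lemma evl_singleton (n v w : ℕ) (k : ZMod s) (x : ℕ × ℕ × ℕ) :
    evl K n v w k [(1, x)] = term K n v w k x := by
  rw [evl_cons, evl_nil, one_smul, add_zero]

lemma map_rgt (L : Fr K s →ₗ[Env K s] Fr K s) (q : Alg K s) (f : Fr K s) :
    L (rgt q f) = rgt q (L f) := map_smul L _ _

lemma homotopy_succ {n : ℕ} {f : Fr K s} (hf : f ∈ QF K s (n + 1)) :
    dF K s (n + 1) (hF (n + 1) f) + hF n (dF K s n f) = f := by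
  refine qF_ext (n := n + 1) (Φ := ((dF K s (n + 1)).restrictScalars K).comp (hF (n + 1)) +
    (hF n).comp ((dF K s n).restrictScalars K)) (Ψ := LinearMap.id) (fun q f => ?_)
    (fun q f => rfl) (fun g hg w hw d hd k => ?_) hf
  · change dF K s (n + 1) (hF (n + 1) (rgt q f)) + hF n (dF K s n (rgt q f)) =
      rgt q (dF K s (n + 1) (hF (n + 1) f) + hF n (dF K s n f))
    rw [hF_rgt, map_rgt, map_rgt, hF_rgt, map_add]
  · change dF K s (n + 1) (hF (n + 1) (term K (n + 1) (gB (n + 1) g) w k (g, 0, d))) +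
      hF n (dF K s n (term K (n + 1) (gB (n + 1) g) w k (g, 0, d))) =
      term K (n + 1) (gB (n + 1) g) w k (g, 0, d)
    have h := allB_spec (allB_spec (allB_spec (check_spec (n := n)).2.2.2 hg) hw) hd
    rw [show (n % 22 + 1) % 22 = (n + 1) % 22 by omega,
      show (n % 22 + 2) % 22 = (n + 1 + 1) % 22 by omega] at h
    have h := evl_of_zeroC (n := n + 1) h k (K := K)
    have h1 : ∀ x ∈ [((1 : ℤ), g, 0, d)], x.2.1 < 9 := by simpa using hg
    rw [evl_cons, evl_append, ← dF_evl (n + 1), ← hF_evl (n + 1), ← hF_evl n, ← dF_evl n,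
      evl_singleton] at h
    · rw [neg_one_smul, neg_add_eq_zero] at h
      exact h.symm
    · exact h1
    · exact dC_lt n _ _ h1
    · exact h1
    · exact hC_lt (n + 1) _ _ h1

lemma homotopy_zero {f : Fr K s} (hf : f ∈ QF K s 0) :
    dF K s 0 (hF 0 f) + secF K s (epsF K s f) = f := by
  refine qF_ext (n := 0) (Φ := ((dF K s 0).restrictScalars K).comp (hF 0) +
    (secF K s).comp ((epsF K s).restrictScalars K)) (Ψ := LinearMap.id) (fun q f => ?_)
    (fun q f => rfl) (fun g hg w hw d hd k => ?_) hf
  · change dF K s 0 (hF 0 (rgt q f)) + secF K s (epsF K s (rgt q f)) =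
      rgt q (dF K s 0 (hF 0 f) + secF K s (epsF K s f))
    rw [hF_rgt, map_rgt, map_add, ← secF_mul]
    congr 2
    exact (map_smul (epsF K s) _ _).trans (one_mul _)
  · change dF K s 0 (hF 0 (term K 0 (gB 0 g) w k (g, 0, d))) +
      secF K s (epsF K s (term K 0 (gB 0 g) w k (g, 0, d))) = term K 0 (gB 0 g) w k (g, 0, d)
    have h := evl_of_zeroC (n := 0) (checkE_spec.1 g hg w hw d hd) k (K := K)
    have h1 : ∀ x ∈ [((1 : ℤ), g, 0, d)], x.2.1 < 9 := by simpa using hg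
    have e1 := dF_evl 0 (gBT 0 g) w k (K := K) (hC_lt 0 (gBT 0 g) w h1)
    rw [← hF_evl 0 _ _ _ h1] at e1
    rw [evl_cons, evl_append] at h
    erw [← e1] at h
    rw [← secF_epsF_evl _ _ _ h1, evl_singleton, neg_one_smul, neg_add_eq_zero] at h
    exact h.symm

variable (K s) in
/-- The projection onto a term of the resolution. -/
noncomputable def prF (n : ℕ) : Fr K s →ₗ[Env K s] QF K s n where
  toFun f := ⟨fun i => f i * idm K n i, fun i => by rw [mul_assoc, idm_mul_idm]⟩
  map_add' f g := Subtype.ext (funext fun i => add_mul (f i) (g i) _)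
  map_smul' c f := Subtype.ext (funext fun i => mul_assoc c (f i) _)

instance : Module.Projective (Env K s) (Fr K s) :=
  inferInstanceAs (Module.Projective (Env K s) (GI s → Env K s))

variable (K s) in
/-- An explicit projective resolution of `R_s`. -/
noncomputable def resE : ProjRes (Env K s) (Alg K s) where
  Q n := QF K s n
  proj n := Module.Projective.of_split (QF K s n).subtype (prF K s n)
    (LinearMap.ext fun f => Subtype.ext (funext f.2))
  d n := (dF K s n).restrict fun f _ => dF_mem_QF n f
  ε := (epsF K s).comp (QF K s 0).subtype
  surj r := ⟨⟨secF K s r, secF_mem_QF r⟩, epsF_secF r⟩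
  exact₀ := by
    ext ⟨f, hf⟩
    constructor
    · rintro ⟨g, hg⟩
      rw [← hg]
      exact epsF_dF g.1
    · intro h
      have h : epsF K s f = 0 := h
      refine ⟨⟨hF 0 f, hF_mem_QF 0 f⟩, Subtype.ext ?_⟩
      have := homotopy_zero hf
      rwa [h, map_zero, add_zero] at this
  exact n := by
    ext ⟨f, hf⟩
    constructor
    · rintro ⟨g, hg⟩
      rw [← hg]
      exact Subtype.ext (dF_comp n g.1)
    · intro h
      have h : dF K s n f = 0 := congrArg Subtype.val h
      refine ⟨⟨hF (n + 1) f, hF_mem_QF _ f⟩, Subtype.ext ?_⟩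
      have := homotopy_succ hf
      rwa [h, map_zero, add_zero] at this

/-! ### Minimality -/

lemma hgt_le : ∀ v < 6, ∀ w < 6, ∀ d < 2, sup v w d = true → hgt v ≤ hgt w + 4 * d := by
  decide

lemma plen_add {v w d x e : ℕ} (h : sup v w d = true) (h' : sup w x e = true) :
    plen v x (d + e) = plen v w d + plen w x e := by
  obtain ⟨hv, hw, hd⟩ := sup_bound h
  obtain ⟨-, hx, he⟩ := sup_bound h'
  have h1 := hgt_le v hv w hw d hd h
  have h2 := hgt_le w hw x hx e he h'
  simp only [plen]
  omega

variable (K s) in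
/-- The filtration of the enveloping algebra by total length. -/
noncomputable def lenF (m : ℕ) : Submodule K (Env K s) :=
  Submodule.span K {z | ∃ v w d k v' w' d' k', m ≤ plen v w d + plen v' w' d' ∧
    z = pth K v w d k ⊗ₜ[K] op (pth K v' w' d' k')}

lemma pth_tmul_mem {m v w d v' w' d' : ℕ} {k k' : ZMod s}
    (h : m ≤ plen v w d + plen v' w' d') :
    pth K v w d k ⊗ₜ[K] op (pth K v' w' d' k') ∈ lenF K s m :=
  Submodule.subset_span ⟨v, w, d, k, v', w', d', k', h, rfl⟩

lemma pth_mul_pth_cases (v w d : ℕ) (k : ZMod s) (v' w' d' : ℕ) (k' : ZMod s) :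
    pth K v w d k * pth K v' w' d' k' = 0 ∨ ∃ x y e l, plen x y e = plen v w d + plen v' w' d' ∧
      pth K v w d k * pth K v' w' d' k' = pth K x y e l := by
  by_cases h : sup v w d = true
  · by_cases h' : sup v' w' d' = true
    · by_cases e : v = w' ∧ k = k' + (d' : ZMod s)
      · obtain ⟨rfl, rfl⟩ := e
        exact Or.inr ⟨v', w, d' + d, k', by rw [plen_add h' h, add_comm], pth_mul_pth h' h k'⟩
      · exact Or.inl (pth_mul_pth_of_ne e)
    · rw [pth_of_not_sup h', mul_zero]; exact Or.inl rfl
  · rw [pth_of_not_sup h, zero_mul]; exact Or.inl rfl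

lemma mul_mem_lenF {a b : ℕ} {x y : Env K s} (hx : x ∈ lenF K s a) (hy : y ∈ lenF K s b) :
    x * y ∈ lenF K s (a + b) := by
  induction hx, hy using Submodule.span_induction₂ with
  | mem_mem x y hx hy =>
    obtain ⟨v, w, d, k, v', w', d', k', h, rfl⟩ := hx
    obtain ⟨u, t, e, l, u', t', e', l', h', rfl⟩ := hy
    rw [Algebra.TensorProduct.tmul_mul_tmul, ← op_mul]
    rcases pth_mul_pth_cases (K := K) v w d k u t e l with h0 | ⟨x, y, z, r, h1, h2⟩
    · rw [h0, TensorProduct.zero_tmul]; exact Submodule.zero_mem _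
    rcases pth_mul_pth_cases (K := K) u' t' e' l' v' w' d' k' with h0 | ⟨x', y', z', r', h1', h2'⟩
    · rw [h0, op_zero, TensorProduct.tmul_zero]; exact Submodule.zero_mem _
    rw [h2, h2']
    exact pth_tmul_mem (by omega)
  | zero_left y hy => rw [zero_mul]; exact Submodule.zero_mem _
  | zero_right x hx => rw [mul_zero]; exact Submodule.zero_mem _
  | add_left x y z _ _ _ h h' => rw [add_mul]; exact Submodule.add_mem _ h h'
  | add_right x y z _ _ _ h h' => rw [mul_add]; exact Submodule.add_mem _ h h'
  | smul_left r x y _ _ h => rw [smul_mul_assoc]; exact Submodule.smul_mem _ _ h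
  | smul_right r x y _ _ h => rw [mul_smul_comm]; exact Submodule.smul_mem _ _ h

lemma mem_lenF_zero (x : Env K s) : x ∈ lenF K s 0 := by
  induction x using TensorProduct.induction_on with
  | zero => exact Submodule.zero_mem _
  | add x y hx hy => exact Submodule.add_mem _ hx hy
  | tmul p q =>
    induction (pathBasis K s).mem_span p using Submodule.span_induction with
    | zero => rw [TensorProduct.zero_tmul]; exact Submodule.zero_mem _
    | add x y _ _ hx hy => rw [TensorProduct.add_tmul]; exact Submodule.add_mem _ hx hy
    | smul c x _ hx => rw [← TensorProduct.smul_tmul']; exact Submodule.smul_mem _ _ hx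
    | mem x hx =>
      obtain ⟨i, rfl⟩ := hx
      obtain ⟨q, rfl⟩ := op_surjective q
      induction (pathBasis K s).mem_span q using Submodule.span_induction with
      | zero => rw [op_zero, TensorProduct.tmul_zero]; exact Submodule.zero_mem _
      | add x y _ _ hx hy =>
        rw [op_add, TensorProduct.tmul_add]; exact Submodule.add_mem _ hx hy
      | smul c x _ hx =>
        rw [op_smul, TensorProduct.tmul_smul]; exact Submodule.smul_mem _ _ hx
      | mem x hx =>
        obtain ⟨j, rfl⟩ := hx
        rw [pathBasis_apply, pathBasis_apply]
        exact pth_tmul_mem (Nat.zero_le _)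

lemma lenF_nine {x : Env K s} (hx : x ∈ lenF K s 9) : x = 0 := by
  rw [← Submodule.mem_bot K]
  refine Submodule.span_le.2 ?_ hx
  rintro _ ⟨v, w, d, k, v', w', d', k', h, rfl⟩
  rw [SetLike.mem_coe, Submodule.mem_bot]
  by_cases h1 : sup v w d = true
  · by_cases h2 : sup v' w' d' = true
    · obtain ⟨hv, hw, hd⟩ := sup_bound h1
      obtain ⟨hv', hw', hd'⟩ := sup_bound h2
      have := plen_le v hv w hw d hd h1
      have := plen_le v' hv' w' hw' d' hd' h2
      omega
    · rw [pth_of_not_sup h2, op_zero, TensorProduct.tmul_zero]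
  · rw [pth_of_not_sup h1, TensorProduct.zero_tmul]

lemma mem_jacobson_of_lenF {x : Env K s} (hx : x ∈ lenF K s 1) :
    x ∈ (⊥ : Ideal (Env K s)).jacobson := by
  rw [Ideal.mem_jacobson_iff]
  intro y
  have hp (n : ℕ) : (y * x) ^ n ∈ lenF K s n := by
    induction n with
    | zero => exact mem_lenF_zero _
    | succ n ih => rw [pow_succ]; exact mul_mem_lenF ih (zero_add 1 ▸ mul_mem_lenF (mem_lenF_zero y) hx)
  have hn : IsNilpotent (y * x) := ⟨9, lenF_nine (hp 9)⟩
  obtain ⟨u, hu⟩ := hn.isUnit_one_add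
  refine ⟨↑u⁻¹, ?_⟩
  rw [Submodule.mem_bot, mul_assoc, sub_eq_zero]
  calc ↑u⁻¹ * (y * x) + ↑u⁻¹ = ↑u⁻¹ * (1 + y * x) := by rw [mul_add, mul_one, add_comm]
    _ = 1 := by rw [← hu, Units.inv_mul]

lemma term_mem_radSMul {n v w : ℕ} {k : ZMod s} {x : ℕ × ℕ × ℕ}
    (hx : 1 ≤ plen v (gB n x.1) x.2.1 + plen (gA n x.1) w x.2.2) :
    (⟨term K n v w k x, term_mem_QF n v w k x⟩ : QF K s n) ∈ radSMul (Env K s) (QF K s n) := by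
  by_cases h9 : x.1 < 9
  · let i : GI s := (⟨x.1, h9⟩, k + (x.2.1 : ZMod s))
    refine Submodule.subset_span ⟨pth K (gA n x.1) w x.2.2
      (k + (x.2.1 : ZMod s) + (gO n x.1 : ZMod s)) ⊗ₜ[K] op (pth K v (gB n x.1) x.2.1 k),
      mem_jacobson_of_lenF (pth_tmul_mem (by omega)),
      ⟨sgl i (idm K n i), sgl_mem_QF (idm_mul_idm n i)⟩, Subtype.ext ?_⟩
    change term K n v w k x = _ • sgl i (idm K n i)
    rw [term, dif_pos h9, smul_sgl, idm, Algebra.TensorProduct.tmul_mul_tmul, ← op_mul,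
      ev_mul_pth, pth_mul_ev]
  · have : (⟨term K n v w k x, term_mem_QF n v w k x⟩ : QF K s n) = 0 :=
      Subtype.ext (dif_neg h9)
    rw [this]
    exact Submodule.zero_mem _

lemma resE_minimal : (resE K s).Minimal := by
  rintro n _ ⟨f, rfl⟩
  suffices h : dF K s n f.1 ∈ (radSMul (Env K s) (QF K s n)).map (QF K s n).subtype by
    obtain ⟨y, hy, hy'⟩ := h
    have : y = (resE K s).d n f := Subtype.ext hy'
    rwa [← this]
  refine Submodule.sum_mem _ fun i _ => Submodule.smul_mem _ _ ?_
  have (l : Chain) (hl : ∀ y ∈ l, y ∈ dT (n % 22) i.1) :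
      evl K n (gB (n + 1) i.1) (gA (n + 1) i.1) i.2 l ∈
        (radSMul (Env K s) (QF K s n)).map (QF K s n).subtype := by
    induction l with
    | nil => exact Submodule.zero_mem _
    | cons y l ih =>
      rw [evl_cons]
      have h := term_mem_radSMul (K := K) (n := n) (k := i.2)
        (checkD_spec i.1.2 (hl y List.mem_cons_self)).2.2.2.2
      exact Submodule.add_mem _ (zsmul_mem (Submodule.mem_map_of_mem h) _)
        (ih fun z hz => hl z (List.mem_cons_of_mem _ hz))
  exact this _ fun _ h => h

/-! ### Uniqueness of minimal resolutions -/

section Uniqueness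

variable {Λ : Type v} [Ring Λ] {X Y : Type*} [AddCommGroup X] [Module Λ X]
  [AddCommGroup Y] [Module Λ Y]

lemma radSMul_eq : radSMul Λ X = (⊥ : Ideal Λ).jacobson • (⊤ : Submodule Λ X) := by
  refine le_antisymm (Submodule.span_le.2 ?_) (Submodule.smul_le.2 fun r hr x _ =>
    Submodule.subset_span ⟨r, hr, x, rfl⟩)
  rintro _ ⟨r, hr, x, rfl⟩
  exact Submodule.smul_mem_smul hr trivial

lemma bijective_of_sub_mem_radSMul (hJ : IsNilpotent (⊥ : Ideal Λ).jacobson) (h : X →ₗ[Λ] X)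
    (hh : ∀ x, h x - x ∈ radSMul Λ X) : Function.Bijective h := by
  obtain ⟨N, hN⟩ := hJ
  let u : Module.End Λ X := h - 1
  have hu (k : ℕ) (x : X) : (u ^ k) x ∈ ((⊥ : Ideal Λ).jacobson ^ k) • (⊤ : Submodule Λ X) := by
    induction k with
    | zero => rw [pow_zero, Submodule.pow_zero, Ideal.one_eq_top, Submodule.top_smul]; trivial
    | succ k ih =>
      rw [pow_succ' u, Module.End.mul_apply, Submodule.pow_succ, ← smul_eq_mul, Submodule.smul_assoc]
      refine Submodule.smul_induction_on ih (fun r hr y _ => ?_) fun y z hy hz => ?_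
      · rw [map_smul]
        exact Submodule.smul_mem_smul hr (radSMul_eq (Λ := Λ) (X := X) ▸ hh y)
      · rw [map_add]
        exact Submodule.add_mem _ hy hz
  have hn : IsNilpotent u := by
    refine ⟨N, LinearMap.ext fun x => ?_⟩
    have := hu N x
    rw [hN, Submodule.zero_eq_bot, Submodule.bot_smul] at this
    exact this
  have : IsUnit (1 + u) := hn.isUnit_one_add
  rw [add_sub_cancel] at this
  exact (Module.End.isUnit_iff h).1 this

variable {P Q : Type*} [AddCommGroup P] [Module Λ P] [AddCommGroup Q] [Module Λ Q]

lemma exists_lift [Module.Projective Λ P] (f : P →ₗ[Λ] Y) (q : Q →ₗ[Λ] Y)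
    (h : ∀ x, f x ∈ LinearMap.range q) : ∃ g : P →ₗ[Λ] Q, ∀ x, q (g x) = f x := by
  obtain ⟨g, hg⟩ := Module.projective_lifting_property q.rangeRestrict (f.codRestrict _ h)
    q.surjective_rangeRestrict
  exact ⟨g, fun x => congrArg Subtype.val (LinearMap.congr_fun hg x)⟩

/-- Projective covers of isomorphic modules are isomorphic. -/
lemma exists_equiv_of_cover [Module.Projective Λ P] [Module.Projective Λ Q]
    (hJ : IsNilpotent (⊥ : Ideal Λ).jacobson) (p : P →ₗ[Λ] X) (q : Q →ₗ[Λ] Y) (e : X ≃ₗ[Λ] Y)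
    (he : ∀ x, e x ∈ LinearMap.range q ↔ x ∈ LinearMap.range p)
    (hp : LinearMap.ker p ≤ radSMul Λ P) (hq : LinearMap.ker q ≤ radSMul Λ Q) :
    ∃ f : P ≃ₗ[Λ] Q, ∀ x, q (f x) = e (p x) := by
  obtain ⟨f, hf⟩ := exists_lift (e.toLinearMap ∘ₗ p) q fun x => (he _).2 ⟨x, rfl⟩
  obtain ⟨g, hg⟩ := exists_lift (e.symm.toLinearMap ∘ₗ q) p fun x =>
    (he _).1 (by simp)
  have h1 : Function.Bijective (g ∘ₗ f) := bijective_of_sub_mem_radSMul hJ _ fun x => hp (by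
    rw [LinearMap.mem_ker, map_sub, LinearMap.comp_apply, hg]
    simp [hf])
  have h2 : Function.Bijective (f ∘ₗ g) := bijective_of_sub_mem_radSMul hJ _ fun x => hq (by
    rw [LinearMap.mem_ker, map_sub, LinearMap.comp_apply, hf]
    simp [hg])
  exact ⟨LinearEquiv.ofBijective f ⟨Function.Injective.of_comp h1.1, Function.Surjective.of_comp h2.2⟩, hf⟩

/-- Minimal projective resolutions are unique. -/
lemma exists_equiv_of_minimal {M : Type*} [AddCommGroup M] [Module Λ M]
    (hJ : IsNilpotent (⊥ : Ideal Λ).jacobson) (r r' : ProjRes Λ M) (h : r.Minimal)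
    (h' : r'.Minimal) (n : ℕ) : ∃ (e : r.Q n ≃ₗ[Λ] r'.Q n) (e' : r.Q (n + 1) ≃ₗ[Λ] r'.Q (n + 1)),
      ∀ x, r'.d n (e' x) = e (r.d n x) := by
  have := r.proj
  have := r'.proj
  induction n with
  | zero =>
    obtain ⟨e, he⟩ := exists_equiv_of_cover hJ r.ε r'.ε (LinearEquiv.refl Λ M)
      (fun x => iff_of_true (r'.surj x) (r.surj x)) (r.exact₀ ▸ h 0) (r'.exact₀ ▸ h' 0)
    obtain ⟨e', he'⟩ := exists_equiv_of_cover hJ (r.d 0) (r'.d 0) e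
      (fun x => by rw [r.exact₀, r'.exact₀, LinearMap.mem_ker, LinearMap.mem_ker, he]; rfl)
      (r.exact 0 ▸ h 1) (r'.exact 0 ▸ h' 1)
    exact ⟨e, e', he'⟩
  | succ n ih =>
    obtain ⟨e, e', he⟩ := ih
    obtain ⟨e'', he''⟩ := exists_equiv_of_cover hJ (r.d (n + 1)) (r'.d (n + 1)) e'
      (fun x => by
        rw [r.exact, r'.exact, LinearMap.mem_ker, LinearMap.mem_ker, he, map_eq_zero_iff e e.injective])
      (r.exact (n + 1) ▸ h (n + 2)) (r'.exact (n + 1) ▸ h' (n + 2))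
    exact ⟨e', e'', he''⟩

end Uniqueness

lemma isNilpotent_jacobson : IsNilpotent (⊥ : Ideal (Env K s)).jacobson := by
  have : IsArtinianRing (Env K s) := IsArtinianRing.of_finite K (Env K s)
  exact IsArtinianRing.isNilpotent_jacobson_bot

/-- The coboundary ranks agree for all minimal resolutions. -/
lemma finrank_range_hdelta (r r' : ProjRes (Env K s) (Alg K s)) (h : r.Minimal)
    (h' : r'.Minimal) (t : ℕ) : Module.finrank K (LinearMap.range (hdelta K s r t)) =
      Module.finrank K (LinearMap.range (hdelta K s r' t)) := by
  obtain ⟨e, e', he⟩ := exists_equiv_of_minimal isNilpotent_jacobson r' r h' h t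
  let F : HomQ K s r (t + 1) ≃ₗ[K] HomQ K s r' (t + 1) :=
    { toFun := fun f => HomQ.mk' K s r' (t + 1) ((HomQ.un K s r (t + 1) f).comp e'.toLinearMap)
      invFun := fun f =>
        HomQ.mk' K s r (t + 1) ((HomQ.un K s r' (t + 1) f).comp e'.symm.toLinearMap)
      map_add' := fun f g => rfl
      map_smul' := fun c f => rfl
      left_inv := fun f => LinearMap.ext fun x =>
        congrArg (HomQ.un K s r (t + 1) f) (e'.apply_symm_apply x)
      right_inv := fun f => LinearMap.ext fun x =>
        congrArg (HomQ.un K s r' (t + 1) f) (e'.symm_apply_apply x) }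
  have : LinearMap.range (hdelta K s r' t) = (LinearMap.range (hdelta K s r t)).map F.toLinearMap := by
    ext f
    constructor
    · rintro ⟨f, rfl⟩
      refine ⟨_, ⟨HomQ.mk' K s r t ((HomQ.un K s r' t f).comp e.symm.toLinearMap), rfl⟩,
        LinearMap.ext fun x => ?_⟩
      change HomQ.un K s r' t f (e.symm (r.d t (e' x))) = HomQ.un K s r' t f (r'.d t x)
      rw [he, e.symm_apply_apply]
    · rintro ⟨_, ⟨f, rfl⟩, rfl⟩
      refine ⟨HomQ.mk' K s r' t ((HomQ.un K s r t f).comp e.toLinearMap),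
        LinearMap.ext fun x => ?_⟩
      change HomQ.un K s r t f (e (r'.d t x)) = HomQ.un K s r t f (r.d t (e' x))
      rw [he]
  rw [this]
  exact (LinearEquiv.finrank_map_eq F _).symm

/-! ### Homomorphisms into the algebra -/

/-- The degree shift for which the `n`-th coboundary map can be nonzero. -/
def eE (n : ℕ) : ℕ := 6 * (n / 11) + n % 11 / 2

/-- Whether the generator `g` of the `m`-th term supports a homomorphism of shift `eE n`. -/
def sp (n m g : ℕ) : Bool :=
  Nat.ble (eE n) (gO m g) && sup (gB m g) (gA m g) (gO m g - eE n)

/-- Homomorphisms of other shifts do not contribute to the coboundary. -/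
def checkK (t : ℕ) : Bool :=
  allB 9 fun g => (dT t g).all fun y => allB 2 fun d =>
    !sup (gB t y.2.1) (gA t y.2.1) d || (Nat.beq (gO t y.2.1) (eE t + d) ||
      !sup (gB (t + 1) g) (gA (t + 1) g) (y.2.2.1 + d + y.2.2.2))

lemma checkK_all : (allB 22 checkK) = true := by
  decide +kernel

lemma gA_mod (n g : ℕ) : gA (n % 22) g = gA n g := by simp [gA]
lemma gB_mod (n g : ℕ) : gB (n % 22) g = gB n g := by simp [gB]
lemma gA_succ_mod (n g : ℕ) : gA (n % 22 + 1) g = gA (n + 1) g := by simp [gA, Nat.add_mod]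
lemma gB_succ_mod (n g : ℕ) : gB (n % 22 + 1) g = gB (n + 1) g := by simp [gB, Nat.add_mod]
lemma gO_mod (n g : ℕ) : gO n g = gO (n % 22) g + 12 * (n / 22) := by simp [gO]
lemma gO_succ_mod (n g : ℕ) : gO (n + 1) g = gO (n % 22 + 1) g + 12 * (n / 22) := by
  have e : (n % 22 + 1) % 22 = (n + 1) % 22 := by omega
  simp only [gO, e]
  omega
lemma eE_mod (n : ℕ) : eE n = eE (n % 22) + 12 * (n / 22) := by simp only [eE]; omega

lemma ble_add (a b c : ℕ) : Nat.ble (a + c) (b + c) = Nat.ble a b := by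
  rw [Bool.eq_iff_iff, Nat.ble_eq, Nat.ble_eq]; omega

lemma sp_mod (n g : ℕ) : sp n n g = sp (n % 22) (n % 22) g := by
  simp only [sp, gA_mod, gB_mod]
  rw [gO_mod n, eE_mod n, Nat.add_sub_add_right, ble_add]

lemma sp_succ_mod (n g : ℕ) : sp n (n + 1) g = sp (n % 22) (n % 22 + 1) g := by
  simp only [sp, gA_succ_mod, gB_succ_mod]
  rw [gO_succ_mod n, eE_mod n, Nat.add_sub_add_right, ble_add]

lemma checkK_spec {n g : ℕ} (hg : g < 9) {y : ℤ × ℕ × ℕ × ℕ} (hy : y ∈ dT (n % 22) g) {d : ℕ}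
    (hd : sup (gB n y.2.1) (gA n y.2.1) d = true) (he : gO n y.2.1 ≠ eE n + d) :
    sup (gB (n + 1) g) (gA (n + 1) g) (y.2.2.1 + d + y.2.2.2) ≠ true := by
  have h := allB_spec (List.all_eq_true.1 (allB_spec
    (allB_spec checkK_all (Nat.mod_lt n (by norm_num))) hg) y hy) (sup_bound hd).2.2
  rw [gO_mod, eE_mod] at he
  rw [gA_mod, gB_mod, gA_succ_mod, gB_succ_mod, hd, Bool.not_true, Bool.false_or,
    Bool.or_eq_true, Nat.beq_eq] at h
  rcases h with h | h
  · omega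
  · simpa using h

/-- The components of an element between two idempotents. -/
lemma corner (v w : ℕ) (k l : ZMod s) (r : Alg K s) : ∃ c : ℕ → K,
    ev K w l * (r * ev K v k) =
      ∑ d ∈ Finset.range 2, c d • (if k + (d : ZMod s) = l then pth K v w d k else 0) := by
  induction (pathBasis K s).mem_span r using Submodule.span_induction with
  | zero => exact ⟨0, by simp⟩
  | add x y _ _ hx hy =>
    obtain ⟨c, hc⟩ := hx
    obtain ⟨c', hc'⟩ := hy
    exact ⟨c + c', by simp only [add_mul, mul_add, hc, hc', Pi.add_apply, add_smul,
      Finset.sum_add_distrib]⟩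
  | smul a x _ hx =>
    obtain ⟨c, hc⟩ := hx
    exact ⟨a • c, by simp only [smul_mul_assoc, mul_smul_comm, hc, Pi.smul_apply, smul_eq_mul,
      mul_smul, Finset.smul_sum]⟩
  | mem x hx =>
    obtain ⟨⟨⟨v', w', d, k'⟩, h⟩, rfl⟩ := hx
    rw [pathBasis_apply]
    change ∃ c : ℕ → K, ev K w l * (pth K v' w' d k' * ev K v k) = _
    rw [← pth_mul_ev v' w', mul_assoc, ev_mul_ev]
    by_cases h1 : v' = v ∧ k' = k
    · obtain ⟨rfl, rfl⟩ := h1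
      rw [if_pos ⟨rfl, rfl⟩, pth_mul_ev, ← ev_mul_pth, ← mul_assoc, ev_mul_ev]
      by_cases h2 : w = w' ∧ l = k' + (d : ZMod s)
      · obtain ⟨rfl, rfl⟩ := h2
        refine ⟨fun x => if x = d then 1 else 0, ?_⟩
        rw [if_pos ⟨rfl, rfl⟩, ev_mul_pth, Finset.sum_eq_single d]
        · simp
        · intro x _ hx; simp [hx]
        · intro hx; exact absurd (Finset.mem_range.2 (sup_bound h).2.2) hx
      · exact ⟨0, by simp [if_neg h2]⟩
    · exact ⟨0, by simp [if_neg h1]⟩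

/-! ### The coboundary maps on coefficients -/

/-- The homomorphism `F` has coefficients `c` at the generators. -/
def HasCoef (n : ℕ) (F : Fr K s →ₗ[Env K s] Alg K s) (c : GI s → ℕ → K) : Prop :=
  ∀ i, F (sgl i (idm K n i)) = ∑ d ∈ Finset.range 2, c i d •
    (if i.2 + (d : ZMod s) = i.2 + (gO n i.1 : ZMod s) then pth K (gB n i.1) (gA n i.1) d i.2 else 0)

lemma env_smul (a b r : Alg K s) : (a ⊗ₜ[K] op b : Env K s) • r = a * (r * b) := rfl

lemma exists_hasCoef (n : ℕ) (F : Fr K s →ₗ[Env K s] Alg K s) : ∃ c, HasCoef n F c := by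
  choose c hc using fun i : GI s => corner (K := K) (gB n i.1) (gA n i.1) i.2
    (i.2 + (gO n i.1 : ZMod s)) (F (sgl i 1))
  refine ⟨c, fun i => ?_⟩
  rw [← hc, ← env_smul, ← map_smul, smul_sgl, mul_one]
  rfl

lemma map_term {n : ℕ} (F : Fr K s →ₗ[Env K s] Alg K s) (v w : ℕ) (k : ZMod s)
    (h : Fin 9) (dq dp : ℕ) :
    F (term K n v w k (h, dq, dp)) =
      pth K (gA n h) w dp (k + (dq : ZMod s) + (gO n h : ZMod s)) *
        (F (sgl (h, k + (dq : ZMod s)) (idm K n (h, k + (dq : ZMod s)))) * pth K v (gB n h) dq k) := by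
  have e : term K n v w k (h, dq, dp) =
      (pth K (gA n h) w dp (k + (dq : ZMod s) + (gO n h : ZMod s)) ⊗ₜ[K]
        op (pth K v (gB n h) dq k) : Env K s) •
        sgl (h, k + (dq : ZMod s)) (idm K n (h, k + (dq : ZMod s))) := by
    rw [term, dif_pos h.2, smul_sgl, idm, Algebra.TensorProduct.tmul_mul_tmul, ← op_mul,
      ev_mul_pth, pth_mul_ev]
  rw [e, map_smul]
  rfl

lemma sup_mid_all : (allB 6 fun u => allB 6 fun v => allB 6 fun w => allB 6 fun x =>
    allB 2 fun a => allB 2 fun b => allB 2 fun c =>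
      !(sup u v a && (sup v w b && (sup w x c && sup u x (a + b + c)))) || sup u w (a + b)) =
      true := by
  decide +kernel

lemma sup_mid {u v w x a b c : ℕ} (h1 : sup u v a = true) (h2 : sup v w b = true)
    (h3 : sup w x c = true) (h : sup u x (a + b + c) = true) : sup u w (a + b) = true := by
  obtain ⟨hu, hv, ha⟩ := sup_bound h1
  obtain ⟨-, hw, hb⟩ := sup_bound h2
  obtain ⟨-, hx, hc⟩ := sup_bound h3
  simpa [h1, h2, h3, h] using allB_spec (allB_spec (allB_spec (allB_spec (allB_spec
    (allB_spec (allB_spec sup_mid_all hu) hv) hw) hx) ha) hb) hc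

lemma pth_mul_pth_mul_pth {u v w x a b c : ℕ} (h1 : sup u v a = true) (h2 : sup v w b = true)
    (h3 : sup w x c = true) (k : ZMod s) :
    pth K w x c (k + (a : ZMod s) + (b : ZMod s)) * (pth K v w b (k + (a : ZMod s)) * pth K u v a k) =
      pth K u x (a + b + c) k := by
  rw [pth_mul_pth h1 h2, add_assoc k, ← Nat.cast_add]
  by_cases h : sup u w (a + b) = true
  · rw [pth_mul_pth h h3]
  · rw [pth_of_not_sup h, mul_zero, pth_of_not_sup]
    exact fun h' => h (sup_mid h1 h2 h3 h')

lemma map_term_of_hasCoef {n : ℕ} {F : Fr K s →ₗ[Env K s] Alg K s} {c : GI s → ℕ → K}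
    (hF : HasCoef n F c) {g : ℕ} (hg : g < 9) {y : ℤ × ℕ × ℕ × ℕ} (hy : y ∈ dT (n % 22) g)
    (k : ZMod s) :
    F (term K n (gB (n + 1) g) (gA (n + 1) g) k y.2) =
      if (eE n : ZMod s) = 0 ∧ sp n n y.2.1 = true then
        c (Fin.ofNat 9 y.2.1, k + (y.2.2.1 : ZMod s)) (gO n y.2.1 - eE n) •
          pth K (gB (n + 1) g) (gA (n + 1) g) (gO (n + 1) g - eE n) k
      else 0 := by
  obtain ⟨h9, hs1, hs2, ho, -⟩ := checkD_spec hg hy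
  have hK := fun d => checkK_spec hg hy (d := d)
  obtain ⟨y1, h, dq, dp⟩ := y
  simp only at *
  lift h to Fin 9 using h9
  have e9 : Fin.ofNat 9 (h : ℕ) = h := by simp
  rw [map_term, hF, e9]
  have key (d : ℕ) : pth K (gA n h) (gA (n + 1) g) dp (k + (dq : ZMod s) + (gO n h : ZMod s)) *
        ((if k + (dq : ZMod s) + (d : ZMod s) = k + (dq : ZMod s) + (gO n h : ZMod s) then
          pth K (gB n h) (gA n h) d (k + (dq : ZMod s)) else 0) * pth K (gB (n + 1) g) (gB n h) dq k) =
      if ((eE n : ZMod s) = 0 ∧ sp n n h = true) ∧ d = gO n h - eE n then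
        pth K (gB (n + 1) g) (gA (n + 1) g) (gO (n + 1) g - eE n) k else 0 := by
    by_cases hd : sup (gB n h) (gA n h) d = true
    · by_cases he : gO n h = eE n + d
      · have hsp : sp n n h = true := by
          rw [sp, Bool.and_eq_true, Nat.ble_eq]
          exact ⟨by omega, by rwa [he, Nat.add_sub_cancel_left]⟩
        rw [he, Nat.cast_add]
        by_cases hE : (eE n : ZMod s) = 0
        · rw [hE, zero_add, if_pos rfl, if_pos ⟨⟨rfl, hsp⟩, by omega⟩,
            pth_mul_pth_mul_pth hs1 hd hs2]
          congr 1
          omega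
        · rw [if_neg, if_neg, zero_mul, mul_zero]
          · exact fun h => hE h.1.1
          · intro h
            have h := add_left_cancel h
            exact hE (right_eq_add.1 h)
      · have hn : ¬(((eE n : ZMod s) = 0 ∧ sp n n h = true) ∧ d = gO n h - eE n) := by
          rintro ⟨⟨-, h1⟩, h2⟩
          rw [sp, Bool.and_eq_true, Nat.ble_eq] at h1
          omega
        rw [if_neg hn]
        by_cases hi : k + (dq : ZMod s) + (d : ZMod s) = k + (dq : ZMod s) + (gO n h : ZMod s)
        · rw [if_pos hi, ← hi, pth_mul_pth_mul_pth hs1 hd hs2]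
          exact pth_of_not_sup (hK d hd he) k
        · rw [if_neg hi, zero_mul, mul_zero]
    · rw [pth_of_not_sup hd, ite_self, zero_mul, mul_zero, if_neg]
      rintro ⟨⟨-, h1⟩, rfl⟩
      rw [sp, Bool.and_eq_true] at h1
      exact hd h1.2
  simp only [Finset.sum_mul, Finset.mul_sum, smul_mul_assoc, mul_smul_comm, key]
  by_cases hc : (eE n : ZMod s) = 0 ∧ sp n n h = true
  · rw [Finset.sum_eq_single (gO n h - eE n), if_pos hc, if_pos ⟨hc, rfl⟩]
    · intro d _ hd
      rw [if_neg fun h => hd h.2, smul_zero]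
    · intro hd
      have := hc.2
      rw [sp, Bool.and_eq_true] at this
      exact absurd (Finset.mem_range.2 (sup_bound this.2).2.2) hd
  · rw [if_neg hc]
    exact Finset.sum_eq_zero fun d _ => by rw [if_neg fun h => hc h.1, smul_zero]

/-! ### Matrices of shift operators -/

/-- Sparse matrices of Laurent polynomials: entries `(c, i, j, z)` stand for `c * T ^ z` in row
`i` and column `j`. -/
abbrev SMat := List (ℤ × Fin 9 × Fin 9 × ℤ)

variable (K s) in
/-- The operator of an elementary matrix. -/
def opU (x : Fin 9 × Fin 9 × ℤ) : Module.End K (GI s → K) where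
  toFun φ i := if i.1 = x.1 then φ (x.2.1, i.2 + (x.2.2 : ZMod s)) else 0
  map_add' φ ψ := funext fun i => by
    change (if _ then φ _ + ψ _ else _) = (if _ then φ _ else _) + (if _ then ψ _ else _)
    split_ifs <;> simp
  map_smul' c φ := funext fun i => by
    change (if _ then c * φ _ else _) = c * (if _ then φ _ else _)
    split_ifs <;> simp

lemma opU_apply (x : Fin 9 × Fin 9 × ℤ) (φ : GI s → K) (i : GI s) :
    opU K s x φ i = if i.1 = x.1 then φ (x.2.1, i.2 + (x.2.2 : ZMod s)) else 0 := rfl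

variable (K s) in
/-- The operator of a sparse matrix. -/
def opS (l : SMat) : Module.End K (GI s → K) := (l.map fun x => x.1 • opU K s x.2).sum

/-- The entries of the coboundary map. -/
def matS (n : ℕ) : SMat :=
  (List.finRange 9).flatMap fun g : Fin 9 =>
    bif sp n (n + 1) (g : ℕ) then
      ((dT (n % 22) (g : ℕ)).filter fun y => sp n n y.2.1).map fun y =>
        (y.1, g, Fin.ofNat 9 y.2.1, (y.2.2.1 : ℤ))
    else []

lemma matS_mod (n : ℕ) : matS (n % 22) = matS n := by
  simp only [matS, ← sp_mod, ← sp_succ_mod, Nat.mod_mod]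

lemma opS_append (l l' : SMat) : opS K s (l ++ l') = opS K s l + opS K s l' := by simp [opS]

lemma opS_row (l : List (ℤ × Fin 9 × ℤ)) (g : Fin 9) (φ : GI s → K) (i : GI s) :
    opS K s (l.map fun y => (y.1, g, y.2)) φ i =
      if i.1 = g then (l.map fun y => y.1 • φ (y.2.1, i.2 + (y.2.2 : ZMod s))).sum else 0 := by
  induction l with
  | nil => simp [opS]
  | cons y l ih =>
    have e : opS K s ((y :: l).map fun y => (y.1, g, y.2)) =
      y.1 • opU K s (g, y.2) + opS K s (l.map fun y => (y.1, g, y.2)) := by simp [opS]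
    rw [e, LinearMap.add_apply, Pi.add_apply, ih, LinearMap.smul_apply, Pi.smul_apply, opU_apply]
    split_ifs <;> simp

lemma opS_matS (n : ℕ) (φ : GI s → K) (i : GI s) :
    opS K s (matS n) φ i = if sp n (n + 1) i.1 = true then
      (((dT (n % 22) i.1).filter fun y => sp n n y.2.1).map fun y =>
        y.1 • φ (Fin.ofNat 9 y.2.1, i.2 + (y.2.2.1 : ZMod s))).sum else 0 := by
  have hrow (g : Fin 9) (l : Chain) : opS K s (bif sp n (n + 1) (g : ℕ) then l.map fun y =>
        (y.1, g, Fin.ofNat 9 y.2.1, (y.2.2.1 : ℤ)) else []) φ i =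
      if i.1 = g then (if sp n (n + 1) (g : ℕ) = true then
        (l.map fun y => y.1 • φ (Fin.ofNat 9 y.2.1, i.2 + (y.2.2.1 : ZMod s))).sum else 0) else 0 := by
    cases sp n (n + 1) (g : ℕ)
    · simp [opS]
    · have := opS_row (K := K) (l.map fun y => (y.1, Fin.ofNat 9 y.2.1, (y.2.2.1 : ℤ))) g φ i
      simp only [List.map_map] at this
      simpa [Function.comp_def] using this
  have hsum (L : List (Fin 9)) (f : Fin 9 → SMat) :
      opS K s (L.flatMap f) φ i = (L.map fun g => opS K s (f g) φ i).sum := by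
    induction L with
    | nil => simp [opS]
    | cons g L ih => rw [List.flatMap_cons, opS_append, LinearMap.add_apply, Pi.add_apply, ih,
        List.map_cons, List.sum_cons]
  rw [matS, hsum]
  simp only [hrow]
  rw [← List.ofFn_eq_map, List.sum_ofFn]
  rw [Finset.sum_ite_eq]
  simp

lemma opS_matS_congr {n : ℕ} {φ ψ : GI s → K}
    (h : ∀ i, sp n n i.1 = true → φ i = ψ i) : opS K s (matS n) φ = opS K s (matS n) ψ := by
  funext i
  rw [opS_matS, opS_matS]
  congr 2
  refine List.map_congr_left fun y hy => ?_
  obtain ⟨hy, hy'⟩ := List.mem_filter.1 hy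
  rw [h]
  have := (checkD_spec i.1.2 hy).1
  simpa [Nat.mod_eq_of_lt this] using hy'

lemma map_dF_of_hasCoef {n : ℕ} {F : Fr K s →ₗ[Env K s] Alg K s} {c : GI s → ℕ → K}
    (hF : HasCoef n F c) (i : GI s) :
    F (DD n i) = if (eE n : ZMod s) = 0 then
      opS K s (matS n) (fun j => c j (gO n j.1 - eE n)) i •
        pth K (gB (n + 1) i.1) (gA (n + 1) i.1) (gO (n + 1) i.1 - eE n) i.2 else 0 := by
  have hl (l : Chain) (hl : ∀ y ∈ l, y ∈ dT (n % 22) i.1) :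
      F (evl K n (gB (n + 1) i.1) (gA (n + 1) i.1) i.2 l) =
        if (eE n : ZMod s) = 0 then ((l.filter fun y => sp n n y.2.1).map fun y =>
          y.1 • c (Fin.ofNat 9 y.2.1, i.2 + (y.2.2.1 : ZMod s)) (gO n y.2.1 - eE n)).sum •
            pth K (gB (n + 1) i.1) (gA (n + 1) i.1) (gO (n + 1) i.1 - eE n) i.2 else 0 := by
    induction l with
    | nil => simp
    | cons y l ih =>
      rw [evl_cons, map_add, map_zsmul, map_term_of_hasCoef hF i.1.2 (hl y List.mem_cons_self),
        ih fun z hz => hl z (List.mem_cons_of_mem _ hz)]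
      by_cases hE : (eE n : ZMod s) = 0
      · cases hy : sp n n y.2.1
        · simp [hy, hE]
        · simp only [hy, hE, if_true, and_self, List.filter_cons, List.map_cons, List.sum_cons, add_smul, smul_assoc]
      · simp [hE]
  refine (hl _ fun _ h => h).trans ?_
  split_ifs with hE
  · rw [opS_matS]
    split_ifs with hs
    · congr 2
      refine List.map_congr_left fun y hy => ?_
      have := (checkD_spec i.1.2 (List.mem_filter.1 hy).1).1
      simp [Nat.mod_eq_of_lt this]
    · rw [zero_smul]
      by_cases h : sup (gB (n + 1) i.1) (gA (n + 1) i.1) (gO (n + 1) i.1 - eE n) = true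
      · have hf : (dT (n % 22) i.1).filter (fun y => sp n n y.2.1) = [] := by
          refine List.filter_eq_nil_iff.2 fun y hy hy' => hs ?_
          obtain ⟨-, -, -, ho, -⟩ := checkD_spec i.1.2 hy
          rw [sp, Bool.and_eq_true, Nat.ble_eq] at hy' ⊢
          exact ⟨by omega, h⟩
        rw [hf, List.map_nil, List.sum_nil, zero_smul]
      · rw [pth_of_not_sup h, smul_zero]
  · rfl

/-! ### The coboundary groups -/

lemma pth_ne_zero {v w d : ℕ} (h : sup v w d = true) (k : ZMod s) : pth K v w d k ≠ 0 := by
  have := (pathBasis K s).ne_zero ⟨(v, w, d, k), h⟩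
  rwa [pathBasis_apply] at this

variable (K s) in
/-- Evaluation of homomorphisms at the generators. -/
noncomputable def evG (n : ℕ) : HomQ K s (resE K s) n →ₗ[K] (GI s → Alg K s) where
  toFun f i := HomQ.un K s (resE K s) n f (prF K s n (sgl i 1))
  map_add' _ _ := rfl
  map_smul' _ _ := rfl

lemma prF_coe {n : ℕ} (f : QF K s n) : prF K s n f.1 = f := Subtype.ext (funext f.2)

lemma evG_injective (n : ℕ) : Function.Injective (evG K s n) := by
  intro f g h
  have key (f g : QF K s n →ₗ[Env K s] Alg K s)
      (h : ∀ i, f (prF K s n (sgl i 1)) = g (prF K s n (sgl i 1))) : f = g := by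
    refine LinearMap.ext fun x => ?_
    rw [← prF_coe x, ← sum_sgl x.1]
    simp only [map_sum]
    refine Finset.sum_congr rfl fun i _ => ?_
    rw [← mul_one (x.1 i), ← smul_sgl, map_smul, map_smul, map_smul, h]
  exact key _ _ (congrFun h)

/-- Extension of a homomorphism to the free module. -/
noncomputable def extF {n : ℕ} (f : HomQ K s (resE K s) n) : Fr K s →ₗ[Env K s] Alg K s :=
  (HomQ.un K s (resE K s) n f : QF K s n →ₗ[Env K s] Alg K s).comp (prF K s n)

lemma evG_hdelta (n : ℕ) (f : HomQ K s (resE K s) n) (i : GI s) :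
    evG K s (n + 1) (hdelta K s (resE K s) n f) i =
      idm K (n + 1) i • (extF f)
        (DD n i) := by
  rw [← map_smul, ← dF_sgl]
  change HomQ.un K s (resE K s) n f _ = HomQ.un K s (resE K s) n f _
  congr 1
  refine Eq.trans ?_ (prF_coe ⟨dF K s n (sgl i (idm K (n + 1) i)), dF_mem_QF n _⟩).symm
  refine Subtype.ext (congrArg (dF K s n) ?_)
  funext j
  change sgl i 1 j * idm K (n + 1) j = _
  rw [sgl_apply, sgl_apply]
  split_ifs with h
  · rw [h, one_mul]
  · exact zero_mul _

variable (K s) in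
/-- The values at the generators of the cochain with given coefficients. -/
noncomputable def valG (n : ℕ) : (GI s → K) →ₗ[K] (GI s → Alg K s) where
  toFun ψ i := ψ i • pth K (gB (n + 1) i.1) (gA (n + 1) i.1) (gO (n + 1) i.1 - eE n) i.2
  map_add' _ _ := funext fun _ => add_smul _ _ _
  map_smul' _ _ := funext fun _ => mul_smul _ _ _

lemma evG_hdelta_of_hasCoef {n : ℕ} {f : HomQ K s (resE K s) n} {c : GI s → ℕ → K}
    (h : HasCoef n (extF f) c) :
    evG K s (n + 1) (hdelta K s (resE K s) n f) = if (eE n : ZMod s) = 0 then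
      valG K s n (opS K s (matS n) fun j => c j (gO n j.1 - eE n)) else 0 := by
  funext i
  rw [evG_hdelta, map_dF_of_hasCoef h]
  split_ifs with hE
  · change _ = opS K s (matS n) (fun j => c j (gO n j.1 - eE n)) i •
      pth K (gB (n + 1) i.1) (gA (n + 1) i.1) (gO (n + 1) i.1 - eE n) i.2
    rw [opS_matS]
    split_ifs with hs
    · rw [sp, Bool.and_eq_true, Nat.ble_eq] at hs
      rw [idm, smul_comm, env_smul, pth_mul_ev]
      have e : (gO (n + 1) i.1 : ZMod s) = ((gO (n + 1) i.1 - eE n : ℕ) : ZMod s) := by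
        rw [Nat.cast_sub hs.1, hE, sub_zero]
      rw [e, ev_mul_pth]
    · rw [zero_smul, smul_zero]
  · exact smul_zero _

lemma exists_hom_of_coef (n : ℕ) (φ : GI s → K) (hE : (eE n : ZMod s) = 0) :
    ∃ (f : HomQ K s (resE K s) n) (c : GI s → ℕ → K),
      HasCoef n (extF f) c ∧
      ∀ i, sp n n i.1 = true → c i (gO n i.1 - eE n) = φ i := by
  let m (i : GI s) : Alg K s := if sp n n i.1 = true then
    φ i • pth K (gB n i.1) (gA n i.1) (gO n i.1 - eE n) i.2 else 0
  let F : Fr K s →ₗ[Env K s] Alg K s :=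
    ∑ i, (LinearMap.toSpanSingleton (Env K s) (Alg K s) (m i)).comp (LinearMap.proj i)
  have hF (i : GI s) (x : Env K s) : F (sgl i x) = x • m i := by
    rw [LinearMap.sum_apply, Finset.sum_eq_single i]
    · change sgl i x i • m i = _
      rw [sgl_apply, if_pos rfl]
    · intro j _ hj
      change sgl i x j • m j = _
      rw [sgl_apply, if_neg hj, zero_smul]
    · intro h; exact absurd (Finset.mem_univ _) h
  refine ⟨HomQ.mk' K s (resE K s) n (F.comp (QF K s n).subtype),
    fun i d => if sp n n i.1 = true ∧ d = gO n i.1 - eE n then φ i else 0, fun i => ?_,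
    fun i hi => if_pos ⟨hi, rfl⟩⟩
  change F (prF K s n (sgl i (idm K n i))).1 = _
  rw [prF_coe ⟨_, sgl_mem_QF (idm_mul_idm n i)⟩, hF]
  by_cases hs : sp n n i.1 = true
  · have hs' := hs
    rw [sp, Bool.and_eq_true, Nat.ble_eq] at hs'
    have e : ((gO n i.1 - eE n : ℕ) : ZMod s) = (gO n i.1 : ZMod s) := by
      rw [Nat.cast_sub hs'.1, hE, sub_zero]
    rw [Finset.sum_eq_single (gO n i.1 - eE n), e, if_pos rfl]
    · simp only [m, if_pos hs, hs, and_self, if_true]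
      rw [idm, smul_comm, env_smul, pth_mul_ev, ← e, ev_mul_pth]
    · intro d _ hd
      simp only [hd, and_false, if_false, zero_smul]
    · intro hd
      exact absurd (Finset.mem_range.2 (sup_bound hs'.2).2.2) hd
  · simp only [m, if_neg hs, smul_zero]
    exact (Finset.sum_eq_zero fun d _ => by rw [if_neg fun h => hs h.1, zero_smul]).symm

lemma finrank_range_hdelta_resE (n : ℕ) :
    Module.finrank K (LinearMap.range (hdelta K s (resE K s) n)) =
      if (eE n : ZMod s) = 0 then Module.finrank K (LinearMap.range (opS K s (matS n))) else 0 := by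
  have h1 : Module.finrank K (LinearMap.range (hdelta K s (resE K s) n)) =
      Module.finrank K (LinearMap.range ((evG K s (n + 1)).comp (hdelta K s (resE K s) n))) := by
    rw [LinearMap.range_comp]
    exact (Submodule.equivMapOfInjective _ (evG_injective (n + 1)) _).finrank_eq
  rw [h1]
  split_ifs with hE
  · have h2 : LinearMap.range ((evG K s (n + 1)).comp (hdelta K s (resE K s) n)) =
        LinearMap.range ((valG K s n).domRestrict (LinearMap.range (opS K s (matS n)))) := by
      rw [LinearMap.range_domRestrict]
      ext x
      constructor
      · rintro ⟨f, rfl⟩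
        obtain ⟨c, hc⟩ := exists_hasCoef n
          (extF f)
        rw [LinearMap.comp_apply, evG_hdelta_of_hasCoef hc, if_pos hE]
        exact ⟨_, ⟨_, rfl⟩, rfl⟩
      · rintro ⟨_, ⟨φ, rfl⟩, rfl⟩
        obtain ⟨f, c, hc, hφ⟩ := exists_hom_of_coef n φ hE
        refine ⟨f, ?_⟩
        rw [LinearMap.comp_apply, evG_hdelta_of_hasCoef hc, if_pos hE]
        exact congrArg _ (opS_matS_congr hφ)
    rw [h2]
    refine LinearMap.finrank_range_of_inj ?_
    refine (injective_iff_map_eq_zero _).2 ?_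
    rintro ⟨_, ⟨φ, rfl⟩⟩ h
    refine Subtype.ext (funext fun i => ?_)
    have hi : opS K s (matS n) φ i •
      pth K (gB (n + 1) i.1) (gA (n + 1) i.1) (gO (n + 1) i.1 - eE n) i.2 = 0 := congrFun h i
    by_cases hs : sp n (n + 1) i.1 = true
    · have hs' := hs
      rw [sp, Bool.and_eq_true] at hs'
      exact (smul_eq_zero.1 hi).resolve_right (pth_ne_zero hs'.2 _)
    · change opS K s (matS n) φ i = 0
      rw [opS_matS, if_neg hs]
  · have : (evG K s (n + 1)).comp (hdelta K s (resE K s) n) = 0 := by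
      refine LinearMap.ext fun f => ?_
      obtain ⟨c, hc⟩ := exists_hasCoef n
        (extF f)
      rw [LinearMap.comp_apply, evG_hdelta_of_hasCoef hc, if_neg hE, LinearMap.zero_apply]
    rw [this, LinearMap.range_zero, finrank_bot]

/-! ### Ranks of the coboundary matrices -/

/-- Diagonalisations of the coboundary matrices: for every `t < 22`, the number of unit pivots and a
period, the last pivot, its cofactor and the transition matrices. -/
def rkTable : List (List (List ℕ)) :=
  [
    [[5, 1], [1297, 1458], [1296], [1297, 1299, 1317, 1337, 1339, 1357, 1304, 1322, 1376, 1469,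
      1487, 1541, 1414], [1297, 1298, 1317, 1337, 1338, 1357, 1322, 1376, 1360, 1378, 1542, 1398],
      [1297, 1314, 1299, 1334, 1301, 1354, 1303, 1374, 1304, 1395, 1396], [1368, 1386, 1298, 1370,
      1388, 1318, 1372, 1390, 1338, 1374, 1392, 1358, 1376, 1394, 1396]],
    [[0, 1], [1296], [1297, 1458], [1296], [1296], [1296, 1314, 1333, 1351, 1368, 1387], [1296]],
    [[2, 1], [1296], [1297, 1458], [1297, 1316, 1373], [1297, 1316, 1301, 1320, 1341, 1343, 1345,
      1347], [1332, 1370, 1390], [1300, 1322, 1342]],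
    [[4, 2], [1296, 1458], [1297, 1458], [1297, 1334, 1408, 1320, 1339, 1410, 1484, 1503, 1574,
      1449], [1297, 1316, 1335, 1352, 1318, 1344, 1528, 1385], [1297, 1314, 1332, 1351, 1370,
      1407, 1390, 1427, 1302, 1339, 1410, 1429, 1412, 1431], [1350, 1369, 1298, 1352, 1371, 1322,
      1376, 1342, 1380]],
    [[1, 1], [1296], [1297, 1458], [1297, 1335], [1297, 1298, 1319, 1321, 1467, 1468, 1327, 1328],
      [1314, 1442], [1298, 1330]],
    [[5, 3], [1296, 1458, 1620], [1297, 1458], [1315, 1335, 1373, 1410, 1305, 1323, 1377, 1306,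
      1468, 1324, 1486, 1342, 1378, 1540, 1415, 1433], [1296, 1332, 1369, 1299, 1319, 1341, 1362,
      1329, 1365, 1383, 1545, 1401], [1459, 1368, 1335, 1406, 1481, 1390, 1356, 1428, 1305, 1467,
      1323, 1485, 1340, 1359, 1306, 1324], [1386, 1372, 1390, 1552, 1304, 1556, 1342, 1326, 1380,
      1398, 1560, 1364]],
    [[6, 4], [1297, 1458, 1621, 1782], [1296, 1458], [1386, 1244, 1336, 1247, 1302, 1339, 1179,
      1214, 1088, 1306, 1180, 1343, 1360, 1217, 1396, 1091, 1632, 1795, 1506, 1669, 1830, 1849,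
      1543, 1885, 1417, 1758], [1314, 1332, 1350, 1299, 1370, 1388, 1318, 1336, 1303, 1357, 1374,
      1392, 1340, 1538, 1306, 1488, 1365, 1382, 1544, 1562, 1094], [1404, 1441, 1316, 1280, 1336,
      1427, 1283, 1302, 1428, 1304, 1124, 1287, 1378, 1127, 1288, 1451, 1452], [1368, 1081, 1242,
      1316, 1245, 1336, 1354, 1373, 1084, 1394, 1088, 1251, 1412, 1308, 1416, 1364, 1383, 1094,
      1257, 1420]],
    [[0, 1], [1296], [1297, 1458], [1296], [1296], [1296, 1315, 1333, 1350], [1296]],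
    [[2, 1], [1297, 1458], [1296], [1296, 1299, 1316, 1481, 1372], [1296, 1298, 1316, 1318, 1466,
      1484, 1340, 1489, 1345], [1332, 1369, 1370, 1389, 1390], [1300, 1318, 1336, 1322, 1340,
      1342]],
    [[1, 1], [1296], [1297, 1458], [1297, 1226], [1297, 1486], [1297, 1314, 1333, 1298, 1209,
      1245], [1314, 1298, 1316]],
    [[1, 6], [1296, 1459, 1620], [1297, 1459, 1782, 1944], [1296, 1298, 1461, 1388], [1296, 1307,
      1468, 1324], [1296, 1459, 1386, 1298], [1314, 1306, 1325, 1486]],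
    [[1, 1], [1296], [1297, 1458], [1296, 1371], [1296, 1300, 1323, 1325, 1470, 1327], [1296,
      1388], [1296, 1324]],
    [[2, 1], [1297, 1458], [1296], [1152, 1190, 1462, 1319, 1354], [1296, 1315, 1170, 1460, 1482],
      [1296, 1206, 1243, 1334, 1226, 1245, 1372, 1391], [1296, 1171, 1318, 1340]],
    [[0, 1], [1296], [1297, 1458], [1369], [1305, 1307, 1309, 1310], [1386], [1306]],
    [[6, 4], [1297, 1458, 1621, 1782], [1296, 1458], [1332, 1262, 1372, 1320, 1375, 1322, 1377,
      1448, 1415, 1470, 1489, 1650, 1506, 1705, 1417, 1578, 1741, 1434, 1615, 1776], [1297, 1315,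
      1332, 1368, 1531, 1225, 1386, 1549, 1242, 1334, 1352, 1300, 1340, 1399, 1490, 1367, 1384],
      [1332, 1368, 1405, 1316, 1227, 1263, 1462, 1372, 1409, 1302, 1465, 1356, 1393, 1410, 1304,
      1358, 1520, 1395, 1431, 1361, 1396, 1432, 1362], [1368, 1386, 1567, 1316, 1226, 1244, 1300,
      1337, 1534, 1552, 1733, 1410, 1340, 1358, 1377, 1574, 1396, 1414, 1362, 1381, 1542, 1560,
      1578, 1741]],
    [[5, 3], [1296, 1458, 1620], [1297, 1458], [1296, 1317, 1336, 1356, 1304, 1341, 1377, 1307,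
      1342, 1378, 1540, 1415], [1296, 1317, 1336, 1356, 1304, 1341, 1377, 1325, 1360, 1378, 1470,
      1507, 1381, 1543, 1399, 1490, 1527, 1383, 1545, 1401], [1315, 1332, 1317, 1406, 1372, 1445,
      1428, 1447, 1323, 1485, 1448, 1324], [1388, 1300, 1390, 1340, 1376, 1394, 1556, 1326, 1398,
      1364, 1382, 1400, 1562, 1384, 1402, 1564]],
    [[1, 1], [1296], [1297, 1458], [1297, 1262], [1297, 1490], [1297, 1315, 1332, 1351, 1368,
      1386, 1298, 1316, 1335, 1352, 1245, 1262], [1316, 1304, 1322]],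
    [[4, 2], [1296, 1458], [1297, 1458], [1296, 1316, 1391, 1320, 1357, 1322, 1359, 1376, 1394],
      [1296, 1316, 1300, 1355, 1320, 1357, 1340, 1359, 1376, 1343, 1344, 1363, 1380, 1346], [1296,
      1332, 1298, 1406, 1444, 1302, 1428, 1304], [1368, 1300, 1373, 1326, 1381, 1364, 1383, 1348]],
    [[2, 1], [1296], [1297, 1458], [1314, 1352, 1301], [1333, 1298, 1320], [1368, 1405, 1388,
      1424, 1301, 1318, 1336, 1355], [1336, 1304, 1324]],
    [[0, 1], [1296], [1297, 1458], [1315], [1299, 1301, 1303, 1305, 1307, 1309], [1386], [1306]],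
    [[5, 1], [1297, 1458], [1296], [1314, 1334, 1354, 1374, 1305, 1323, 1341, 1358, 1376, 1307,
      1325, 1343, 1360, 1378, 1396], [1297, 1315, 1332, 1350, 1369, 1298, 1318, 1338, 1358, 1379,
      1396], [1314, 1351, 1352, 1371, 1336, 1391, 1392, 1411, 1305, 1376, 1413, 1306], [1386,
      1298, 1316, 1370, 1388, 1336, 1354, 1320, 1374, 1392, 1376, 1394, 1360]],
    [[5, 12], [1296, 1458, 1783, 2106, 2268], [1297, 1458, 1621, 1944, 2107, 2268], [1314, 1137,
      1154, 1138, 1067, 1302, 1357, 1231, 1466, 1629, 1953, 1646, 1826, 2006, 1700, 1395, 1719,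
      1792, 1954, 2116, 1649, 1811, 1829, 1991, 1361, 1523, 2009, 2171, 1378, 1703, 1865, 1558,
      1720, 1882], [1296, 1477, 1298, 1300, 1462, 1319, 1481, 1643, 1175, 1337, 1499, 1661, 1192,
      1354, 1516, 886, 1211, 1373, 1229, 1500, 1357, 1502, 1359, 1521, 1376, 1538, 1394, 1468,
      1649, 1667], [1458, 1314, 1476, 1332, 1387, 1137, 1316, 1190, 1208, 1300, 1066, 1356, 1518,
      1374, 1230, 1392, 1682, 2169, 1394, 1360], [1332, 1045, 1386, 1873, 1316, 1172, 1191, 885,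
      1046, 1208, 1226, 1551, 1713, 1874, 2036, 1300, 1319, 1481, 1175, 1337, 1499, 1192, 1354,
      886, 1211, 1229, 1391, 1714, 2039, 1392, 1358, 1215, 1377, 1395, 1718, 2043, 2205, 1378,
      1721, 2206]]]

/-- Decoding of the entries of `rkTable`. -/
def decM (x : ℕ) : ℤ × Fin 9 × Fin 9 × ℤ :=
  (bif Nat.beq (x % 2) 0 then 1 else -1, Fin.ofNat 9 (x / 2), Fin.ofNat 9 (x / 18),
    ((x / 162 : ℕ) : ℤ) - 8)

/-- An entry of `rkTable`. -/
def rkE (t j : ℕ) : SMat := ((rkTable.getD (t % 22) []).getD j []).map decM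

/-- The number of unit pivots. -/
def rkU (t : ℕ) : ℕ := ((rkTable.getD (t % 22) []).getD 0 []).getD 0 0

/-- A period of the kernel of the last pivot. -/
def rkN (t : ℕ) : ℕ := ((rkTable.getD (t % 22) []).getD 0 []).getD 1 0

/-- Product of sparse matrices. -/
def mulS (a b : SMat) : SMat :=
  a.flatMap fun x => (b.filter fun y => Nat.beq x.2.2.1 y.2.1).map fun y =>
    (x.1 * y.1, x.2.1, y.2.2.1, x.2.2.2 + y.2.2.2)

/-- Equality of positions. -/
def keyB (x y : Fin 9 × Fin 9 × ℤ) : Bool :=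
  Nat.beq x.1 y.1 && (Nat.beq x.2.1 y.2.1 && decide (x.2.2 = y.2.2))

/-- Insertion of an entry into a sparse matrix. -/
def insM (x : ℤ × Fin 9 × Fin 9 × ℤ) : SMat → SMat
  | [] => [x]
  | y :: l => bif keyB x.2 y.2 then (x.1 + y.1, y.2) :: l else y :: insM x l

/-- Equality test for sparse matrices. -/
def eqM (a b : SMat) : Bool :=
  ((a ++ b.map fun x => (-x.1, x.2)).foldr insM []).all fun x => decide (x.1 = 0)

/-- The diagonal matrix with `u` units and one further entry. -/
def dgM (u : ℕ) (l : SMat) : SMat :=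
  ((List.range u).map fun i => (1, Fin.ofNat 9 i, Fin.ofNat 9 i, 0)) ++
    l.map fun y => (y.1, Fin.ofNat 9 u, Fin.ofNat 9 u, y.2.2.2)

/-- Correctness of `rkTable`. -/
def checkR (t : ℕ) : Bool :=
  eqM (matS t) (mulS (mulS (rkE t 4) (dgM (rkU t) (rkE t 1))) (rkE t 5)) &&
  (eqM (dgM (rkU t) (rkE t 1)) (mulS (mulS (rkE t 3) (matS t)) (rkE t 6)) &&
  (eqM (mulS (dgM 0 (rkE t 2)) (dgM 0 (rkE t 1))) [(1, 0, 0, (rkN t : ℤ)), (-1, 0, 0, 0)] &&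
  (Nat.beq (Nat.gcd (rkN t) (eE t)) 1 && (Nat.beq (12 % rkN t) 0 && Nat.blt (rkU t) 9))))

lemma checkR_all : (allB 22 checkR) = true := by
  decide +kernel

lemma opU_mul (x y : Fin 9 × Fin 9 × ℤ) : opU K s x * opU K s y =
    if x.2.1 = y.1 then opU K s (x.1, y.2.1, x.2.2 + y.2.2) else 0 := by
  refine LinearMap.ext fun φ => funext fun i => ?_
  rw [Module.End.mul_apply, opU_apply, opU_apply]
  split_ifs with h1 h2 h2
  · rw [opU_apply, if_pos h1, add_assoc, ← Int.cast_add]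
  · rfl
  · rw [opU_apply, if_neg h1]
  · rfl

lemma opS_cons (x : ℤ × Fin 9 × Fin 9 × ℤ) (l : SMat) :
    opS K s (x :: l) = x.1 • opU K s x.2 + opS K s l := by simp [opS]

lemma opS_mulS (a b : SMat) : opS K s (mulS a b) = opS K s a * opS K s b := by
  have h (x : ℤ × Fin 9 × Fin 9 × ℤ) (b : SMat) :
      opS K s ((b.filter fun y => Nat.beq x.2.2.1 y.2.1).map fun y =>
        (x.1 * y.1, x.2.1, y.2.2.1, x.2.2.2 + y.2.2.2)) = (x.1 • opU K s x.2) * opS K s b := by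
    induction b with
    | nil => simp [opS]
    | cons y b ih =>
      rw [opS_cons, mul_add, ← ih, smul_mul_assoc, mul_smul_comm, smul_smul, opU_mul,
        List.filter_cons]
      by_cases e : x.2.2.1 = y.2.1
      · rw [if_pos e, if_pos (by rw [e]; exact Nat.beq_refl _), List.map_cons, opS_cons]
      · rw [if_neg e, smul_zero, zero_add, if_neg]
        exact fun h => e (Fin.ext (Nat.eq_of_beq_eq_true h))
  induction a with
  | nil => simp [opS, mulS]
  | cons x a ih =>
    rw [opS_cons, add_mul, ← ih, ← h]
    exact opS_append _ _

lemma keyB_eq {x y : Fin 9 × Fin 9 × ℤ} (h : keyB x y = true) : x = y := by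
  simp only [keyB, Bool.and_eq_true, decide_eq_true_eq] at h
  exact Prod.ext (Fin.ext (Nat.eq_of_beq_eq_true h.1))
    (Prod.ext (Fin.ext (Nat.eq_of_beq_eq_true h.2.1)) h.2.2)

lemma opS_insM (x : ℤ × Fin 9 × Fin 9 × ℤ) (l : SMat) :
    opS K s (insM x l) = x.1 • opU K s x.2 + opS K s l := by
  induction l with
  | nil => exact opS_cons x []
  | cons y l ih =>
    rw [insM]
    cases h : keyB x.2 y.2
    · rw [cond_false, opS_cons, ih, opS_cons]
      abel
    · rw [cond_true, opS_cons, opS_cons, keyB_eq h, add_smul, add_assoc]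

lemma opS_eq_of_eqM {a b : SMat} (h : eqM a b = true) : opS K s a = opS K s b := by
  have h1 (l : SMat) : opS K s (l.foldr insM []) = opS K s l := by
    induction l with
    | nil => rfl
    | cons x l ih => rw [List.foldr_cons, opS_insM, ih, opS_cons]
  have h2 (l : SMat) (hl : ∀ x ∈ l, x.1 = 0) : opS K s l = 0 := by
    refine List.sum_eq_zero fun x hx => ?_
    obtain ⟨y, hy, rfl⟩ := List.mem_map.1 hx
    rw [hl y hy, zero_smul]
  have h3 (l : SMat) : opS K s (l.map fun x => (-x.1, x.2)) = -opS K s l := by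
    induction l with
    | nil => simp [opS]
    | cons x l ih => rw [List.map_cons, opS_cons, opS_cons, ih, neg_smul, neg_add]
  have := h2 _ fun x hx => of_decide_eq_true (List.all_eq_true.1 h x hx)
  rwa [h1, opS_append, h3, ← sub_eq_add_neg, sub_eq_zero] at this

variable (K s) in
/-- The shift operator of a one-variable Laurent polynomial. -/
def thE (l : SMat) : Module.End K (ZMod s → K) :=
  (l.map fun y => y.1 • LinearMap.funLeft K K fun k : ZMod s => k + (y.2.2.2 : ZMod s)).sum

lemma thE_cons (y : ℤ × Fin 9 × Fin 9 × ℤ) (l : SMat) (φ : ZMod s → K) (k : ZMod s) :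
    thE K s (y :: l) φ k = y.1 • φ (k + (y.2.2.2 : ZMod s)) + thE K s l φ k := by
  simp [thE]

lemma opS_dgM {u : ℕ} (hu : u < 9) (l : SMat) (φ : GI s → K) (i : GI s) :
    opS K s (dgM u l) φ i = if (i.1 : ℕ) < u then φ i else
      if (i.1 : ℕ) = u then thE K s l (fun k => φ (Fin.ofNat 9 u, k)) i.2 else 0 := by
  have h1 (v : ℕ) (hv : v ≤ 9) : opS K s ((List.range v).map fun i =>
      ((1 : ℤ), Fin.ofNat 9 i, Fin.ofNat 9 i, (0 : ℤ))) φ i = if (i.1 : ℕ) < v then φ i else 0 := by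
    induction v with
    | zero => simp [opS]
    | succ v ih =>
      rw [List.range_succ, List.map_append, opS_append, LinearMap.add_apply, Pi.add_apply,
        ih (by omega), List.map_singleton, opS_cons, one_smul, LinearMap.add_apply, Pi.add_apply,
        opU_apply]
      have hv' : (Fin.ofNat 9 v : ℕ) = v := Nat.mod_eq_of_lt (by omega)
      have e : i.1 = Fin.ofNat 9 v ↔ (i.1 : ℕ) = v := by rw [Fin.ext_iff, hv']
      by_cases hi : (i.1 : ℕ) = v
      · rw [if_neg (by omega), if_pos (e.2 hi), if_pos (by omega), ← e.2 hi]
        simp [opS]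
      · rw [if_neg (mt e.1 hi)]
        have : ((i.1 : ℕ) < v + 1) ↔ ((i.1 : ℕ) < v) := by omega
        simp [opS, this]
  have h2 (l : SMat) : opS K s (l.map fun y => (y.1, Fin.ofNat 9 u, Fin.ofNat 9 u, y.2.2.2)) φ i =
      if (i.1 : ℕ) = u then thE K s l (fun k => φ (Fin.ofNat 9 u, k)) i.2 else 0 := by
    have hu' : (Fin.ofNat 9 u : ℕ) = u := Nat.mod_eq_of_lt hu
    have e : i.1 = Fin.ofNat 9 u ↔ (i.1 : ℕ) = u := by rw [Fin.ext_iff, hu']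
    induction l with
    | nil => simp [opS, thE]
    | cons y l ih =>
      rw [List.map_cons, opS_cons, LinearMap.add_apply, Pi.add_apply, ih, LinearMap.smul_apply,
        Pi.smul_apply, opU_apply]
      by_cases hi : (i.1 : ℕ) = u
      · rw [if_pos (e.2 hi), if_pos hi, if_pos hi, thE_cons]
      · rw [if_neg (mt e.1 hi), if_neg hi, if_neg hi, smul_zero, zero_add]
  rw [dgM, opS_append, LinearMap.add_apply, Pi.add_apply, h1 u hu.le, h2]
  split_ifs with h h' h' <;> first | omega | simp

lemma finrank_range_dgM {u : ℕ} (hu : u < 9) (l : SMat) :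
    Module.finrank K (LinearMap.range (opS K s (dgM u l))) =
      u * s + Module.finrank K (LinearMap.range (thE K s l)) := by
  have hu' : (Fin.ofNat 9 u : ℕ) = u := Nat.mod_eq_of_lt hu
  let J : ((Fin u → ZMod s → K) × LinearMap.range (thE K s l)) →ₗ[K] (GI s → K) :=
    { toFun := fun x i => if h : (i.1 : ℕ) < u then x.1 ⟨i.1, h⟩ i.2 else
        if (i.1 : ℕ) = u then x.2.1 i.2 else 0
      map_add' := fun x y => funext fun i => by
        simp only [Pi.add_apply, Prod.fst_add, Prod.snd_add, Submodule.coe_add]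
        split_ifs <;> simp
      map_smul' := fun c x => funext fun i => by
        simp only [Pi.smul_apply, Prod.smul_fst, Prod.smul_snd, Submodule.coe_smul, RingHom.id_apply]
        split_ifs <;> simp }
  have hJ (x) (i : GI s) : J x i = if h : (i.1 : ℕ) < u then x.1 ⟨i.1, h⟩ i.2 else
        if (i.1 : ℕ) = u then x.2.1 i.2 else 0 := rfl
  have hinj : Function.Injective J := by
    intro x y h
    refine Prod.ext (funext fun a => funext fun k => ?_) (Subtype.ext (funext fun k => ?_))
    · have := congrFun h (⟨a, a.2.trans hu⟩, k)
      rw [hJ, hJ] at this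
      simpa using this
    · have := congrFun h (Fin.ofNat 9 u, k)
      rw [hJ, hJ, dif_neg hu'.not_lt, dif_neg hu'.not_lt, if_pos hu', if_pos hu'] at this
      exact this
  have hr : LinearMap.range J = LinearMap.range (opS K s (dgM u l)) := by
    ext ψ
    constructor
    · rintro ⟨⟨f, ⟨_, ⟨g, rfl⟩⟩⟩, rfl⟩
      refine ⟨fun i => if h : (i.1 : ℕ) < u then f ⟨i.1, h⟩ i.2 else g i.2, funext fun i => ?_⟩
      rw [opS_dgM hu, hJ]
      by_cases h : (i.1 : ℕ) < u
      · simp [h]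
      · have e : ¬ (Fin.ofNat 9 u : ℕ) < u := hu'.not_lt
        simp only [h, e, dite_false, if_false]
    · rintro ⟨φ, rfl⟩
      refine ⟨(fun a k => φ (⟨a, a.2.trans hu⟩, k),
        ⟨_, ⟨fun k => φ (Fin.ofNat 9 u, k), rfl⟩⟩), funext fun i => ?_⟩
      rw [opS_dgM hu, hJ]
      split_ifs <;> rfl
  rw [← hr, LinearMap.finrank_range_of_inj hinj, Module.finrank_prod]
  simp [Module.finrank_pi_fintype, ZMod.card]

lemma eq_of_add_eq {N : ℕ} (hN : Nat.Coprime N s) {φ : ZMod s → K}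
    (h : ∀ k, φ (k + (N : ZMod s)) = φ k) (k : ZMod s) : φ k = φ 0 := by
  have hm (m : ℕ) : φ ((m : ZMod s) * (N : ZMod s)) = φ 0 := by
    induction m with
    | zero => simp
    | succ m ih => rw [Nat.cast_succ, add_mul, one_mul, h, ih]
  have := hm (k * (N : ZMod s)⁻¹).val
  rwa [ZMod.natCast_zmod_val, mul_assoc, mul_comm _ (N : ZMod s), ZMod.coe_mul_inv_eq_one N hN,
    mul_one] at this

open Classical in
lemma finrank_range_thE {l : SMat} (h : ∀ φ, thE K s l φ = 0 → ∀ k, φ k = φ 0) :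
    Module.finrank K (LinearMap.range (thE K s l)) =
      s - if (((l.map Prod.fst).sum : ℤ) : K) = 0 then 1 else 0 := by
  have hc (l : SMat) (c : K) :
      thE K s l (fun _ => c) = fun _ => (((l.map Prod.fst).sum : ℤ) : K) * c := by
    funext k
    induction l with
    | nil => simp [thE]
    | cons y l ih =>
      rw [thE_cons, ih, List.map_cons, List.sum_cons, Int.cast_add, add_mul, zsmul_eq_mul]
  have hs := LinearMap.finrank_range_add_finrank_ker (thE K s l)
  rw [Module.finrank_pi, ZMod.card] at hs
  suffices hk : Module.finrank K (LinearMap.ker (thE K s l)) =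
      if (((l.map Prod.fst).sum : ℤ) : K) = 0 then 1 else 0 by omega
  split_ifs with h0
  · have : LinearMap.ker (thE K s l) = Submodule.span K {fun _ => (1 : K)} := by
      ext φ
      rw [LinearMap.mem_ker, Submodule.mem_span_singleton]
      constructor
      · exact fun hφ => ⟨φ 0, funext fun k => by simp [h φ hφ k]⟩
      · rintro ⟨c, rfl⟩
        rw [map_smul, hc, h0]
        funext
        simp
    rw [this, finrank_span_singleton]
    exact fun h => one_ne_zero (congrFun h 0)
  · have : LinearMap.ker (thE K s l) = ⊥ := by
      refine (Submodule.eq_bot_iff _).2 fun φ hφ => ?_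
      have e : φ = fun _ => φ 0 := funext (h φ hφ)
      rw [LinearMap.mem_ker, e, hc] at hφ
      have := (mul_eq_zero.1 (congrFun hφ 0)).resolve_left h0
      rw [e, this]
      rfl
    rw [this, finrank_bot]

lemma finrank_range_comp_le {V : Type*} [AddCommGroup V] [Module K V] [Module.Finite K V]
    (a b c : Module.End K V) : Module.finrank K (LinearMap.range (a * b * c)) ≤
      Module.finrank K (LinearMap.range b) := by
  refine (Submodule.finrank_mono (?_ : _ ≤ (LinearMap.range b).map a)).trans
    (Submodule.finrank_map_le a _)
  rintro _ ⟨x, rfl⟩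
  exact ⟨b (c x), ⟨c x, rfl⟩, rfl⟩

lemma rkE_mod (t j : ℕ) : rkE (t % 22) j = rkE t j := by simp [rkE]
lemma rkU_mod (t : ℕ) : rkU (t % 22) = rkU t := by simp [rkU]
lemma rkN_mod (t : ℕ) : rkN (t % 22) = rkN t := by simp [rkN]

open Classical in
lemma finrank_range_opS_matS {n : ℕ} (hn : (eE n : ZMod s) = 0) :
    Module.finrank K (LinearMap.range (opS K s (matS n))) = rkU n * s +
      (s - if ((((rkE n 1).map Prod.fst).sum : ℤ) : K) = 0 then 1 else 0) := by
  have h := allB_spec checkR_all (Nat.mod_lt n (by norm_num : 0 < 22))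
  simp only [checkR, Bool.and_eq_true, matS_mod, rkE_mod, rkU_mod, rkN_mod] at h
  obtain ⟨h1, h2, h3, h4, h5, h6⟩ := h
  have e1 := opS_eq_of_eqM (K := K) (s := s) h1
  have e2 := opS_eq_of_eqM (K := K) (s := s) h2
  have e3 := opS_eq_of_eqM (K := K) (s := s) h3
  rw [opS_mulS, opS_mulS] at e1 e2
  rw [opS_mulS] at e3
  have hu : rkU n < 9 := Nat.le_of_ble_eq_true h6
  rw [← finrank_range_thE (l := rkE n 1), ← finrank_range_dgM hu]
  · refine le_antisymm ?_ ?_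
    · rw [e1]; exact finrank_range_comp_le _ _ _
    · rw [e2]; exact finrank_range_comp_le _ _ _
  · intro φ hφ
    have hcop : Nat.Coprime (rkN n) s := by
      have hd : s ∣ eE n := (ZMod.natCast_eq_zero_iff _ _).1 hn
      refine Nat.Coprime.coprime_dvd_right hd ?_
      obtain ⟨m, hm⟩ := Nat.dvd_of_mod_eq_zero (Nat.eq_of_beq_eq_true h5)
      rw [eE_mod, hm, mul_assoc, Nat.coprime_add_mul_left_right]
      exact Nat.eq_of_beq_eq_true h4
    refine eq_of_add_eq hcop fun k => ?_
    have := congrFun (LinearMap.congr_fun e3 fun i : GI s => φ i.2) (0, k)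
    rw [Module.End.mul_apply] at this
    have hz : opS K s (dgM 0 (rkE n 1)) (fun i : GI s => φ i.2) = 0 := by
      funext i
      rw [opS_dgM (by norm_num)]
      simp only [Nat.not_lt_zero, if_false, hφ]
      split_ifs <;> rfl
    rw [hz, map_zero, opS_cons, opS_cons] at this
    simpa [opU_apply, opS, add_neg_eq_zero, eq_comm] using this

/-! ### The dimensions of the coboundary groups -/

lemma natCast_eq_zero_iff_ringChar (p : ℕ) [hp : Fact p.Prime] : (p : K) = 0 ↔ ringChar K = p := by
  rw [ringChar.spec]
  refine ⟨fun h => ?_, fun h => h ▸ dvd_rfl⟩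
  exact (hp.out.eq_one_or_self_of_dvd _ h).resolve_left (CharP.ringChar_ne_one)

/-- The numbers of unit pivots and the values at `1` of the last pivots. -/
lemma rk_values : (List.range 22).map (fun t => (rkU t, ((rkE t 1).map Prod.fst).sum)) =
    [(5, 0), (0, 1), (2, 1), (4, 2), (1, 1), (5, 3), (6, 0), (0, 1), (2, 0), (1, 1), (1, 1),
      (1, 1), (2, 0), (0, 1), (6, 0), (5, 3), (1, 1), (4, 2), (2, 1), (0, 1), (5, 0), (5, 3)] := by
  decide +kernel

open Classical in
lemma imDim_eq (t : ℕ) : imDim (ringChar K) s t = if (eE t : ZMod s) = 0 then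
    rkU t * s + (s - if ((((rkE t 1).map Prod.fst).sum : ℤ) : K) = 0 then 1 else 0) else 0 := by
  have hs : 0 < s := Nat.pos_of_neZero s
  have hc : ((6 * (t / 11) + t % 11 / 2) % s == 0 % s) = decide ((eE t : ZMod s) = 0) := by
    rw [Bool.eq_iff_iff, beq_iff_eq, decide_eq_true_eq, ZMod.natCast_eq_zero_iff, Nat.zero_mod,
      Nat.dvd_iff_mod_eq_zero, eE]
  have h2 : (2 : K) = 0 ↔ ringChar K = 2 := by
    have : Fact (Nat.Prime 2) := ⟨Nat.prime_two⟩
    exact_mod_cast natCast_eq_zero_iff_ringChar (K := K) 2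
  have h3 : (3 : K) = 0 ↔ ringChar K = 3 := by
    have : Fact (Nat.Prime 3) := ⟨Nat.prime_three⟩
    exact_mod_cast natCast_eq_zero_iff_ringChar (K := K) 3
  simp only [imDim, hc]
  by_cases hE : (eE t : ZMod s) = 0
  · simp only [hE, decide_true, Bool.true_and, if_true]
    rw [← rkU_mod, ← rkE_mod]
    have e1 : t / 11 % 2 = t % 22 / 11 := by omega
    have e2 : t % 11 = t % 22 % 11 := by omega
    rw [e1, e2]
    have hr := congrArg (fun l => l[t % 22]?) rk_values
    have hlt : t % 22 < 22 := Nat.mod_lt _ (by norm_num)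
    generalize t % 22 = r at hr hlt ⊢
    interval_cases r <;>
    · simp at hr
      obtain ⟨hr1, hr2⟩ := hr
      rw [hr1, hr2]
      simp [h2, h3] <;> first | omega | (split_ifs <;> omega)
  · simp [hE]

end Resolution

/-- Dimensions of the coboundary groups `Im δ^t` of the complex
`Hom_Λ(Q_•, R)` obtained by applying `Hom_Λ(-, R)` to the minimal projective
`Λ`-resolution of `R = R_s`. -/
theorem im_delta_dims (K : Type u) [Field K] (s : ℕ) (hs : 0 < s)
    (res : ProjRes (Env K s) (Alg K s)) (hmin : res.Minimal) (t : ℕ) :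
    Module.finrank K ↥(LinearMap.range (hdelta K s res t)) = imDim (ringChar K) s t := by
  have : NeZero s := ⟨hs.ne'⟩
  rw [finrank_range_hdelta res (resE K s) hmin resE_minimal t, finrank_range_hdelta_resE, imDim_eq]
  by_cases h : (eE t : ZMod s) = 0
  · rw [if_pos h, if_pos h, finrank_range_opS_matS h]
  · rw [if_neg h, if_neg h]

end E6
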